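/- Let n ≥ 1, let F, F₀ satisfy (H0) and (H1), and let u be a Lipschitz solution of the boundary (Signorini) obstacle problem in B₁⁺ ⊂ ℝ^{n+1}. Then u ∈ C¹(B₁⁺ ∪ B₁'): u is continuously differentiable in the open half-ball B₁⁺ and its gradient ∇u extends to a continuous map on B₁⁺ ∪ B₁'. -/

import Mathlib

open MeasureTheory Metric Filter
open scoped InnerProductSpace NNReal ENNReal Topology

noncomputable section

/-- Euclidean space `ℝ^{n+1}`. -/
abbrev Eucl (n : ℕ) : Type := EuclideanSpace ℝ (Fin (n + 1))

namespace TOP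

variable {n : ℕ}

/-- The `(n+1)`-st standard basis vector `e_{n+1}`. -/
def eLast (n : ℕ) : Eucl n := EuclideanSpace.single (Fin.last n) 1

/-- Open upper half ball `B_r⁺(x₀)`. -/
def hBall (x₀ : Eucl n) (r : ℝ) : Set (Eucl n) :=
  Metric.ball x₀ r ∩ {x : Eucl n | 0 < x (Fin.last n)}

/-- Open lower half ball `B_r⁻(x₀)`. -/
def hBallNeg (x₀ : Eucl n) (r : ℝ) : Set (Eucl n) :=
  Metric.ball x₀ r ∩ {x : Eucl n | x (Fin.last n) < 0}

/-- Thin ball `B_r'(x₀)`. -/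
def tBall (x₀ : Eucl n) (r : ℝ) : Set (Eucl n) :=
  Metric.ball x₀ r ∩ {x : Eucl n | x (Fin.last n) = 0}

/-- (H0): `F` and `F₀` are of class `C¹` on `B₁ × ℝ × ℝ^{n+1}`. -/
def H0 (F : Eucl n → ℝ → Eucl n → Eucl n) (F₀ : Eucl n → ℝ → Eucl n → ℝ) : Prop :=
  ContDiffOn ℝ 1 (fun q : Eucl n × ℝ × Eucl n => F q.1 q.2.1 q.2.2)
      (Metric.ball (0 : Eucl n) 1 ×ˢ (Set.univ : Set ℝ) ×ˢ (Set.univ : Set (Eucl n))) ∧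
    ContDiffOn ℝ 1 (fun q : Eucl n × ℝ × Eucl n => F₀ q.1 q.2.1 q.2.2)
      (Metric.ball (0 : Eucl n) 1 ×ˢ (Set.univ : Set ℝ) ×ˢ (Set.univ : Set (Eucl n)))

/-- (H1): uniform ellipticity of `D_pF` on compact subsets. -/
def H1 (F : Eucl n → ℝ → Eucl n → Eucl n) : Prop :=
  ∀ M : ℝ, 0 < M → ∃ lam : ℝ, 0 < lam ∧
    ∀ x ∈ Metric.ball (0 : Eucl n) 1, ∀ z : ℝ, |z| ≤ M → ∀ p : Eucl n, ‖p‖ ≤ M →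
      ∀ ξ : Eucl n, lam * ‖ξ‖ ^ 2 ≤ ⟪fderiv ℝ (F x z) p ξ, ξ⟫_ℝ

/-- (H1) with a prescribed ellipticity function `lam : M ↦ λ(M)`. -/
def H1With (lam : ℝ → ℝ) (F : Eucl n → ℝ → Eucl n → Eucl n) : Prop :=
  ∀ M : ℝ, 0 < M → 0 < lam M ∧
    ∀ x ∈ Metric.ball (0 : Eucl n) 1, ∀ z : ℝ, |z| ≤ M → ∀ p : Eucl n, ‖p‖ ≤ M →
      ∀ ξ : Eucl n, lam M * ‖ξ‖ ^ 2 ≤ ⟪fderiv ℝ (F x z) p ξ, ξ⟫_ℝ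

/-- `div_x F (x, z, p) = ∑ᵢ ∂_{xᵢ} Fᵢ (x, z, p)`. -/
def divx (F : Eucl n → ℝ → Eucl n → Eucl n) (x : Eucl n) (z : ℝ) (p : Eucl n) : ℝ :=
  ∑ i : Fin (n + 1), fderiv ℝ (fun y : Eucl n => F y z p i) x (EuclideanSpace.single i 1)

/-- `(F, F₀)` is `t`-rescaled with bound function `L : M ↦ L(M)`. -/
def Rescaled (t : ℝ) (L : ℝ → ℝ) (F : Eucl n → ℝ → Eucl n → Eucl n)
    (F₀ : Eucl n → ℝ → Eucl n → ℝ) : Prop :=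
  ∀ M : ℝ, 0 < M → ∀ x ∈ Metric.ball (0 : Eucl n) 1, ∀ z : ℝ, |z| ≤ M →
    ∀ p : Eucl n, ‖p‖ ≤ M →
      |(- divx F x z p - ⟪deriv (fun s : ℝ => F x s p) z, p⟫_ℝ + F₀ x z p)| ≤ t * L M ∧
        ‖fderiv ℝ (F x z) p‖ ≤ L M

/-- The operator `H_t` acting classically on a `C²` function `φ`:
`H_t(φ)(x) = −div_x F − ⟨∂_z F, ∇φ⟩ − tr(D_pF · D²φ) + F₀`, all evaluated at
`(x, φ(x), ∇φ(x))`. -/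
def Hop (F : Eucl n → ℝ → Eucl n → Eucl n) (F₀ : Eucl n → ℝ → Eucl n → ℝ)
    (φ : Eucl n → ℝ) (x : Eucl n) : ℝ :=
  - divx F x (φ x) (gradient φ x)
    - ⟪deriv (fun s : ℝ => F x s (gradient φ x)) (φ x), gradient φ x⟫_ℝ
    - ∑ i : Fin (n + 1),
        ⟪fderiv ℝ (F x (φ x)) (gradient φ x)
          (fderiv ℝ (gradient φ) x (EuclideanSpace.single i 1)), EuclideanSpace.single i 1⟫_ℝ
    + F₀ x (φ x) (gradient φ x)

/-- The admissible class `A_g` for the thin obstacle problem: `W^{1,∞}(B₁)` functions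
with boundary value `g` on `∂B₁` which are nonnegative on `B₁'`. -/
def AdmissibleThin (g v : Eucl n → ℝ) : Prop :=
  (∃ C : ℝ≥0, LipschitzOnWith C v (Metric.closedBall (0 : Eucl n) 1)) ∧
    (∀ x ∈ Metric.sphere (0 : Eucl n) 1, v x = g x) ∧
    ∀ x ∈ tBall (0 : Eucl n) 1, 0 ≤ v x

/-- A (Lipschitz) solution of the thin obstacle problem in `B₁`. -/
def ThinSolution (F : Eucl n → ℝ → Eucl n → Eucl n) (F₀ : Eucl n → ℝ → Eucl n → ℝ)
    (g u : Eucl n → ℝ) : Prop :=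
  AdmissibleThin g u ∧
    ∀ v : Eucl n → ℝ, AdmissibleThin g v →
      0 ≤ ∫ x in Metric.ball (0 : Eucl n) 1,
        (⟪F x (u x) (gradient u x), gradient v x - gradient u x⟫_ℝ +
          F₀ x (u x) (gradient u x) * (v x - u x))

/-- The admissible class `A_g` for the boundary (Signorini) obstacle problem:
`W^{1,∞}(B₁⁺)` functions with boundary value `g` on `∂B₁⁺ ∖ B₁'` which are
nonnegative on `B₁'`. -/
def AdmissibleBdry (g v : Eucl n → ℝ) : Prop :=
  (∃ C : ℝ≥0, LipschitzOnWith C v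
      (Metric.closedBall (0 : Eucl n) 1 ∩ {x : Eucl n | 0 ≤ x (Fin.last n)})) ∧
    (∀ x : Eucl n, ‖x‖ = 1 → 0 ≤ x (Fin.last n) → v x = g x) ∧
    ∀ x ∈ tBall (0 : Eucl n) 1, 0 ≤ v x

/-- A (Lipschitz) solution of the boundary (Signorini) obstacle problem in `B₁⁺`. -/
def BdrySolution (F : Eucl n → ℝ → Eucl n → Eucl n) (F₀ : Eucl n → ℝ → Eucl n → ℝ)
    (g u : Eucl n → ℝ) : Prop :=
  AdmissibleBdry g u ∧
    ∀ v : Eucl n → ℝ, AdmissibleBdry g v →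
      0 ≤ ∫ x in hBall (0 : Eucl n) 1,
        (⟪F x (u x) (gradient u x), gradient v x - gradient u x⟫_ℝ +
          F₀ x (u x) (gradient u x) * (v x - u x))

/-- The coincidence set `Λ(u) = {x ∈ B₁' : u(x) = 0}`. -/
def coincidenceSet (u : Eucl n → ℝ) : Set (Eucl n) :=
  {x ∈ tBall (0 : Eucl n) 1 | u x = 0}

/-- The free boundary `Γ(u)`: the boundary of `Λ(u)` in the relative topology of `B₁'`. -/
def freeBoundary (u : Eucl n → ℝ) : Set (Eucl n) :=
  {x ∈ coincidenceSet u |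
    ∀ r : ℝ, 0 < r → ∃ y ∈ tBall (0 : Eucl n) 1, y ∈ Metric.ball x r ∧ 0 < u y}

/-- `w` satisfies the Caccioppoli inequality with constant `Q` at `x₀ ∈ B₁'`. -/
def CaccAt (w : Eucl n → ℝ) (Q : ℝ) (x₀ : Eucl n) : Prop :=
  ∀ k : ℝ, 0 ≤ k → ∀ r R : ℝ, 0 < r → r < R → R < 1 - ‖x₀‖ →
    (∫ x in ({x : Eucl n | k ≤ w x} ∩ hBall x₀ r), ‖gradient w x‖ ^ 2) ≤
      Q / (R - r) ^ 2 * (∫ x in ({x : Eucl n | k ≤ w x} ∩ hBall x₀ R), (w x - k) ^ 2) +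
        Q * (volume ({x : Eucl n | k ≤ w x} ∩ hBall x₀ R)).toReal

/-- Difference quotient `D_e^h w (x) = (w(x + h e) − w(x))/h`. -/
def diffQuot (h : ℝ) (e : Eucl n) (w : Eucl n → ℝ) (x : Eucl n) : ℝ :=
  (w (x + h • e) - w x) / h

/-- The barrier function `η(x) = t(|x' − x₀'|² − K x_{n+1}²) + m x_{n+1} + γ`. -/
def etaFn (x₀ : Eucl n) (t K m γ : ℝ) (x : Eucl n) : ℝ :=
  t * ((∑ i : Fin n, (x i.castSucc - x₀ i.castSucc) ^ 2) - K * (x (Fin.last n)) ^ 2) +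
    m * x (Fin.last n) + γ

end TOP

namespace Signorini

variable {n : ℕ}

/-- The open upper half space `{x | 0 < x_{n+1}}`. -/
def upper (n : ℕ) : Set (Eucl n) := {x | 0 < x (Fin.last n)}

lemma continuous_last : Continuous fun x : Eucl n => x (Fin.last n) := by fun_prop

lemma isOpen_upper : IsOpen (upper n) := isOpen_lt continuous_const continuous_last

lemma measurableSet_upper : MeasurableSet (upper n) := isOpen_upper.measurableSet

lemma convex_upper : Convex ℝ (upper n) := by
  intro x hx y hy a b ha hb hab
  simp only [upper, Set.mem_ofPred_eq, PiLp.add_apply, PiLp.smul_apply, smul_eq_mul] at *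
  rcases ha.eq_or_lt with rfl | ha
  · have : b = 1 := by linarith
    subst this; simpa using hy
  · have := mul_pos ha hx
    have := mul_nonneg hb hy.le
    linarith

lemma norm_gradient {E : Type*} [NormedAddCommGroup E] [InnerProductSpace ℝ E] [CompleteSpace E]
    (f : E → ℝ) (x : E) : ‖gradient f x‖ = ‖fderiv ℝ f x‖ := by
  simp [gradient]

lemma gradient_congr {f g : Eucl n → ℝ} {x : Eucl n} (h : f =ᶠ[𝓝 x] g) :
    gradient f x = gradient g x := by
  simp [gradient, h.fderiv_eq]

lemma gradient_eq_zero_of_min {f : Eucl n → ℝ} {x : Eucl n} (h : ∀ y, f x ≤ f y) :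
    gradient f x = 0 := by
  have : IsLocalMin f x := Filter.Eventually.of_forall h
  simp [gradient, this.fderiv_eq_zero]

lemma gradient_eq_zero_of_nonneg {f : Eucl n → ℝ} {x : Eucl n} (h : ∀ y, 0 ≤ f y)
    (hx : f x = 0) : gradient f x = 0 :=
  gradient_eq_zero_of_min (by simpa [hx] using h)

lemma measurable_gradient (f : Eucl n → ℝ) : Measurable (gradient f) := by
  unfold gradient
  exact (LinearIsometryEquiv.continuous _).measurable.comp (measurable_fderiv ℝ f)

lemma norm_gradient_le {C : ℝ≥0} {f : Eucl n → ℝ} (hf : LipschitzWith C f) (x : Eucl n) :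
    ‖gradient f x‖ ≤ C := by
  rw [norm_gradient]; exact norm_fderiv_le_of_lipschitz ℝ hf

lemma ae_hasGradientAt {C : ℝ≥0} {f : Eucl n → ℝ} (hf : LipschitzWith C f) :
    ∀ᵐ x, HasGradientAt f (gradient f x) x := by
  filter_upwards [hf.ae_differentiableAt] with x hx using hx.hasGradientAt

lemma gradient_max_sub {w : Eucl n → ℝ} (hw : Continuous w) (k : ℝ) (x : Eucl n) :
    gradient (fun y => max (w y - k) 0) x = if k < w x then gradient w x else 0 := by
  split_ifs with h
  · have : (fun y => max (w y - k) 0) =ᶠ[𝓝 x] fun y => w y - k := by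
      filter_upwards [hw.continuousAt.eventually (lt_mem_nhds h)] with y hy
      exact max_eq_left (by linarith)
    rw [gradient_congr this]
    simp [gradient, fderiv_sub_const]
  · apply gradient_eq_zero_of_nonneg (fun y => le_max_right _ _)
    exact max_eq_right (by linarith [not_lt.1 h])

lemma hasGradientAt_mul {f g : Eucl n → ℝ} {f' g' x : Eucl n} (hf : HasGradientAt f f' x)
    (hg : HasGradientAt g g' x) :
    HasGradientAt (fun y => f y * g y) (f x • g' + g x • f') x := by
  rw [hasGradientAt_iff_hasFDerivAt] at *
  refine (hf.mul hg).congr_fderiv ?_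
  ext v
  simp

lemma finrank_eucl : Module.finrank ℝ (Eucl n) = n + 1 := by simp

/-- The volume of the upper half of the unit ball. -/
def halfVol (n : ℕ) : ℝ := volume.real (ball (0 : Eucl n) 1 ∩ upper n)

lemma halfVol_pos : 0 < halfVol n := by
  unfold halfVol
  rw [measureReal_def, ENNReal.toReal_pos_iff]
  constructor
  · apply (isOpen_ball.inter isOpen_upper).measure_pos volume
    refine ⟨(1 / 2 : ℝ) • EuclideanSpace.single (Fin.last n) (1 : ℝ), ?_, ?_⟩
    · simp [norm_smul]; norm_num
    · simp [upper]
  · exact (measure_mono Set.inter_subset_left).trans_lt measure_ball_lt_top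

open scoped Pointwise in
lemma smul_upper {r : ℝ} (hr : 0 < r) : r • upper n = upper n := by
  ext x
  rw [Set.mem_smul_set_iff_inv_smul_mem₀ hr.ne']
  simp [upper, hr]

open scoped Pointwise in
lemma volume_half_ball {r : ℝ} (hr : 0 < r) :
    volume.real (ball (0 : Eucl n) r ∩ upper n) = r ^ (n + 1) * halfVol n := by
  have : ball (0 : Eucl n) r ∩ upper n = r • (ball (0 : Eucl n) 1 ∩ upper n) := by
    rw [Set.smul_set_inter₀ hr.ne', smul_upper hr, smul_unitBall hr.ne', Real.norm_of_nonneg hr.le]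
  rw [this, measureReal_def, Measure.addHaar_smul, finrank_eucl, ENNReal.toReal_mul, halfVol,
    measureReal_def, ENNReal.toReal_ofReal (abs_nonneg _), abs_of_nonneg (by positivity)]

/-- The volume of the unit ball. -/
def ballVol (n : ℕ) : ℝ := volume.real (ball (0 : Eucl n) 1)

lemma ballVol_pos : 0 < ballVol n :=
  ENNReal.toReal_pos (measure_ball_pos _ _ one_pos).ne' measure_ball_lt_top.ne

lemma volume_real_ball (x : Eucl n) {r : ℝ} (hr : 0 < r) :
    volume.real (ball x r) = r ^ (n + 1) * ballVol n := by
  rw [measureReal_def, Measure.addHaar_ball_of_pos _ _ hr, finrank_eucl, ENNReal.toReal_mul,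
    ballVol, measureReal_def, ENNReal.toReal_ofReal (by positivity)]

lemma volume_inter_upper_lt_top (x : Eucl n) (r : ℝ) (s : Set (Eucl n)) :
    volume (ball x r ∩ s) < ∞ :=
  (measure_mono Set.inter_subset_left).trans_lt measure_ball_lt_top

lemma volume_ball_inter_upper_le (x : Eucl n) {r : ℝ} (hr : 0 < r) (s : Set (Eucl n)) :
    volume.real (ball x r ∩ s) ≤ r ^ (n + 1) * ballVol n := by
  rw [← volume_real_ball x hr]
  exact measureReal_mono Set.inter_subset_left measure_ball_lt_top.ne

lemma le_volume_ball_inter_upper {x : Eucl n} (hx : 0 ≤ x (Fin.last n)) {r : ℝ} (hr : 0 < r) :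
    r ^ (n + 1) * halfVol n ≤ volume.real (ball x r ∩ upper n) := by
  rw [← volume_half_ball hr]
  have h : (fun y => x + y) '' (ball (0 : Eucl n) r ∩ upper n) ⊆ ball x r ∩ upper n := by
    rintro _ ⟨y, ⟨hy, hy'⟩, rfl⟩
    simp only [upper, Set.mem_ofPred_eq, mem_ball, dist_zero_right] at *
    refine ⟨by simpa using hy, ?_⟩
    simp only [Set.mem_ofPred_eq, PiLp.add_apply]; linarith
  calc _ = volume.real ((fun y => x + y) '' (ball (0 : Eucl n) r ∩ upper n)) := by
        rw [measureReal_def, measureReal_def, Set.image_add_left, measure_preimage_add]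
    _ ≤ _ := measureReal_mono h (volume_inter_upper_lt_top x r _).ne

lemma integrableOn_of_continuous_ball {f : Eucl n → ℝ} (hf : Continuous f) (x : Eucl n) (r : ℝ)
    (s : Set (Eucl n)) : IntegrableOn f (ball x r ∩ s) :=
  (hf.locallyIntegrable.integrableOn_isCompact (isCompact_closedBall x r)).mono_set
    (Set.inter_subset_left.trans ball_subset_closedBall)

lemma abs_pow_le_telescope (a : ℕ → ℝ) (p N : ℕ) (hN : 0 < N) :
    |a N - a 0| ^ (p + 1) ≤ (N : ℝ)⁻¹ * ∑ j ∈ Finset.range N, (N * |a (j + 1) - a j|) ^ (p + 1) := by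
  have hN' : (0 : ℝ) < N := by exact_mod_cast hN
  have h1 : |a N - a 0| ≤ ∑ j ∈ Finset.range N, |a (j + 1) - a j| := by
    rw [← Finset.sum_range_sub]; exact Finset.abs_sum_le_sum_abs _ _
  have h2 := pow_sum_div_card_le_sum_pow (s := Finset.range N) (f := fun j => |a (j + 1) - a j|)
    (fun i _ => abs_nonneg _) p
  rw [Finset.card_range, div_le_iff₀ (by positivity)] at h2
  calc |a N - a 0| ^ (p + 1) ≤ (∑ j ∈ Finset.range N, |a (j + 1) - a j|) ^ (p + 1) :=
        pow_le_pow_left₀ (abs_nonneg _) h1 _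
    _ ≤ _ := h2
    _ = _ := by
      simp_rw [mul_pow, ← Finset.mul_sum]
      field_simp
      ring

lemma setIntegral_translate_le {g : Eucl n → ℝ} {A B : Set (Eucl n)} (hA : MeasurableSet A)
    (hB : MeasurableSet B) (hg : 0 ≤ g) (hgi : IntegrableOn g B) (v : Eucl n)
    (h : ∀ x ∈ A, x + v ∈ B) : ∫ x in A, g (x + v) ≤ ∫ x in B, g x := by
  rw [← integral_indicator hA, ← integral_indicator hB,
    ← integral_add_right_eq_self (fun x => B.indicator g x) v]
  apply integral_mono_of_nonneg
  · exact Eventually.of_forall fun x => Set.indicator_nonneg (fun y _ => hg _) x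
  · exact ((integrable_indicator_iff hB).2 hgi).comp_add_right v
  · refine Eventually.of_forall fun x => ?_
    by_cases hx : x ∈ A
    · simp [hx, h x hx]
    · simpa only [Set.indicator_of_notMem hx] using
        Set.indicator_nonneg (fun y _ => hg y) (x + v)

lemma integral_translate_sub_le {C : ℝ≥0} {f : Eucl n → ℝ} (hf : LipschitzWith C f)
    {B : Set (Eucl n)} (hB : Convex ℝ B) (hm : MeasurableSet B) (hfin : volume B < ∞)
    (z : Eucl n) (p : ℕ) :
    ∫ x in B ∩ {x | x + z ∈ B}, |f (x + z) - f x| ^ (p + 1) ≤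
      ∫ x in B, |⟪gradient f x, z⟫_ℝ| ^ (p + 1) := by
  set A := B ∩ {x | x + z ∈ B} with hAdef
  have hAm : MeasurableSet A := hm.inter ((measurable_id.add_const z) hm)
  have hfc := hf.continuous
  set g : ℕ → Eucl n → ℝ := fun N y =>
    (N * |f (y + (N : ℝ)⁻¹ • z) - f y|) ^ (p + 1) with hg
  have hgc : ∀ N, Continuous (g N) := fun N => by simp only [hg]; fun_prop
  have hg0 : ∀ N, 0 ≤ g N := fun N y => by simp only [hg]; positivity
  have hgb : ∀ N y, ‖g N y‖ ≤ (C * ‖z‖) ^ (p + 1) := by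
    intro N y
    rw [Real.norm_of_nonneg (hg0 N y)]
    simp only [hg]
    refine pow_le_pow_left₀ (by positivity) ?_ _
    rcases Nat.eq_zero_or_pos N with rfl | hN
    · simp; positivity
    have h1 := hf.dist_le_mul (y + (N : ℝ)⁻¹ • z) y
    rw [Real.dist_eq, dist_eq_norm, add_sub_cancel_left, norm_smul, norm_inv, Real.norm_natCast] at h1
    have hN' : (0 : ℝ) < N := by exact_mod_cast hN
    calc (N : ℝ) * |f (y + (N : ℝ)⁻¹ • z) - f y| ≤ N * (C * ((N : ℝ)⁻¹ * ‖z‖)) := by gcongr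
      _ = _ := by field_simp
  have hgi : ∀ N, IntegrableOn (g N) B := fun N =>
    Measure.integrableOn_of_bounded hfin.ne (hgc N).aestronglyMeasurable
      (Eventually.of_forall (hgb N))
  have key : ∀ N : ℕ, 0 < N → ∫ x in A, |f (x + z) - f x| ^ (p + 1) ≤ ∫ x in B, g N x := by
    intro N hN
    have hN' : (0 : ℝ) < N := by exact_mod_cast hN
    have hAfin : volume A < ∞ := (measure_mono Set.inter_subset_left).trans_lt hfin
    have hi : ∀ v, IntegrableOn (fun x => g N (x + v)) A := fun v =>
      Measure.integrableOn_of_bounded hAfin.ne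
        ((hgc N).comp (continuous_add_const v)).aestronglyMeasurable
        (Eventually.of_forall fun x => hgb N _)
    calc ∫ x in A, |f (x + z) - f x| ^ (p + 1)
        ≤ ∫ x in A, (N : ℝ)⁻¹ * ∑ j ∈ Finset.range N, g N (x + ((j : ℝ) * (N : ℝ)⁻¹) • z) := by
          apply integral_mono_of_nonneg
          · exact Eventually.of_forall fun x => by positivity
          · exact (integrable_finsetSum _ fun j _ => hi _).const_mul _
          · refine Eventually.of_forall fun x => ?_
            have := abs_pow_le_telescope (fun j => f (x + ((j : ℝ) * (N : ℝ)⁻¹) • z)) p N hN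
            simp only [mul_inv_cancel₀ hN'.ne', one_smul, Nat.cast_zero, zero_mul, zero_smul,
              add_zero] at this
            refine this.trans (le_of_eq ?_)
            simp only [hg]
            congr 1
            refine Finset.sum_congr rfl fun j _ => ?_
            rw [add_assoc, ← add_smul]
            push_cast
            ring_nf
      _ = (N : ℝ)⁻¹ * ∑ j ∈ Finset.range N, ∫ x in A, g N (x + ((j : ℝ) * (N : ℝ)⁻¹) • z) := by
          rw [integral_const_mul, integral_finsetSum _ fun j _ => hi _]
      _ ≤ (N : ℝ)⁻¹ * ∑ j ∈ Finset.range N, ∫ x in B, g N x := by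
          gcongr with j hj
          refine setIntegral_translate_le hAm hm (hg0 N) (hgi N) _ ?_
          rintro x ⟨hx, hx'⟩
          have hj' : (j : ℝ) ≤ N := by exact_mod_cast (Finset.mem_range.1 hj).le
          have := hB.add_smul_sub_mem hx hx' (t := (j : ℝ) * (N : ℝ)⁻¹)
            ⟨by positivity, by rw [← div_eq_mul_inv]; exact div_le_one_of_le₀ hj' hN'.le⟩
          simpa using this
      _ = _ := by
          rw [Finset.sum_const, Finset.card_range, nsmul_eq_mul]; field_simp
  have lim : Tendsto (fun N => ∫ x in B, g N x) atTop
      (𝓝 (∫ x in B, |⟪gradient f x, z⟫_ℝ| ^ (p + 1))) := by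
    refine tendsto_integral_of_dominated_convergence (fun _ => (C * ‖z‖) ^ (p + 1))
      (fun N => (hgc N).aestronglyMeasurable) ?_ (fun N => Eventually.of_forall (hgb N)) ?_
    · exact integrableOn_const hfin.ne
    · refine ae_restrict_of_ae ?_
      filter_upwards [ae_hasGradientAt hf] with x hx
      have h1 := (hx.hasFDerivAt.hasLineDerivAt z).tendsto_slope_zero_right
      have h2 : Tendsto (fun N : ℕ => (N : ℝ)⁻¹) atTop (𝓝[>] 0) :=
        tendsto_inv_atTop_nhdsGT_zero.comp tendsto_natCast_atTop_atTop
      have h3 := ((h1.comp h2).abs).pow (p + 1)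
      refine (h3.congr fun N => ?_)
      simp [hg, abs_mul]
  exact ge_of_tendsto lim (eventually_atTop.2 ⟨1, fun N hN => key N hN⟩)

lemma integrable_of_bounded_of_support {g : Eucl n → ℝ} (hg : AEStronglyMeasurable g volume)
    {K R : ℝ} {x₀ : Eucl n} (hb : ∀ x, ‖g x‖ ≤ K) (h0 : ∀ x, x ∉ closedBall x₀ R → g x = 0) :
    Integrable g := by
  rw [← integrableOn_iff_integrable_of_support_subset (s := closedBall x₀ R)]
  · exact Measure.integrableOn_of_bounded measure_closedBall_lt_top.ne hg
      (Eventually.of_forall hb)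
  · intro x hx; by_contra h; exact hx (h0 x h)

lemma gradient_eq_zero_of_notMem {f : Eucl n → ℝ} {S : Set (Eucl n)} (hS : IsClosed S)
    (h0 : ∀ x, x ∉ S → f x = 0) {x : Eucl n} (hx : x ∉ S) : gradient f x = 0 := by
  have : f =ᶠ[𝓝 x] fun _ => 0 := by
    filter_upwards [hS.isOpen_compl.mem_nhds hx] with y hy using h0 y hy
  rw [gradient_congr this]; simp [gradient]

lemma integrable_norm_gradient_sq {C : ℝ≥0} {f : Eucl n → ℝ} (hf : LipschitzWith C f)
    {R : ℝ} {x₀ : Eucl n} (h0 : ∀ x, x ∉ closedBall x₀ R → f x = 0) :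
    Integrable fun x => ‖gradient f x‖ ^ 2 := by
  refine integrable_of_bounded_of_support (K := C ^ 2) (R := R) (x₀ := x₀)
    ((measurable_gradient f).norm.pow_const 2).aestronglyMeasurable ?_ ?_
  · intro x
    rw [Real.norm_of_nonneg (by positivity)]
    exact pow_le_pow_left₀ (norm_nonneg _) (norm_gradient_le hf x) 2
  · intro x hx
    simp [gradient_eq_zero_of_notMem isClosed_closedBall h0 hx]

lemma add_mem_upper {x z : Eucl n} (hx : x ∈ upper n) (hz : z ∈ upper n) : x + z ∈ upper n := by
  simp only [upper, Set.mem_ofPred_eq, PiLp.add_apply] at *; linarith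

/-- A Faber-Krahn type inequality on the half space. -/
lemma faber_krahn {C : ℝ≥0} {f : Eucl n → ℝ} (hf : LipschitzWith C f) {x₀ : Eucl n} {R s : ℝ}
    (hs : 0 < s) (h0 : ∀ x, x ∉ ball x₀ R → f x = 0)
    (hvol : 2 * volume.real ({x | f x ≠ 0} ∩ upper n) ≤ s ^ (n + 1) * halfVol n) :
    ∫ x in upper n, f x ^ 2 ≤ 2 * s ^ 2 * ∫ x in upper n, ‖gradient f x‖ ^ 2 := by
  set B := ball x₀ (R + s) ∩ upper n with hB
  set A := ball x₀ R ∩ upper n with hA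
  set D := ball (0 : Eucl n) s ∩ upper n with hD
  have hAm : MeasurableSet A := measurableSet_ball.inter measurableSet_upper
  have hDm : MeasurableSet D := measurableSet_ball.inter measurableSet_upper
  have hBm : MeasurableSet B := measurableSet_ball.inter measurableSet_upper
  have hAfin : volume A < ∞ := volume_inter_upper_lt_top _ _ _
  have hDfin : volume D < ∞ := volume_inter_upper_lt_top _ _ _
  have hBfin : volume B < ∞ := volume_inter_upper_lt_top _ _ _
  have hBc : Convex ℝ B := (convex_ball _ _).inter convex_upper
  have hfc := hf.continuous
  have hvD : volume.real D = s ^ (n + 1) * halfVol n := volume_half_ball hs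
  have hgi := integrable_norm_gradient_sq hf (x₀ := x₀) (R := R)
    (fun x hx => h0 x fun h => hx (ball_subset_closedBall h))
  set I := ∫ x in upper n, ‖gradient f x‖ ^ 2 with hI
  have hshift : ∀ z ∈ D, ∫ x in A, (f (x + z) - f x) ^ 2 ≤ s ^ 2 * I := by
    intro z hz
    have hz' : ‖z‖ ≤ s := by simpa using (mem_ball.1 hz.1).le
    have h1 := integral_translate_sub_le hf hBc hBm hBfin z 1
    simp only [sq_abs, one_add_one_eq_two] at h1
    have hsub : A ⊆ B ∩ {x | x + z ∈ B} := by
      rintro x ⟨hx, hxu⟩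
      rw [mem_ball, dist_eq_norm] at hx
      refine ⟨⟨?_, hxu⟩, ?_, add_mem_upper hxu hz.2⟩
      · rw [mem_ball, dist_eq_norm]; linarith
      · rw [mem_ball, dist_eq_norm, add_sub_right_comm]
        have := norm_add_le (x - x₀) z
        have : ‖z‖ < s := by simpa using hz.1
        linarith
    have hint : IntegrableOn (fun x => (f (x + z) - f x) ^ 2) B :=
      integrableOn_of_continuous_ball (by fun_prop) _ _ _
    calc ∫ x in A, (f (x + z) - f x) ^ 2
        ≤ ∫ x in B ∩ {x | x + z ∈ B}, (f (x + z) - f x) ^ 2 :=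
          setIntegral_mono_set (hint.mono_set Set.inter_subset_left)
            (Eventually.of_forall fun x => by positivity) hsub.eventuallyLE
      _ ≤ _ := h1
      _ ≤ ∫ x in B, s ^ 2 * ‖gradient f x‖ ^ 2 := by
          apply integral_mono_of_nonneg
          · exact Eventually.of_forall fun x => by positivity
          · exact (hgi.integrableOn).const_mul _
          · refine Eventually.of_forall fun x => ?_
            have h2 := abs_real_inner_le_norm (gradient f x) z
            have h3 : |⟪gradient f x, z⟫_ℝ| ≤ s * ‖gradient f x‖ :=
              h2.trans (by rw [mul_comm]; gcongr)
            calc ⟪gradient f x, z⟫_ℝ ^ 2 = |⟪gradient f x, z⟫_ℝ| ^ 2 := (sq_abs _).symm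
              _ ≤ (s * ‖gradient f x‖) ^ 2 := pow_le_pow_left₀ (abs_nonneg _) h3 2
              _ = _ := by ring
      _ = s ^ 2 * ∫ x in B, ‖gradient f x‖ ^ 2 := integral_const_mul _ _
      _ ≤ s ^ 2 * I := by
          gcongr
          exact setIntegral_mono_set hgi.integrableOn
            (Eventually.of_forall fun x => by positivity) Set.inter_subset_right.eventuallyLE
  have hpt : ∀ x ∈ A, f x ^ 2 * (volume.real D / 2) ≤ ∫ z in D, (f (x + z) - f x) ^ 2 := by
    intro x hx
    have hint : IntegrableOn (fun z => (f (x + z) - f x) ^ 2) D :=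
      integrableOn_of_continuous_ball (by fun_prop) _ _ _
    set Z := {z | f (x + z) ≠ 0} with hZ
    have hZm : MeasurableSet Z := by
      have : IsOpen Z := isOpen_ne_fun (by fun_prop) continuous_const
      exact this.measurableSet
    have hPfin : volume ({x | f x ≠ 0} ∩ upper n) < ∞ := by
      refine (measure_mono ?_).trans_lt hAfin
      rintro y ⟨hy, hyu⟩
      exact ⟨by_contra fun h => hy (h0 y h), hyu⟩
    have hv : volume.real (D ∩ Z) ≤ volume.real D / 2 := by
      have : volume.real (D ∩ Z) ≤ volume.real ({x | f x ≠ 0} ∩ upper n) := by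
        have h1 : D ∩ Z ⊆ (fun z => x + z) ⁻¹' ({x | f x ≠ 0} ∩ upper n) := by
          rintro z ⟨hz, hz'⟩
          exact ⟨hz', add_mem_upper hx.2 hz.2⟩
        calc _ ≤ volume.real ((fun z => x + z) ⁻¹' ({x | f x ≠ 0} ∩ upper n)) :=
              measureReal_mono h1 (by rw [measure_preimage_add]; exact hPfin.ne)
          _ = _ := by rw [measureReal_def, measure_preimage_add, measureReal_def]
      rw [hvD]; linarith
    have hv2 : volume.real D / 2 ≤ volume.real (D \ Z) := by
      have := measureReal_inter_add_sdiff (μ := volume) (s := D) hZm hDfin.ne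
      linarith
    calc f x ^ 2 * (volume.real D / 2) ≤ f x ^ 2 * volume.real (D \ Z) := by gcongr
      _ = ∫ z in D \ Z, f x ^ 2 := by
          rw [setIntegral_const, smul_eq_mul, mul_comm]
      _ = ∫ z in D \ Z, (f (x + z) - f x) ^ 2 := by
          refine setIntegral_congr_fun (hDm.diff hZm) fun z hz => ?_
          have : f (x + z) = 0 := by simpa [hZ] using hz.2
          simp [this]
      _ ≤ _ := setIntegral_mono_set hint
            (Eventually.of_forall fun x => by positivity) Set.sdiff_subset.eventuallyLE
  have hfA : IntegrableOn (fun x => f x ^ 2) A :=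
    integrableOn_of_continuous_ball (by fun_prop) _ _ _
  have hprod : Integrable (Function.uncurry fun z x => (f (x + z) - f x) ^ 2)
      ((volume.restrict D).prod (volume.restrict A)) := by
    rw [Measure.prod_restrict]
    have hc : Continuous (Function.uncurry fun z x : Eucl n => (f (x + z) - f x) ^ 2) := by
      simp only [Function.uncurry_def]; fun_prop
    refine (hc.continuousOn.integrableOn_compact
      ((isCompact_closedBall (0 : Eucl n) s).prod (isCompact_closedBall x₀ R))).mono_set ?_
    exact Set.prod_mono (Set.inter_subset_left.trans ball_subset_closedBall)
      (Set.inter_subset_left.trans ball_subset_closedBall)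
  have main : (∫ x in A, f x ^ 2) * (volume.real D / 2) ≤ volume.real D * (s ^ 2 * I) := by
    calc (∫ x in A, f x ^ 2) * (volume.real D / 2)
        = ∫ x in A, f x ^ 2 * (volume.real D / 2) := (integral_mul_const _ _).symm
      _ ≤ ∫ x in A, ∫ z in D, (f (x + z) - f x) ^ 2 := by
          refine setIntegral_mono_on (hfA.mul_const _) ?_ hAm hpt
          exact hprod.integral_prod_right
      _ = ∫ z in D, ∫ x in A, (f (x + z) - f x) ^ 2 := (integral_integral_swap hprod).symm
      _ ≤ ∫ z in D, s ^ 2 * I := by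
          refine setIntegral_mono_on hprod.integral_prod_left
            (integrableOn_const hDfin.ne) hDm hshift
      _ = _ := by rw [setIntegral_const, smul_eq_mul]
  have hDpos : 0 < volume.real D := by rw [hvD]; have := halfVol_pos (n := n); positivity
  have hUA : ∫ x in upper n, f x ^ 2 = ∫ x in A, f x ^ 2 := by
    refine (setIntegral_eq_of_subset_of_forall_sdiff_eq_zero measurableSet_upper
      Set.inter_subset_right ?_)
    rintro x ⟨hx, hx'⟩
    rw [h0 x fun h => hx' ⟨h, hx⟩]; simp
  rw [hUA]
  have h5 : volume.real D * (∫ x in A, f x ^ 2) ≤ volume.real D * (2 * s ^ 2 * I) := by linarith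
  exact le_of_mul_le_mul_left h5 hDpos

lemma gradient_const_sub (c : ℝ) (f : Eucl n → ℝ) (x : Eucl n) :
    gradient (fun y => c - f y) x = -gradient f x := by
  simp [gradient, fderiv_const_sub]

lemma gradient_clamp {w : Eucl n → ℝ} (hw : Continuous w) {k l : ℝ} (hkl : k < l) (x : Eucl n) :
    gradient (fun y => min (max (w y - k) 0) (l - k)) x =
      if k < w x ∧ w x < l then gradient w x else 0 := by
  split_ifs with h
  · have h1 : (fun y => min (max (w y - k) 0) (l - k)) =ᶠ[𝓝 x] fun y => w y - k := by
      filter_upwards [(isOpen_lt continuous_const hw).mem_nhds h.1,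
        (isOpen_lt hw continuous_const).mem_nhds h.2] with y h1 h2
      have h1 : k < w y := h1
      have h2 : w y < l := h2
      rw [max_eq_left (by linarith), min_eq_left (by linarith)]
    rw [gradient_congr h1]; simp [gradient, fderiv_sub_const]
  · by_cases hk : k < w x
    · have hl : l ≤ w x := not_lt.1 fun hl => h ⟨hk, hl⟩
      have h2 := gradient_eq_zero_of_nonneg (f := fun y => (l - k) - min (max (w y - k) 0) (l - k))
        (x := x) (fun y => sub_nonneg.2 (min_le_right _ _)) (by
          rw [max_eq_left (by linarith), min_eq_right (by linarith), sub_self])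
      rw [gradient_const_sub] at h2
      simpa using h2
    · refine gradient_eq_zero_of_nonneg (fun y => le_min (le_max_right _ _) (by linarith)) ?_
      rw [max_eq_right (by linarith), min_eq_left (by linarith)]

lemma measurableSet_half_ball (x : Eucl n) (r : ℝ) : MeasurableSet (ball x r ∩ upper n) :=
  measurableSet_ball.inter measurableSet_upper

/-- De Giorgi's isoperimetric inequality on half balls. -/
lemma isoperimetric {C : ℝ≥0} {w : Eucl n → ℝ} (hw : LipschitzWith C w) (x₀ : Eucl n) {R k l : ℝ}
    (hR : 0 < R) (hkl : k < l) :
    (l - k) * (volume.real (ball x₀ R ∩ upper n ∩ {x | l ≤ w x}) *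
      volume.real (ball x₀ R ∩ upper n ∩ {x | w x ≤ k})) ≤
    (2 * R) ^ (n + 1) * ballVol n * (2 * R) *
      ∫ x in ball x₀ R ∩ upper n ∩ {x | k < w x ∧ w x < l}, ‖gradient w x‖ := by
  set B := ball x₀ R ∩ upper n with hB
  have hBm : MeasurableSet B := measurableSet_half_ball _ _
  have hBfin : volume B < ∞ := volume_inter_upper_lt_top _ _ _
  have hBc : Convex ℝ B := (convex_ball _ _).inter convex_upper
  have hwc := hw.continuous
  have hTm : MeasurableSet {x | k < w x ∧ w x < l} :=
    ((isOpen_lt continuous_const hwc).inter (isOpen_lt hwc continuous_const)).measurableSet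
  set P := B ∩ {x | l ≤ w x} with hP
  set N := B ∩ {x | w x ≤ k} with hN
  have hPm : MeasurableSet P := hBm.inter (isClosed_le continuous_const hwc).measurableSet
  have hNm : MeasurableSet N := hBm.inter (isClosed_le hwc continuous_const).measurableSet
  have hPfin : volume P ≠ ∞ := ((measure_mono Set.inter_subset_left).trans_lt hBfin).ne
  have hNfin : volume N ≠ ∞ := ((measure_mono Set.inter_subset_left).trans_lt hBfin).ne
  set f : Eucl n → ℝ := fun y => min (max (w y - k) 0) (l - k) with hf
  have hfL : LipschitzWith C f := by
    have h1 : LipschitzWith C fun y => w y - k := by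
      refine LipschitzWith.of_dist_le_mul fun x y => ?_
      simpa [Real.dist_eq] using hw.dist_le_mul x y
    exact (h1.max_const 0).min_const _
  have hfc := hfL.continuous
  have hgf : IntegrableOn (fun x => ‖gradient w x‖) B :=
    Measure.integrableOn_of_bounded hBfin.ne (measurable_gradient w).norm.aestronglyMeasurable
      (Eventually.of_forall fun x => by simpa using norm_gradient_le hw x)
  set J := ∫ x in B ∩ {x | k < w x ∧ w x < l}, ‖gradient w x‖ with hJ
  have hJ0 : 0 ≤ J := integral_nonneg fun x => norm_nonneg _
  have hJf : ∫ x in B, ‖gradient f x‖ = J := by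
    rw [hJ, setIntegral_eq_of_subset_of_forall_sdiff_eq_zero (f := fun x => ‖gradient f x‖) hBm
      (Set.inter_subset_left : B ∩ {x | k < w x ∧ w x < l} ⊆ B)]
    · refine setIntegral_congr_fun (hBm.inter hTm) fun x hx => ?_
      simp only [hf]
      rw [gradient_clamp hwc hkl, if_pos (show k < w x ∧ w x < l from hx.2)]
    · rintro x ⟨hx, hx'⟩
      simp only [hf]
      rw [gradient_clamp hwc hkl, if_neg (show ¬ (k < w x ∧ w x < l) from fun h => hx' ⟨hx, h⟩), norm_zero]
  have hint : Integrable (fun q : Eucl n × Eucl n =>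
      N.indicator (fun _ => (1 : ℝ)) q.1 * P.indicator (fun _ => (1 : ℝ)) (q.1 + q.2))
      (volume.prod volume) := by
    have h1 : Integrable (fun q : Eucl n × Eucl n =>
      N.indicator (fun _ => (1 : ℝ)) q.1 * P.indicator (fun _ => (1 : ℝ)) q.2)
      (volume.prod volume) :=
      ((integrable_indicator_iff hNm).2 (integrableOn_const hNfin)).mul_prod
        ((integrable_indicator_iff hPm).2 (integrableOn_const hPfin))
    exact (measurePreserving_prod_add (volume : Measure (Eucl n)) volume).integrable_comp_of_integrable h1
  have hleft : ∫ x, ∫ z, N.indicator (fun _ => (1 : ℝ)) x * P.indicator (fun _ => (1 : ℝ)) (x + z) =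
      volume.real P * volume.real N := by
    have : ∀ x, ∫ z, N.indicator (fun _ => (1 : ℝ)) x * P.indicator (fun _ => (1 : ℝ)) (x + z) =
        N.indicator (fun _ => (1 : ℝ)) x * volume.real P := by
      intro x
      rw [integral_const_mul, integral_add_left_eq_self (fun z => P.indicator (fun _ => (1 : ℝ)) z) x,
        integral_indicator_const _ hPm]; simp
    simp_rw [this]
    rw [integral_mul_const, integral_indicator_const _ hNm]; simp [mul_comm]
  have hz : ∀ z, ∫ x, N.indicator (fun _ => (1 : ℝ)) x * P.indicator (fun _ => (1 : ℝ)) (x + z) ≤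
      (ball (0 : Eucl n) (2 * R)).indicator (fun _ => 2 * R * J / (l - k)) z := by
    intro z
    have hlk : 0 < l - k := by linarith
    by_cases hz : z ∈ ball (0 : Eucl n) (2 * R)
    · have hz' : ‖z‖ ≤ 2 * R := by simpa using (mem_ball.1 hz).le
      rw [Set.indicator_of_mem hz, le_div_iff₀ hlk]
      have hA : MeasurableSet (B ∩ {x | x + z ∈ B}) := hBm.inter ((measurable_id.add_const z) hBm)
      have h1 := integral_translate_sub_le hfL hBc hBm hBfin z 0
      simp only [zero_add, pow_one] at h1
      calc (∫ x, N.indicator (fun _ => (1 : ℝ)) x * P.indicator (fun _ => (1 : ℝ)) (x + z)) * (l - k)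
          = ∫ x, N.indicator (fun _ => (1 : ℝ)) x * P.indicator (fun _ => (1 : ℝ)) (x + z) * (l - k) :=
            (integral_mul_const _ _).symm
        _ ≤ ∫ x, (B ∩ {x | x + z ∈ B}).indicator (fun x => |f (x + z) - f x|) x := by
            apply integral_mono_of_nonneg
            · refine Eventually.of_forall fun x => ?_
              refine mul_nonneg (mul_nonneg ?_ ?_) hlk.le <;>
              exact Set.indicator_nonneg (fun _ _ => zero_le_one) _
            · rw [integrable_indicator_iff hA]
              have : Continuous fun x => |f (x + z) - f x| := by fun_prop
              rw [hB, Set.inter_assoc]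
              exact integrableOn_of_continuous_ball this _ _ _
            · refine Eventually.of_forall fun x => ?_
              by_cases hx : x ∈ N
              · by_cases hxz : x + z ∈ P
                · simp only [Set.indicator_of_mem hx, Set.indicator_of_mem hxz]
                  have hmem : x ∈ B ∩ {x | x + z ∈ B} := ⟨hx.1, hxz.1⟩
                  rw [Set.indicator_of_mem hmem]
                  have e1 : f (x + z) = l - k := by
                    have : l ≤ w (x + z) := hxz.2
                    simp only [hf]
                    rw [max_eq_left (by linarith), min_eq_right (by linarith)]
                  have e2 : f x = 0 := by
                    have : w x ≤ k := hx.2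
                    simp only [hf]
                    rw [max_eq_right (by linarith), min_eq_left (by linarith)]
                  rw [e1, e2, sub_zero, abs_of_pos hlk]; simp
                · simp only [Set.indicator_of_notMem hxz]
                  simpa using Set.indicator_nonneg (fun _ _ => abs_nonneg _) x
              · simp only [Set.indicator_of_notMem hx]
                simpa using Set.indicator_nonneg (fun _ _ => abs_nonneg _) x
        _ = ∫ x in B ∩ {x | x + z ∈ B}, |f (x + z) - f x| := integral_indicator hA
        _ ≤ _ := h1
        _ ≤ ∫ x in B, 2 * R * ‖gradient f x‖ := by
            apply integral_mono_of_nonneg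
            · exact Eventually.of_forall fun x => abs_nonneg _
            · refine Integrable.const_mul ?_ _
              exact Measure.integrableOn_of_bounded hBfin.ne
                (measurable_gradient f).norm.aestronglyMeasurable
                (Eventually.of_forall fun x => by simpa using norm_gradient_le hfL x)
            · refine Eventually.of_forall fun x => ?_
              refine (abs_real_inner_le_norm (gradient f x) z).trans ?_
              simp only []
              rw [mul_comm]; gcongr
        _ = 2 * R * J := by rw [integral_const_mul, hJf]
    · rw [Set.indicator_of_notMem hz]
      refine le_of_eq (integral_eq_zero_of_ae (Eventually.of_forall fun x => ?_))
      by_cases hx : x ∈ N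
      · by_cases hxz : x + z ∈ P
        · exfalso
          apply hz
          have h1 := mem_ball.1 hx.1.1
          have h2 := mem_ball.1 hxz.1.1
          rw [mem_ball_zero_iff]
          rw [dist_eq_norm] at h1 h2
          have : z = (x + z - x₀) - (x - x₀) := by abel
          rw [this]
          linarith [norm_sub_le (x + z - x₀) (x - x₀)]
        · simp [Set.indicator_of_notMem hxz]
      · simp [Set.indicator_of_notMem hx]
  have hfinal : volume.real P * volume.real N ≤
      ∫ z, (ball (0 : Eucl n) (2 * R)).indicator (fun _ => 2 * R * J / (l - k)) z := by
    rw [← hleft, integral_integral_swap hint]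
    exact integral_mono hint.integral_prod_right
      ((integrable_indicator_iff measurableSet_ball).2 (integrableOn_const measure_ball_lt_top.ne)) hz
  rw [integral_indicator_const _ measurableSet_ball, smul_eq_mul,
    volume_real_ball 0 (by positivity : (0:ℝ) < 2 * R)] at hfinal
  have hlk : 0 < l - k := by linarith
  calc (l - k) * (volume.real P * volume.real N)
      ≤ (l - k) * ((2 * R) ^ (n + 1) * ballVol n * (2 * R * J / (l - k))) := by gcongr
    _ = _ := by field_simp

/-- Bounded Lipschitz functions. -/
def LipBdd (f : Eucl n → ℝ) : Prop := ∃ C : ℝ≥0, LipschitzWith C f ∧ ∀ x, |f x| ≤ C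

namespace LipBdd

variable {f g : Eucl n → ℝ}

lemma of_bounds {C A : ℝ} (hf : ∀ x y, |f x - f y| ≤ C * dist x y) (hA : ∀ x, |f x| ≤ A) :
    LipBdd f := by
  refine ⟨Real.toNNReal (max C A), LipschitzWith.of_dist_le_mul fun x y => ?_, fun x => ?_⟩
  · rw [Real.dist_eq, Real.coe_toNNReal']
    exact (hf x y).trans (by gcongr; exact (le_max_left _ _).trans (le_max_left _ _))
  · rw [Real.coe_toNNReal']
    exact (hA x).trans ((le_max_right _ _).trans (le_max_left _ _))

lemma bounds (hf : LipBdd f) : ∃ C : ℝ, 0 ≤ C ∧ (∀ x y, |f x - f y| ≤ C * dist x y) ∧ ∀ x, |f x| ≤ C := by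
  obtain ⟨C, h1, h2⟩ := hf
  exact ⟨C, C.2, fun x y => by simpa [Real.dist_eq] using h1.dist_le_mul x y, h2⟩

lemma continuous (hf : LipBdd f) : Continuous f := by
  obtain ⟨C, h1, -⟩ := hf; exact h1.continuous

lemma mul (hf : LipBdd f) (hg : LipBdd g) : LipBdd fun x => f x * g x := by
  obtain ⟨A, hA0, hA, hA'⟩ := hf.bounds
  obtain ⟨B, hB0, hB, hB'⟩ := hg.bounds
  refine of_bounds (C := A * B + A * B) (A := A * B) (fun x y => ?_) fun x => ?_
  · have : f x * g x - f y * g y = f x * (g x - g y) + (f x - f y) * g y := by ring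
    rw [this]
    refine (abs_add_le _ _).trans ?_
    rw [abs_mul, abs_mul]
    have h1 : |f x| * |g x - g y| ≤ A * (B * dist x y) := by gcongr; exacts [hA' x, hB x y]
    have h2 : |f x - f y| * |g y| ≤ A * dist x y * B := by gcongr; exacts [hA x y, hB' y]
    linarith
  · rw [abs_mul]; gcongr; exacts [hA' x, hB' x]

lemma const (c : ℝ) : LipBdd fun _ : Eucl n => c :=
  of_bounds (C := 0) (A := |c|) (fun x y => by simp) fun _ => le_rfl

lemma sub (hf : LipBdd f) (hg : LipBdd g) : LipBdd fun x => f x - g x := by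
  obtain ⟨A, hA0, hA, hA'⟩ := hf.bounds
  obtain ⟨B, hB0, hB, hB'⟩ := hg.bounds
  refine of_bounds (C := A + B) (A := A + B) (fun x y => ?_) fun x => ?_
  · have : f x - g x - (f y - g y) = (f x - f y) - (g x - g y) := by ring
    rw [this]
    have := abs_sub (f x - f y) (g x - g y)
    linarith [hA x y, hB x y]
  · linarith [abs_sub (f x) (g x), hA' x, hB' x]

lemma neg (hf : LipBdd f) : LipBdd fun x => -f x := by
  simpa using (const 0).sub hf

lemma max_zero (hf : LipBdd f) : LipBdd fun x => max (f x) 0 := by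
  obtain ⟨A, hA0, hA, hA'⟩ := hf.bounds
  refine of_bounds (C := A) (A := A) (fun x y => ?_) fun x => ?_
  · exact (abs_max_sub_max_le_abs _ _ _).trans (hA x y)
  · rw [abs_of_nonneg (le_max_right _ _)]
    exact max_le ((le_abs_self _).trans (hA' x)) hA0

lemma trunc (hf : LipBdd f) (k : ℝ) : LipBdd fun x => max (f x - k) 0 :=
  (hf.sub (const k)).max_zero

lemma translate (hf : LipBdd f) (v : Eucl n) : LipBdd fun x => f (x + v) := by
  obtain ⟨A, hA0, hA, hA'⟩ := hf.bounds
  exact of_bounds (C := A) (A := A) (fun x y => by simpa using hA (x + v) (y + v)) fun x => hA' _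

end LipBdd

/-- The radial cutoff which is `1` on `closedBall x₀ r` and vanishes outside `ball x₀ r'`. -/
def cutoff (x₀ : Eucl n) (r r' : ℝ) (x : Eucl n) : ℝ := max (min ((r' - dist x x₀) / (r' - r)) 1) 0

section cutoff

variable {x₀ x : Eucl n} {r r' : ℝ}

lemma cutoff_nonneg : 0 ≤ cutoff x₀ r r' x := le_max_right _ _

lemma cutoff_le_one : cutoff x₀ r r' x ≤ 1 := max_le (min_le_right _ _) zero_le_one

lemma cutoff_eq_one (hr : r < r') (hx : dist x x₀ ≤ r) : cutoff x₀ r r' x = 1 := by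
  have : 1 ≤ (r' - dist x x₀) / (r' - r) := by rw [le_div_iff₀ (by linarith)]; linarith
  rw [cutoff, min_eq_right this, max_eq_left zero_le_one]

lemma cutoff_eq_zero (hr : r < r') (hx : x ∉ ball x₀ r') : cutoff x₀ r r' x = 0 := by
  have h : r' ≤ dist x x₀ := by simpa using hx
  have : (r' - dist x x₀) / (r' - r) ≤ 0 :=
    div_nonpos_of_nonpos_of_nonneg (by linarith) (by linarith)
  rw [cutoff, max_eq_right ((min_le_left _ _).trans this)]

lemma abs_cutoff_sub_le (hr : r < r') (x y : Eucl n) :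
    |cutoff x₀ r r' x - cutoff x₀ r r' y| ≤ (r' - r)⁻¹ * dist x y := by
  have h0 : 0 < r' - r := by linarith
  refine (abs_max_sub_max_le_abs _ _ _).trans ?_
  refine (abs_min_sub_min_le_max _ _ _ _).trans ?_
  rw [sub_self, abs_zero, max_eq_left (abs_nonneg _), ← sub_div, abs_div, abs_of_pos h0,
    div_eq_inv_mul]
  gcongr
  have h1 : r' - dist x x₀ - (r' - dist y x₀) = dist y x₀ - dist x x₀ := by ring
  rw [h1, dist_comm x y]
  exact abs_dist_sub_le y x x₀

lemma cutoff_lipBdd (hr : r < r') : LipBdd (cutoff x₀ r r') :=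
  LipBdd.of_bounds (A := 1) (abs_cutoff_sub_le hr) fun x => by
    rw [abs_of_nonneg cutoff_nonneg]; exact cutoff_le_one

end cutoff

/-- The Caccioppoli inequality (De Giorgi class condition) for `w` at levels above `k₀`. -/
def Cacc (w : Eucl n → ℝ) (Q : ℝ) (x₀ : Eucl n) (R k₀ : ℝ) : Prop :=
  ∀ k, k₀ ≤ k → ∀ r r', 0 < r → r < r' → r' ≤ R →
    ∫ x in upper n, ‖gradient (fun y => cutoff x₀ r r' y * max (w y - k) 0) x‖ ^ 2 ≤
      Q / (r' - r) ^ 2 * (∫ x in ball x₀ r' ∩ upper n, max (w x - k) 0 ^ 2) +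
        Q * volume.real (ball x₀ r' ∩ upper n ∩ {x | k < w x})

lemma Cacc.mono {w : Eucl n → ℝ} {Q : ℝ} {x₀ : Eucl n} {R R' k k' : ℝ} (h : Cacc w Q x₀ R k)
    (hR : R' ≤ R) (hk : k ≤ k') : Cacc w Q x₀ R' k' :=
  fun l hl r r' h0 h1 h2 => h l (hk.trans hl) r r' h0 h1 (h2.trans hR)

lemma integrableOn_trunc {w : Eucl n → ℝ} (hw : Continuous w) (k : ℝ) (x : Eucl n) (r : ℝ)
    (s : Set (Eucl n)) : IntegrableOn (fun x => max (w x - k) 0 ^ 2) (ball x r ∩ s) :=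
  integrableOn_of_continuous_ball (by fun_prop) _ _ _

lemma volume_superlevel_le {w : Eucl n → ℝ} (hw : Continuous w) {k l : ℝ} (hkl : k ≤ l)
    (x₀ : Eucl n) (r : ℝ) :
    (l - k) ^ 2 * volume.real (ball x₀ r ∩ upper n ∩ {x | l < w x}) ≤
      ∫ x in ball x₀ r ∩ upper n, max (w x - k) 0 ^ 2 := by
  have hm : MeasurableSet (ball x₀ r ∩ upper n ∩ {x | l < w x}) :=
    (measurableSet_half_ball _ _).inter (isOpen_lt continuous_const hw).measurableSet
  have hfin : volume (ball x₀ r ∩ upper n ∩ {x | l < w x}) ≠ ∞ :=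
    ((measure_mono Set.inter_subset_left).trans_lt (volume_inter_upper_lt_top _ _ _)).ne
  calc (l - k) ^ 2 * volume.real (ball x₀ r ∩ upper n ∩ {x | l < w x})
      = ∫ x in ball x₀ r ∩ upper n ∩ {x | l < w x}, (l - k) ^ 2 := by
        rw [setIntegral_const, smul_eq_mul, mul_comm]
    _ ≤ ∫ x in ball x₀ r ∩ upper n ∩ {x | l < w x}, max (w x - k) 0 ^ 2 := by
        refine setIntegral_mono_on (integrableOn_const hfin)
          ((integrableOn_trunc hw _ _ _ _).mono_set Set.inter_subset_left) hm fun x hx => ?_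
        have : l < w x := hx.2
        exact pow_le_pow_left₀ (by linarith) ((by linarith : l - k ≤ w x - k).trans (le_max_left _ _)) 2
    _ ≤ _ := setIntegral_mono_set (integrableOn_trunc hw _ _ _ _)
        (Eventually.of_forall fun x => by positivity) Set.inter_subset_left.eventuallyLE

lemma integral_trunc_mono {w : Eucl n → ℝ} (hw : Continuous w) {k l : ℝ} (hkl : k ≤ l)
    (x₀ : Eucl n) {r r' : ℝ} (hr : r ≤ r') :
    ∫ x in ball x₀ r ∩ upper n, max (w x - l) 0 ^ 2 ≤
      ∫ x in ball x₀ r' ∩ upper n, max (w x - k) 0 ^ 2 := by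
  calc _ ≤ ∫ x in ball x₀ r ∩ upper n, max (w x - k) 0 ^ 2 :=
        integral_mono (integrableOn_trunc hw _ _ _ _) (integrableOn_trunc hw _ _ _ _) fun x => by
          simp only []; gcongr
    _ ≤ _ := setIntegral_mono_set (integrableOn_trunc hw _ _ _ _)
        (Eventually.of_forall fun x => by positivity)
        (Set.inter_subset_inter_left _ (ball_subset_ball hr)).eventuallyLE

/-- One step of the De Giorgi iteration. -/
lemma deGiorgi_step {w : Eucl n → ℝ} (hw : LipBdd w) {Q : ℝ} (hQ : 0 < Q) {x₀ : Eucl n}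
    {R k D t σ Y : ℝ} (hR : 0 < R) (hD : R ≤ D) (ht : 0 < t) (ht1 : t ≤ 1) (hσ : 0 < σ)
    (hC : Cacc w Q x₀ R k)
    (hY : ∫ x in ball x₀ (R / 2 * (1 + t)) ∩ upper n, max (w x - (k + D * (1 - t))) 0 ^ 2 ≤ Y)
    (hsmall : 8 * Y ≤ t ^ 2 * D ^ 2 * ((R * σ * t) ^ (n + 1) * halfVol n)) :
    ∫ x in ball x₀ (R / 2 * (1 + t / 2)) ∩ upper n, max (w x - (k + D * (1 - t / 2))) 0 ^ 2 ≤
      40 * Q * σ ^ 2 * Y := by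
  have hD0 : 0 < D := hR.trans_le hD
  have hwc := hw.continuous
  set r' := R / 2 * (1 + t) with hr'
  set r := R / 2 * (1 + t / 2) with hr
  set l := k + D * (1 - t / 2) with hl
  have hrr : r < r' := by rw [hr, hr']; nlinarith
  have hr0 : 0 < r := by positivity
  have hrd : r' - r = R * t / 4 := by rw [hr, hr']; ring
  have hr'R : r' ≤ R := by rw [hr']; nlinarith
  have hlk : l - (k + D * (1 - t)) = D * t / 2 := by rw [hl]; ring
  have hkl : k + D * (1 - t) ≤ l := by have : 0 < D * t := by positivity
                                       linarith
  have hkl' : k ≤ l := by have : 0 ≤ D * (1 - t / 2) := mul_nonneg hD0.le (by linarith)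
                          linarith
  have hv := volume_superlevel_le hwc hkl x₀ r'
  rw [hlk] at hv
  set m := volume.real (ball x₀ r' ∩ upper n ∩ {x | l < w x}) with hm
  have hm0 : 0 ≤ m := measureReal_nonneg
  have hvY : D ^ 2 * t ^ 2 * m ≤ 4 * Y := by nlinarith
  have hY0 : 0 ≤ Y := by have : 0 ≤ D ^ 2 * t ^ 2 * m := by positivity
                         linarith
  set f : Eucl n → ℝ := fun y => cutoff x₀ r r' y * max (w y - l) 0 with hf
  have hfL : LipBdd f := (cutoff_lipBdd hrr).mul (hw.trunc l)
  obtain ⟨C, hfC, -⟩ := hfL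
  have hf0 : ∀ x, x ∉ ball x₀ r' → f x = 0 := fun x hx => by
    simp only [hf]; rw [cutoff_eq_zero hrr hx, zero_mul]
  have hsub : {x | f x ≠ 0} ∩ upper n ⊆ ball x₀ r' ∩ upper n ∩ {x | l < w x} := by
    rintro x ⟨hx, hxu⟩
    have hx : f x ≠ 0 := hx
    refine ⟨⟨by_contra fun h => hx (hf0 x h), hxu⟩, ?_⟩
    by_contra h
    have h : w x ≤ l := not_lt.1 h
    apply hx
    simp only [hf]
    rw [max_eq_right (by linarith), mul_zero]
  have hvol : 2 * volume.real ({x | f x ≠ 0} ∩ upper n) ≤ (R * σ * t) ^ (n + 1) * halfVol n := by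
    have h1 : volume.real ({x | f x ≠ 0} ∩ upper n) ≤ m :=
      measureReal_mono hsub
        ((measure_mono Set.inter_subset_left).trans_lt (volume_inter_upper_lt_top _ _ _)).ne
    have h2 : t ^ 2 * D ^ 2 * (2 * m) ≤ t ^ 2 * D ^ 2 * ((R * σ * t) ^ (n + 1) * halfVol n) := by
      linarith
    have h3 := le_of_mul_le_mul_left h2 (by positivity)
    linarith
  have hFK := faber_krahn hfC (s := R * σ * t) (by positivity) hf0 hvol
  have hC1 := hC l hkl' r r' hr0 hrr hr'R
  have hle : ∫ x in ball x₀ r ∩ upper n, max (w x - l) 0 ^ 2 ≤ ∫ x in upper n, f x ^ 2 := by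
    have hfi : Integrable fun x => f x ^ 2 := by
      refine Continuous.integrable_of_hasCompactSupport (hfC.continuous.pow 2) ?_
      refine HasCompactSupport.intro (isCompact_closedBall x₀ r') fun x hx => ?_
      rw [hf0 x fun h => hx (ball_subset_closedBall h)]; simp
    calc _ = ∫ x in ball x₀ r ∩ upper n, f x ^ 2 := by
          refine setIntegral_congr_fun (measurableSet_half_ball _ _) fun x hx => ?_
          simp only [hf]
          rw [cutoff_eq_one hrr (mem_ball.1 hx.1).le, one_mul]
      _ ≤ _ := setIntegral_mono_set hfi.integrableOn
        (Eventually.of_forall fun x => by positivity) Set.inter_subset_right.eventuallyLE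
  have hint : ∫ x in ball x₀ r' ∩ upper n, max (w x - l) 0 ^ 2 ≤ Y :=
    (integral_trunc_mono hwc hkl x₀ le_rfl).trans hY
  have hgrad : ∫ x in upper n, ‖gradient f x‖ ^ 2 ≤ 20 * Q * Y / (R * t) ^ 2 := by
    refine hC1.trans ?_
    rw [hrd]
    have h1 : Q / (R * t / 4) ^ 2 * (∫ x in ball x₀ r' ∩ upper n, max (w x - l) 0 ^ 2) ≤
        Q / (R * t / 4) ^ 2 * Y := by gcongr
    have h2 : m ≤ 4 * Y / (R * t) ^ 2 := by
      rw [le_div_iff₀ (by positivity)]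
      have : R ^ 2 ≤ D ^ 2 := by gcongr
      calc m * (R * t) ^ 2 = R ^ 2 * (t ^ 2 * m) := by ring
        _ ≤ D ^ 2 * (t ^ 2 * m) := by gcongr
        _ ≤ _ := by linarith
    calc _ ≤ Q / (R * t / 4) ^ 2 * Y + Q * (4 * Y / (R * t) ^ 2) := by gcongr
      _ = _ := by field_simp; ring
  calc _ ≤ _ := hle
    _ ≤ _ := hFK
    _ ≤ 2 * (R * σ * t) ^ 2 * (20 * Q * Y / (R * t) ^ 2) := by gcongr
    _ = _ := by field_simp; ring

/-- De Giorgi's first lemma. -/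
lemma deGiorgi_first (n : ℕ) {Q : ℝ} (hQ : 0 < Q) : ∃ δ : ℝ, 0 < δ ∧
    ∀ (w : Eucl n → ℝ) (x₀ : Eucl n) (R k D : ℝ), LipBdd w → 0 < R → R ≤ D → Cacc w Q x₀ R k →
      ∫ x in ball x₀ R ∩ upper n, max (w x - k) 0 ^ 2 ≤ δ * (D ^ 2 * R ^ (n + 1)) →
      ∀ x ∈ ball x₀ (R / 2) ∩ upper n, w x ≤ k + D := by
  set q : ℝ := (1 / 2) ^ 2 * (1 / 2) ^ (n + 1) with hq
  have hq0 : 0 < q := by positivity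
  have hq1 : q < 1 := by
    rw [hq, ← pow_add]; exact pow_lt_one₀ (by norm_num) (by norm_num) (by omega)
  set σ : ℝ := Real.sqrt (q / (40 * Q)) with hσ
  have hσ0 : 0 < σ := Real.sqrt_pos.2 (by positivity)
  have hσ2 : 40 * Q * σ ^ 2 = q := by
    rw [hσ, Real.sq_sqrt (by positivity)]; field_simp
  have hhv := halfVol_pos (n := n)
  refine ⟨σ ^ (n + 1) * halfVol n / 8, by positivity, ?_⟩
  set δ := σ ^ (n + 1) * halfVol n / 8 with hδ
  intro w x₀ R k D hw hR hD hC h0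
  have hwc := hw.continuous
  have hD0 : 0 < D := hR.trans_le hD
  have claim : ∀ j : ℕ, ∫ x in ball x₀ (R / 2 * (1 + (1 / 2) ^ j)) ∩ upper n,
      max (w x - (k + D * (1 - (1 / 2) ^ j))) 0 ^ 2 ≤ q ^ j * (δ * (D ^ 2 * R ^ (n + 1))) := by
    intro j
    induction j with
    | zero => simpa [← two_mul, mul_div_cancel₀] using h0
    | succ j ih =>
      have h1 := deGiorgi_step hw hQ (t := (1 / 2) ^ j) (σ := σ) hR hD (by positivity)
        (pow_le_one₀ (by norm_num) (by norm_num)) hσ0 hC ih (le_of_eq ?_)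
      · rw [hσ2] at h1
        have e : ((1 : ℝ) / 2) ^ (j + 1) = (1 / 2) ^ j / 2 := by rw [pow_succ]; ring
        rw [e, pow_succ q]
        linarith
      · have e : q ^ j = ((1 / 2) ^ j) ^ 2 * ((1 / 2) ^ j) ^ (n + 1) := by
          rw [hq, mul_pow, ← pow_mul, ← pow_mul, ← pow_mul, ← pow_mul, mul_comm 2, mul_comm (n + 1)]
        rw [e, hδ]; ring
  have hzero : ∫ x in ball x₀ (R / 2) ∩ upper n, max (w x - (k + D)) 0 ^ 2 = 0 := by
    refine le_antisymm ?_ (integral_nonneg fun x => by positivity)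
    have lim : Tendsto (fun j : ℕ => q ^ j * (δ * (D ^ 2 * R ^ (n + 1)))) atTop
        (𝓝 (0 * (δ * (D ^ 2 * R ^ (n + 1))))) :=
      (tendsto_pow_atTop_nhds_zero_of_lt_one hq0.le hq1).mul_const _
    rw [zero_mul] at lim
    refine ge_of_tendsto' lim fun j => (integral_trunc_mono hwc ?_ x₀ ?_).trans (claim j)
    · have : 0 ≤ D * (1 / 2) ^ j := by positivity
      linarith
    · have : 0 ≤ R / 2 * (1 / 2) ^ j := by positivity
      linarith
  rw [setIntegral_eq_zero_iff_of_nonneg_ae (Eventually.of_forall fun x => by positivity)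
    (integrableOn_trunc hwc _ _ _ _)] at hzero
  have heq := Measure.eqOn_open_of_ae_eq hzero (isOpen_ball.inter isOpen_upper)
    (by fun_prop) continuousOn_const
  intro x hx
  have h1 := heq hx
  simp only [Pi.zero_apply] at h1
  have h2 : max (w x - (k + D)) 0 = 0 := by simpa using h1
  linarith [le_max_left (w x - (k + D)) 0]

lemma integral_gradient_layer_le {w : Eucl n → ℝ} (hw : LipBdd w) {Q : ℝ} (hQ : 0 < Q)
    {x₀ : Eucl n} {R k l A : ℝ} (hR : 0 < R) (hA : R ≤ A)
    (hC : Cacc w Q x₀ (2 * R) k)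
    (hM : ∀ x ∈ ball x₀ (2 * R) ∩ upper n, w x ≤ k + A) :
    ∫ x in ball x₀ R ∩ upper n ∩ {x | k < w x ∧ w x < l}, ‖gradient w x‖ ^ 2 ≤
      2 * Q * ((2 * R) ^ (n + 1) * ballVol n) * A ^ 2 / R ^ 2 := by
  have hwc := hw.continuous
  have hA0 : 0 < A := hR.trans_le hA
  have hR2 : R < 2 * R := by linarith
  set f : Eucl n → ℝ := fun y => cutoff x₀ R (2 * R) y * max (w y - k) 0 with hf
  obtain ⟨C, hfC, -⟩ : LipBdd f := (cutoff_lipBdd hR2).mul (hw.trunc k)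
  have hf0 : ∀ x, x ∉ closedBall x₀ (2 * R) → f x = 0 := fun x hx => by
    simp only [hf]
    rw [cutoff_eq_zero hR2 fun h => hx (ball_subset_closedBall h), zero_mul]
  have hgi := integrable_norm_gradient_sq hfC hf0
  have hm : MeasurableSet (ball x₀ R ∩ upper n ∩ {x | k < w x ∧ w x < l}) :=
    (measurableSet_half_ball _ _).inter
      ((isOpen_lt continuous_const hwc).inter (isOpen_lt hwc continuous_const)).measurableSet
  have hv := volume_ball_inter_upper_le x₀ (by positivity : (0 : ℝ) < 2 * R) (upper n)
  have hv2 : volume.real (ball x₀ (2 * R) ∩ upper n ∩ {x | k < w x}) ≤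
      (2 * R) ^ (n + 1) * ballVol n := by
    rw [Set.inter_assoc]; exact volume_ball_inter_upper_le x₀ (by positivity) _
  set V := (2 * R) ^ (n + 1) * ballVol n with hV
  have hV0 : 0 < V := by have := ballVol_pos (n := n); positivity
  have hint : ∫ x in ball x₀ (2 * R) ∩ upper n, max (w x - k) 0 ^ 2 ≤ A ^ 2 * V := by
    calc _ ≤ ∫ x in ball x₀ (2 * R) ∩ upper n, A ^ 2 := by
          refine setIntegral_mono_on (integrableOn_trunc hwc _ _ _ _)
            (integrableOn_const (volume_inter_upper_lt_top _ _ _).ne)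
            (measurableSet_half_ball _ _) fun x hx => ?_
          exact pow_le_pow_left₀ (le_max_right _ _) (max_le (by linarith [hM x hx]) hA0.le) 2
      _ = volume.real (ball x₀ (2 * R) ∩ upper n) * A ^ 2 := by
          rw [setIntegral_const, smul_eq_mul]
      _ ≤ _ := by rw [mul_comm]; gcongr
  calc ∫ x in ball x₀ R ∩ upper n ∩ {x | k < w x ∧ w x < l}, ‖gradient w x‖ ^ 2
      = ∫ x in ball x₀ R ∩ upper n ∩ {x | k < w x ∧ w x < l}, ‖gradient f x‖ ^ 2 := by
        refine setIntegral_congr_fun hm fun x hx => ?_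
        have h1 : f =ᶠ[𝓝 x] fun y => max (w y - k) 0 := by
          filter_upwards [isOpen_ball.mem_nhds hx.1.1] with y hy
          simp only [hf]
          rw [cutoff_eq_one hR2 (mem_ball.1 hy).le, one_mul]
        have hx2 : k < w x := hx.2.1
        rw [gradient_congr h1, gradient_max_sub hwc, if_pos hx2]
    _ ≤ ∫ x in upper n, ‖gradient f x‖ ^ 2 :=
        setIntegral_mono_set hgi.integrableOn (Eventually.of_forall fun x => by positivity)
          (Set.inter_subset_left.trans Set.inter_subset_right).eventuallyLE
    _ ≤ _ := hC k le_rfl R (2 * R) hR hR2 le_rfl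
    _ ≤ Q / (2 * R - R) ^ 2 * (A ^ 2 * V) + Q * V := by gcongr
    _ = Q * V * (A ^ 2 + R ^ 2) / R ^ 2 := by field_simp; ring
    _ ≤ Q * V * (A ^ 2 + A ^ 2) / R ^ 2 := by gcongr
    _ = _ := by ring

lemma layer_volume_le {w : Eucl n → ℝ} (hw : LipBdd w) {Q : ℝ} (hQ : 0 < Q)
    {x₀ : Eucl n} {R k A θ τ : ℝ} (hR : 0 < R) (hA : R ≤ A) (hτ : 0 < τ)
    (hC : Cacc w Q x₀ (2 * R) k)
    (hM : ∀ x ∈ ball x₀ (2 * R) ∩ upper n, w x ≤ k + A)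
    (hθ : θ * R ^ (n + 1) ≤ volume.real (ball x₀ R ∩ upper n ∩ {x | w x ≤ k})) :
    θ * volume.real (ball x₀ R ∩ upper n ∩ {x | k + A / 2 ≤ w x}) ≤
      2 ^ (n + 2) * ballVol n * (4 * τ * Q * ballVol n * 2 ^ (n + 1) * R ^ (n + 1) +
        (volume.real (ball x₀ R ∩ upper n ∩ {x | w x ≤ k + A / 2}) -
          volume.real (ball x₀ R ∩ upper n ∩ {x | w x ≤ k})) / τ) := by
  have hwc := hw.continuous
  have hA0 : 0 < A := hR.trans_le hA
  obtain ⟨C, hwC, -⟩ := id hw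
  have hiso := isoperimetric hwC x₀ hR (by linarith : k < k + A / 2)
  have hlay := integral_gradient_layer_le hw hQ (l := k + A / 2) hR hA hC hM
  have hbv := ballVol_pos (n := n)
  set B := ball x₀ R ∩ upper n with hB
  have hBm : MeasurableSet B := measurableSet_half_ball _ _
  have hBfin : volume B < ∞ := volume_inter_upper_lt_top _ _ _
  set S := B ∩ {x | k < w x ∧ w x < k + A / 2} with hS
  have hSm : MeasurableSet S := hBm.inter
      ((isOpen_lt continuous_const hwc).inter (isOpen_lt hwc continuous_const)).measurableSet
  have hfin : ∀ s, volume (B ∩ s) < ∞ := fun s =>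
    (measure_mono Set.inter_subset_left).trans_lt hBfin
  set P := volume.real (B ∩ {x | k + A / 2 ≤ w x}) with hP
  set N := volume.real (B ∩ {x | w x ≤ k}) with hN
  set N' := volume.real (B ∩ {x | w x ≤ k + A / 2}) with hN'
  have hP0 : 0 ≤ P := measureReal_nonneg
  have hvS : volume.real S ≤ N' - N := by
    have hd : Disjoint (B ∩ {x | w x ≤ k}) S := by
      rw [Set.disjoint_left]
      rintro x ⟨-, hx⟩ ⟨-, hx', -⟩
      have h1 : w x ≤ k := hx
      have h2 : k < w x := hx'
      linarith
    have h1 := measureReal_union hd hSm (h₁ := (hfin _).ne) (h₂ := (hfin _).ne)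
    have h2 : volume.real (B ∩ {x | w x ≤ k} ∪ S) ≤ N' := by
      refine measureReal_mono ?_ (hfin _).ne
      rintro x (⟨hx, hx'⟩ | ⟨hx, -, hx'⟩)
      · have hx' : w x ≤ k := hx'
        exact ⟨hx, show w x ≤ k + A / 2 by linarith⟩
      · exact ⟨hx, show w x ≤ k + A / 2 from le_of_lt hx'⟩
    linarith
  set t := 2 * τ * R / A with ht
  have ht0 : 0 < t := by positivity
  have hgi1 : IntegrableOn (fun x => ‖gradient w x‖) S :=
    Measure.integrableOn_of_bounded (hfin _).ne (measurable_gradient w).norm.aestronglyMeasurable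
      (Eventually.of_forall fun x => by simpa using norm_gradient_le hwC x)
  have hgi2 : IntegrableOn (fun x => ‖gradient w x‖ ^ 2) S :=
    Measure.integrableOn_of_bounded (hfin _).ne
      ((measurable_gradient w).norm.pow_const 2).aestronglyMeasurable (M := C ^ 2)
      (Eventually.of_forall fun x => by
        rw [Real.norm_of_nonneg (by positivity)]
        exact pow_le_pow_left₀ (norm_nonneg _) (norm_gradient_le hwC x) 2)
  have hAM : ∫ x in S, ‖gradient w x‖ ≤
      t / 2 * (∫ x in S, ‖gradient w x‖ ^ 2) + volume.real S / (2 * t) := by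
    calc ∫ x in S, ‖gradient w x‖ ≤ ∫ x in S, (t / 2 * ‖gradient w x‖ ^ 2 + 1 / (2 * t)) := by
          refine integral_mono hgi1 ((hgi2.const_mul _).add (integrableOn_const (hfin _).ne))
            fun x => ?_
          have h1 : 0 ≤ (t * ‖gradient w x‖ - 1) ^ 2 / (2 * t) := by positivity
          have h2 : (t * ‖gradient w x‖ - 1) ^ 2 / (2 * t) =
            t / 2 * ‖gradient w x‖ ^ 2 + 1 / (2 * t) - ‖gradient w x‖ := by field_simp; ring
          simp only []
          linarith
      _ = _ := by
          rw [integral_add (hgi2.const_mul _) (integrableOn_const (hfin _).ne), integral_const_mul,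
            setIntegral_const, smul_eq_mul]
          ring
  have h1 : A / 2 * (P * (θ * R ^ (n + 1))) ≤ A / 2 * (P * N) := by gcongr
  have h2 : A / 2 * (P * (θ * R ^ (n + 1))) ≤ (2 * R) ^ (n + 1) * ballVol n * (2 * R) *
      (t / 2 * (2 * Q * ((2 * R) ^ (n + 1) * ballVol n) * A ^ 2 / R ^ 2) + (N' - N) / (2 * t)) := by
    refine h1.trans ?_
    have e : k + A / 2 - k = A / 2 := by ring
    rw [e] at hiso
    refine hiso.trans ?_
    gcongr
    refine hAM.trans ?_
    gcongr
  have e : (2 * R) ^ (n + 1) * ballVol n * (2 * R) *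
      (t / 2 * (2 * Q * ((2 * R) ^ (n + 1) * ballVol n) * A ^ 2 / R ^ 2) + (N' - N) / (2 * t)) =
      A / 2 * R ^ (n + 1) * (2 ^ (n + 2) * ballVol n * (4 * τ * Q * ballVol n * 2 ^ (n + 1) * R ^ (n + 1) +
        (N' - N) / (2 * τ))) := by
    rw [ht]; field_simp; ring
  rw [e] at h2
  have h3 : A / 2 * R ^ (n + 1) * (θ * P) ≤ A / 2 * R ^ (n + 1) * (2 ^ (n + 2) * ballVol n * (4 * τ * Q * ballVol n * 2 ^ (n + 1) * R ^ (n + 1) +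
        (N' - N) / (2 * τ))) := by linarith
  have h4 := le_of_mul_le_mul_left h3 (by positivity)
  refine h4.trans ?_
  have : 0 ≤ N' - N := le_trans measureReal_nonneg hvS
  gcongr
  linarith

/-- De Giorgi's growth lemma. -/
lemma deGiorgi_growth (n : ℕ) {Q θ : ℝ} (hQ : 0 < Q) (hθ : 0 < θ) : ∃ κ : ℝ, 0 < κ ∧ κ ≤ 1 ∧
    ∀ (w : Eucl n → ℝ) (x₀ : Eucl n) (R k M : ℝ), LipBdd w → 0 < R → k < M → R ≤ κ * (M - k) →
      Cacc w Q x₀ (2 * R) k → (∀ x ∈ ball x₀ (2 * R) ∩ upper n, w x ≤ M) →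
      θ * R ^ (n + 1) ≤ volume.real (ball x₀ R ∩ upper n ∩ {x | w x ≤ k}) →
      ∀ x ∈ ball x₀ (R / 2) ∩ upper n, w x ≤ M - κ * (M - k) := by
  obtain ⟨δ, hδ, hDG⟩ := deGiorgi_first n hQ
  have hbv := ballVol_pos (n := n)
  set b := ballVol n with hb
  set c₁ := (2 : ℝ) ^ (n + 2) * b with hc₁
  set c₂ := 4 * Q * b * 2 ^ (n + 1) with hc₂
  have hc₁0 : 0 < c₁ := by positivity
  have hc₂0 : 0 < c₂ := by positivity
  set τ := δ * θ / (8 * c₁ * c₂) with hτ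
  have hτ0 : 0 < τ := by positivity
  obtain ⟨J, hJ⟩ := exists_nat_gt (8 * c₁ * b / (τ * (δ * θ)))
  have hJ0 : (0 : ℝ) < J := lt_trans (by positivity) hJ
  rw [div_lt_iff₀ (by positivity)] at hJ
  refine ⟨(1 / 2) ^ (J + 1), by positivity, pow_le_one₀ (by norm_num) (by norm_num), ?_⟩
  intro w x₀ R k M hw hR hkM hRM hC hM hvol
  have hwc := hw.continuous
  set m := M - k with hm
  have hm0 : 0 < m := by linarith
  set B := ball x₀ R ∩ upper n with hB
  have hfin : ∀ s, volume (B ∩ s) < ∞ := fun s =>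
    (measure_mono Set.inter_subset_left).trans_lt (volume_inter_upper_lt_top _ _ _)
  have hanti : ∀ j ≤ J, (1 / 2 : ℝ) ^ J ≤ (1 / 2) ^ j := fun j hj =>
    pow_le_pow_of_le_one (by norm_num) (by norm_num) hj
  have hpow1 : ∀ j, (1 / 2 : ℝ) ^ j ≤ 1 := fun j => pow_le_one₀ (by norm_num) (by norm_num)
  have hpowS : ∀ j, (1 / 2 : ℝ) ^ (j + 1) = (1 / 2) ^ j / 2 := fun j => by rw [pow_succ]; ring
  set a : ℕ → ℝ := fun j => volume.real (B ∩ {x | w x ≤ M - (1 / 2) ^ j * m}) with ha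
  set P := volume.real (B ∩ {x | M - (1 / 2) ^ J * m ≤ w x}) with hP
  have hstep : ∀ j < J, θ * P ≤ c₁ * (τ * c₂ * R ^ (n + 1) + (a (j + 1) - a j) / τ) := by
    intro j hj
    have e1 : M - (1 / 2) ^ j * m + (1 / 2) ^ j * m / 2 = M - (1 / 2) ^ (j + 1) * m := by
      rw [hpowS]; ring
    have hkj : k ≤ M - (1 / 2) ^ j * m := by nlinarith [hpow1 j]
    have h1 := layer_volume_le hw hQ (x₀ := x₀) (R := R) (k := M - (1 / 2) ^ j * m)
      (A := (1 / 2) ^ j * m) (θ := θ) (τ := τ) hR ?_ hτ0 (hC.mono le_rfl hkj)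
      (fun x hx => by linarith [hM x hx]) ?_
    · rw [e1] at h1
      refine le_trans ?_ (h1.trans (le_of_eq ?_))
      · gcongr
        refine measureReal_mono ?_ (hfin _).ne
        rintro x ⟨hx, hx'⟩
        have hx' : M - (1 / 2) ^ J * m ≤ w x := hx'
        refine ⟨hx, show M - (1 / 2) ^ (j + 1) * m ≤ w x from ?_⟩
        have := mul_le_mul_of_nonneg_right (hanti (j + 1) hj) hm0.le
        linarith
      · simp only [ha]; rw [hc₁, hc₂]; ring
    · refine hRM.trans ?_
      have := mul_le_mul_of_nonneg_right (hanti j hj.le) hm0.le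
      rw [hpowS]
      have : 0 < (1 / 2) ^ J * m := by positivity
      linarith
    · refine hvol.trans (measureReal_mono ?_ (hfin _).ne)
      rintro x ⟨hx, hx'⟩
      exact ⟨hx, le_trans (show w x ≤ k from hx') hkj⟩
  have hsum : J * (θ * P) ≤ c₁ * (J * (τ * c₂ * R ^ (n + 1)) + R ^ (n + 1) * b / τ) := by
    calc J * (θ * P) = ∑ j ∈ Finset.range J, θ * P := by simp
      _ ≤ ∑ j ∈ Finset.range J, c₁ * (τ * c₂ * R ^ (n + 1) + (a (j + 1) - a j) / τ) :=
          Finset.sum_le_sum fun j hj => hstep j (Finset.mem_range.1 hj)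
      _ = c₁ * (J * (τ * c₂ * R ^ (n + 1)) + (a J - a 0) / τ) := by
          rw [← Finset.mul_sum, Finset.sum_add_distrib, ← Finset.sum_div, Finset.sum_range_sub]
          simp
      _ ≤ _ := by
          have h1 : a J ≤ R ^ (n + 1) * b := by
            simp only [ha, hB]
            rw [Set.inter_assoc]; exact volume_ball_inter_upper_le x₀ hR _
          have h2 : 0 ≤ a 0 := measureReal_nonneg
          gcongr
          linarith
  have hPle : P ≤ δ / 4 * R ^ (n + 1) := by
    have h1 : c₁ * (J * (τ * c₂ * R ^ (n + 1))) = J * θ * (δ / 8 * R ^ (n + 1)) := by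
      rw [hτ]; field_simp
    have h2 : c₁ * (R ^ (n + 1) * b / τ) ≤ J * θ * (δ / 8 * R ^ (n + 1)) := by
      have : c₁ * (R ^ (n + 1) * b / τ) = (8 * c₁ * b) * (R ^ (n + 1) / (8 * τ)) := by
        field_simp
      rw [this]
      calc _ ≤ (J * (τ * (δ * θ))) * (R ^ (n + 1) / (8 * τ)) := by gcongr
        _ = _ := by field_simp
    have h3 : J * θ * P ≤ J * θ * (δ / 4 * R ^ (n + 1)) := by linarith
    exact le_of_mul_le_mul_left h3 (by positivity)
  have hD : R ≤ (1 / 2) ^ (J + 1) * m := hRM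
  have hkJ : k ≤ M - (1 / 2) ^ J * m := by nlinarith [hpow1 J]
  have hfinal := hDG w x₀ R (M - (1 / 2) ^ J * m) ((1 / 2) ^ (J + 1) * m) hw hR hD
    (hC.mono (by linarith) hkJ) ?_
  · intro x hx
    have := hfinal x hx
    rw [hpowS] at this ⊢
    linarith
  · set l := M - (1 / 2) ^ J * m with hl
    have hSm : MeasurableSet (B ∩ {x | l ≤ w x}) :=
      (measurableSet_half_ball _ _).inter (isClosed_le continuous_const hwc).measurableSet
    calc ∫ x in B, max (w x - l) 0 ^ 2 = ∫ x in B ∩ {x | l ≤ w x}, max (w x - l) 0 ^ 2 := by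
          refine setIntegral_eq_of_subset_of_forall_sdiff_eq_zero (measurableSet_half_ball _ _)
            Set.inter_subset_left ?_
          rintro x ⟨hx, hx'⟩
          have : ¬ l ≤ w x := fun h => hx' ⟨hx, h⟩
          rw [max_eq_right (by linarith)]; simp
      _ ≤ ∫ x in B ∩ {x | l ≤ w x}, ((1 / 2) ^ J * m) ^ 2 := by
          refine setIntegral_mono_on ((integrableOn_trunc hwc _ _ _ _).mono_set
            Set.inter_subset_left) (integrableOn_const (hfin _).ne) hSm fun x hx => ?_
          have h1 : w x ≤ M := hM x ⟨ball_subset_ball (by linarith) hx.1.1, hx.1.2⟩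
          exact pow_le_pow_left₀ (le_max_right _ _)
            (max_le (by linarith) (by positivity)) 2
      _ = P * ((1 / 2) ^ J * m) ^ 2 := by rw [setIntegral_const, smul_eq_mul]
      _ ≤ δ / 4 * R ^ (n + 1) * ((1 / 2) ^ J * m) ^ 2 := by gcongr
      _ = _ := by rw [hpowS]; ring

/-- De Giorgi's oscillation decay on (half) balls centred in the closed half space. -/
lemma deGiorgi_osc (n : ℕ) {Q L ε : ℝ} (hQ : 0 < Q) (hL : 0 < L) (hε : 0 < ε) :
    ∃ c ρ₀ : ℝ, 0 < c ∧ c ≤ 1 ∧ 0 < ρ₀ ∧ ∀ (w : Eucl n → ℝ) (x₀ : Eucl n) (R : ℝ), LipBdd w →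
      0 < R → R ≤ ρ₀ → 0 ≤ x₀ (Fin.last n) → (∀ k, Cacc w Q x₀ R k) →
      (∀ k, Cacc (fun x => -w x) Q x₀ R k) → (∀ x ∈ ball x₀ R ∩ upper n, |w x| ≤ L) →
      ∀ x ∈ ball x₀ (c * R) ∩ upper n, ∀ y ∈ ball x₀ (c * R) ∩ upper n, |w x - w y| ≤ ε := by
  have hhv := halfVol_pos (n := n)
  obtain ⟨κ, hκ0, hκ1, hκ⟩ := deGiorgi_growth n (θ := halfVol n / 2) hQ (by positivity)
  obtain ⟨J, hJ⟩ := exists_pow_lt_of_lt_one (by positivity : 0 < ε / (2 * L))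
    (by linarith : 1 - κ / 2 < 1)
  rw [lt_div_iff₀ (by positivity)] at hJ
  refine ⟨(1 / 4) ^ J, ε * κ, by positivity, pow_le_one₀ (by norm_num) (by norm_num),
    by positivity, ?_⟩
  intro w x₀ R hw hR hRρ hx₀ hC hC' hL'
  have hwc := hw.continuous
  have claim : ∀ j : ℕ, ∃ m M : ℝ, m ≤ M ∧ (∀ x ∈ ball x₀ ((1 / 4) ^ j * R) ∩ upper n, m ≤ w x ∧ w x ≤ M) ∧
      M - m ≤ max ((1 - κ / 2) ^ j * (2 * L)) ε := by
    intro j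
    induction j with
    | zero =>
      refine ⟨-L, L, by linarith, fun x hx => ?_, ?_⟩
      · simp only [pow_zero, one_mul] at hx
        exact abs_le.1 (hL' x hx)
      · refine le_max_of_le_left ?_; rw [pow_zero]; linarith
    | succ j ih =>
      obtain ⟨m, M, hmM, hb, hosc⟩ := ih
      set R' := (1 / 4) ^ j * R with hR'
      have hR'0 : 0 < R' := by positivity
      have hR'R : R' ≤ R := by
        have : (1 / 4 : ℝ) ^ j ≤ 1 := pow_le_one₀ (by norm_num) (by norm_num)
        rw [hR']; nlinarith
      have e : (1 / 4 : ℝ) ^ (j + 1) * R = R' / 2 / 2 := by rw [hR', pow_succ]; ring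
      rw [e]
      have hsub : ball x₀ (R' / 2 / 2) ∩ upper n ⊆ ball x₀ R' ∩ upper n :=
        Set.inter_subset_inter_left _ (ball_subset_ball (by linarith))
      by_cases hsm : M - m ≤ ε
      · exact ⟨m, M, hmM, fun x hx => hb x (hsub hx), hsm.trans (le_max_right _ _)⟩
      have hsm : ε < M - m := not_le.1 hsm
      have hosc' : M - m ≤ (1 - κ / 2) ^ j * (2 * L) :=
        (le_max_iff.1 hosc).resolve_right (by linarith)
      set k := (M + m) / 2 with hk
      have hMk : M - k = (M - m) / 2 := by rw [hk]; ring
      have hkm : -m - -k = (M - m) / 2 := by rw [hk]; ring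
      have hRk : R' / 2 ≤ κ * ((M - m) / 2) := by nlinarith
      have hdec : (1 - κ / 2) * (M - m) ≤ (1 - κ / 2) ^ (j + 1) * (2 * L) := by
        rw [pow_succ']
        have : 0 ≤ 1 - κ / 2 := by linarith
        calc _ ≤ (1 - κ / 2) * ((1 - κ / 2) ^ j * (2 * L)) := by gcongr
          _ = _ := by ring
      have e2 : 2 * (R' / 2) = R' := by ring
      have hv := le_volume_ball_inter_upper hx₀ (by positivity : 0 < R' / 2)
      have hsplit : volume.real (ball x₀ (R' / 2) ∩ upper n) ≤
          volume.real (ball x₀ (R' / 2) ∩ upper n ∩ {x | w x ≤ k}) +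
          volume.real (ball x₀ (R' / 2) ∩ upper n ∩ {x | -w x ≤ -k}) := by
        refine le_trans (measureReal_mono ?_ ?_) (measureReal_union_le _ _)
        · intro x hx
          rcases le_total (w x) k with h | h
          · exact Or.inl ⟨hx, h⟩
          · exact Or.inr ⟨hx, show -w x ≤ -k by linarith⟩
        · exact ((measure_union_lt_top ((measure_mono Set.inter_subset_left).trans_lt
            (volume_inter_upper_lt_top _ _ _)) ((measure_mono Set.inter_subset_left).trans_lt
            (volume_inter_upper_lt_top _ _ _)))).ne
      rcases le_or_gt (halfVol n / 2 * (R' / 2) ^ (n + 1))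
        (volume.real (ball x₀ (R' / 2) ∩ upper n ∩ {x | w x ≤ k})) with h | h
      · have h1 := hκ w x₀ (R' / 2) k M hw (by positivity) (by linarith) (by rw [hMk]; exact hRk)
          ((hC k).mono (by linarith) le_rfl) (fun x hx => (hb x (by rwa [e2] at hx)).2) h
        rw [hMk] at h1
        refine ⟨m, M - κ * ((M - m) / 2), ?_, fun x hx => ⟨(hb x (hsub hx)).1, h1 x hx⟩,
          le_max_of_le_left (le_trans (by linarith) hdec)⟩
        nlinarith
      · have h2 : halfVol n / 2 * (R' / 2) ^ (n + 1) ≤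
            volume.real (ball x₀ (R' / 2) ∩ upper n ∩ {x | -w x ≤ -k}) := by linarith
        have h1 := hκ (fun x => -w x) x₀ (R' / 2) (-k) (-m) hw.neg (by positivity) (by linarith)
          (by rw [hkm]; exact hRk) ((hC' (-k)).mono (by linarith) le_rfl)
          (fun x hx => by linarith [(hb x (by rwa [e2] at hx)).1]) h2
        rw [hkm] at h1
        refine ⟨m + κ * ((M - m) / 2), M, ?_, fun x hx => ⟨by linarith [h1 x hx], (hb x (hsub hx)).2⟩,
          le_max_of_le_left (le_trans (by linarith) hdec)⟩
        nlinarith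
  obtain ⟨m, M, -, hb, hosc⟩ := claim J
  have hosc : M - m ≤ ε := hosc.trans (max_le (by linarith) le_rfl)
  intro x hx y hy
  rw [abs_le]
  constructor <;> linarith [(hb x hx).1, (hb x hx).2, (hb y hy).1, (hb y hy).2]

/-- A Lipschitz function `u` solving the variational inequality on the part of the upper half space
inside `ball 0 ρ`, for a strictly monotone globally Lipschitz structure `(F, F₀)`. -/
structure Sol (F : Eucl n → ℝ → Eucl n → Eucl n) (F₀ : Eucl n → ℝ → Eucl n → ℝ) (u : Eucl n → ℝ)
    (L : ℝ≥0) (ρ lam Lam M : ℝ) : Prop where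
  lip : LipschitzWith L u
  rho_pos : 0 < ρ
  rho_le : ρ ≤ 1
  lam_pos : 0 < lam
  Lam_pos : 0 < Lam
  M_ge : 10 * (L + 1) ≤ M
  bdd : ∀ x ∈ ball (0 : Eucl n) ρ, |u x| ≤ M
  mono : ∀ x ∈ ball (0 : Eucl n) ρ, ∀ z, |z| ≤ M → ∀ p q, ‖p‖ ≤ M → ‖q‖ ≤ M →
    lam * ‖p - q‖ ^ 2 ≤ ⟪F x z p - F x z q, p - q⟫_ℝ
  lipF : ∀ x y z z' p q, ‖F x z p - F y z' q‖ ≤ Lam * (dist x y + |z - z'| + ‖p - q‖)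
  lipF₀ : ∀ x y z z' p q, |F₀ x z p - F₀ y z' q| ≤ Lam * (dist x y + |z - z'| + ‖p - q‖)
  nonneg : ∀ x ∈ ball (0 : Eucl n) ρ, x (Fin.last n) = 0 → 0 ≤ u x
  vi : ∀ ζ : Eucl n → ℝ, LipBdd ζ → ∀ r < ρ, (∀ x, x ∉ ball (0 : Eucl n) r → ζ x = 0) →
    (∀ x ∈ ball (0 : Eucl n) ρ, x (Fin.last n) = 0 → 0 ≤ u x + ζ x) →
    0 ≤ ∫ x in upper n, (⟪F x (u x) (gradient u x), gradient ζ x⟫_ℝ +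
      F₀ x (u x) (gradient u x) * ζ x)

lemma continuous_of_lip {E : Type*} [NormedAddCommGroup E] {F : Eucl n → ℝ → Eucl n → E} {Lam : ℝ}
    (h : ∀ x y z z' p q, ‖F x z p - F y z' q‖ ≤ Lam * (dist x y + |z - z'| + ‖p - q‖)) :
    Continuous fun q : Eucl n × ℝ × Eucl n => F q.1 q.2.1 q.2.2 := by
  rw [continuous_iff_continuousAt]
  intro q
  rw [ContinuousAt, tendsto_iff_norm_sub_tendsto_zero]
  have h1 : Continuous fun p : Eucl n × ℝ × Eucl n =>
      Lam * (dist p.1 q.1 + |p.2.1 - q.2.1| + ‖p.2.2 - q.2.2‖) := by fun_prop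
  have h2 := h1.tendsto q
  simp only [dist_self, sub_self, abs_zero, norm_zero, add_zero, mul_zero] at h2
  exact squeeze_zero (fun _ => norm_nonneg _) (fun p => h _ _ _ _ _ _) h2

lemma measurable_flux {E : Type*} [NormedAddCommGroup E] [MeasurableSpace E] [BorelSpace E]
    {F : Eucl n → ℝ → Eucl n → E} {Lam : ℝ}
    (h : ∀ x y z z' p q, ‖F x z p - F y z' q‖ ≤ Lam * (dist x y + |z - z'| + ‖p - q‖))
    {u : Eucl n → ℝ} (hu : Continuous u) {p : Eucl n → Eucl n} (hp : Measurable p) :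
    Measurable fun x => F x (u x) (p x) :=
  (continuous_of_lip h).measurable.comp (measurable_id.prodMk (hu.measurable.prodMk hp))

lemma norm_flux_le {E : Type*} [NormedAddCommGroup E]
    {F : Eucl n → ℝ → Eucl n → E} {Lam : ℝ} (hLam : 0 < Lam)
    (h : ∀ x y z z' p q, ‖F x z p - F y z' q‖ ≤ Lam * (dist x y + |z - z'| + ‖p - q‖))
    {u : Eucl n → ℝ} {L : ℝ≥0} (hu : LipschitzWith L u) {p : Eucl n → Eucl n} {P : ℝ}
    (hp : ∀ x, ‖p x‖ ≤ P) (R : ℝ) : ∃ K : ℝ, ∀ x ∈ closedBall (0 : Eucl n) R,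
      ‖F x (u x) (p x)‖ ≤ K := by
  refine ⟨‖F 0 (u 0) 0‖ + Lam * (R + L * R + P), fun x hx => ?_⟩
  have h1 := h x 0 (u x) (u 0) (p x) 0
  have h2 : dist x 0 ≤ R := hx
  have h3 : |u x - u 0| ≤ L * R := by
    rw [← Real.dist_eq]; exact (hu.dist_le_mul x 0).trans (by gcongr)
  have h4 : ‖p x - 0‖ ≤ P := by simpa using hp x
  have h5 : ‖F x (u x) (p x)‖ ≤ ‖F 0 (u 0) 0‖ + ‖F x (u x) (p x) - F 0 (u 0) 0‖ := by
    have := norm_add_le (F 0 (u 0) 0) (F x (u x) (p x) - F 0 (u 0) 0)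
    simpa using this
  refine h5.trans ?_
  gcongr
  exact h1.trans (by gcongr)

lemma gradient_eq_zero_of_support {ζ : Eucl n → ℝ} {x₀ : Eucl n} {r R : ℝ} (hrR : r < R)
    (h0 : ∀ x, x ∉ ball x₀ r → ζ x = 0) {x : Eucl n} (hx : x ∉ ball x₀ R) : gradient ζ x = 0 :=
  gradient_eq_zero_of_notMem isClosed_closedBall (x := x) (S := closedBall x₀ r)
    (fun y hy => h0 y fun h => hy (ball_subset_closedBall h))
    fun h => hx (closedBall_subset_ball hrR h)

/-- Integrability of the integrand of the variational inequality. -/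
lemma integrable_pairing {V : Eucl n → Eucl n} {V₀ ζ : Eucl n → ℝ} {R K : ℝ} {x₀ : Eucl n}
    (hV : Measurable V) (hV₀ : Measurable V₀) (hVK : ∀ x ∈ closedBall x₀ R, ‖V x‖ ≤ K)
    (hV₀K : ∀ x ∈ closedBall x₀ R, |V₀ x| ≤ K) (hζ : LipBdd ζ)
    (h0 : ∀ x, x ∉ closedBall x₀ R → ζ x = 0) :
    Integrable fun x => ⟪V x, gradient ζ x⟫_ℝ + V₀ x * ζ x := by
  obtain ⟨C, hC, hCb⟩ := id hζ
  have hg0 : ∀ x, x ∉ closedBall x₀ R → gradient ζ x = 0 := fun x hx =>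
    gradient_eq_zero_of_notMem isClosed_closedBall h0 hx
  refine integrable_of_bounded_of_support (K := |K| * C + |K| * C) (x₀ := x₀) (R := R) ?_ ?_ ?_
  · exact ((hV.inner (measurable_gradient ζ)).add
      (hV₀.mul hζ.continuous.measurable)).aestronglyMeasurable
  · intro x
    by_cases hx : x ∈ closedBall x₀ R
    · refine (norm_add_le _ _).trans ?_
      have h1 := (hVK x hx).trans (le_abs_self K)
      have h2 := (hV₀K x hx).trans (le_abs_self K)
      rw [norm_mul, Real.norm_eq_abs (V₀ x), Real.norm_eq_abs (ζ x), Real.norm_eq_abs]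
      have h3 := abs_real_inner_le_norm (V x) (gradient ζ x)
      have h4 := norm_gradient_le hC x
      have h5 := hCb x
      gcongr
      exact h3.trans (by gcongr)
    · rw [hg0 x hx, h0 x hx]; simp; positivity
  · intro x hx
    rw [hg0 x hx, h0 x hx]; simp

section Caccioppoli

/-- The constant in the pointwise Caccioppoli estimate. -/
def caccK (lam Λ : ℝ) : ℝ := 12 * (Λ ^ 2 / (2 * lam) + Λ) + lam

lemma cacc_pointwise {lam Λ η g d₀ : ℝ} (hlam : 0 < lam) (hΛ : 0 < Λ) (hη0 : 0 ≤ η) (hη1 : η ≤ 1)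
    (hg : 0 ≤ g) {w' η' A E' : Eucl n} (hA : lam * ‖w'‖ ^ 2 ≤ ⟪A, w'⟫_ℝ) (hA' : ‖A‖ ≤ Λ * ‖w'‖)
    (hE : ‖E'‖ ≤ Λ) (hd : |d₀| ≤ Λ * (1 + ‖w'‖)) :
    lam / 4 * ‖η • w' + g • η'‖ ^ 2 ≤
      ⟪A + E', η • (η • w' + g • η') + (η * g) • η'⟫_ℝ + d₀ * (η * (η * g)) +
        caccK lam Λ * (1 + g ^ 2 * ‖η'‖ ^ 2 + g ^ 2) := by
  set N := ‖η'‖ with hN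
  have hN0 : 0 ≤ N := norm_nonneg _
  set W := η * ‖w'‖ with hW
  have hW0 : 0 ≤ W := by positivity
  have h1 : ‖η • w' + g • η'‖ ^ 2 ≤ 2 * W ^ 2 + 2 * (g ^ 2 * N ^ 2) := by
    have h := norm_add_le (η • w') (g • η')
    rw [norm_smul, norm_smul, Real.norm_of_nonneg hη0, Real.norm_of_nonneg hg] at h
    have h2 := pow_le_pow_left₀ (norm_nonneg _) h 2
    nlinarith [sq_nonneg (W - g * N)]
  have e : ⟪A + E', η • (η • w' + g • η') + (η * g) • η'⟫_ℝ =
      η ^ 2 * ⟪A, w'⟫_ℝ + η ^ 2 * ⟪E', w'⟫_ℝ + 2 * (η * g) * ⟪A + E', η'⟫_ℝ := by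
    simp only [inner_add_left, inner_add_right, inner_smul_right]; ring
  have h2 : η ^ 2 * (lam * ‖w'‖ ^ 2) ≤ η ^ 2 * ⟪A, w'⟫_ℝ := by gcongr
  have h3 : -(Λ * W) ≤ η ^ 2 * ⟪E', w'⟫_ℝ := by
    have a1 : -(Λ * ‖w'‖) ≤ ⟪E', w'⟫_ℝ := by
      have := (abs_le.1 (abs_real_inner_le_norm E' w')).1
      have : ‖E'‖ * ‖w'‖ ≤ Λ * ‖w'‖ := by gcongr
      linarith
    have a2 : η ^ 2 * (-(Λ * ‖w'‖)) ≤ η ^ 2 * ⟪E', w'⟫_ℝ := by gcongr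
    have a3 : η * W ≤ 1 * W := by gcongr
    have a4 : Λ * (η * W) ≤ Λ * W := by gcongr; linarith
    have a5 : η ^ 2 * (-(Λ * ‖w'‖)) = -(Λ * (η * W)) := by rw [hW]; ring
    linarith
  have h4 : -(2 * g * N * Λ * (W + 1)) ≤ 2 * (η * g) * ⟪A + E', η'⟫_ℝ := by
    have a1 : -((Λ * ‖w'‖ + Λ) * N) ≤ ⟪A + E', η'⟫_ℝ := by
      have := (abs_le.1 (abs_real_inner_le_norm (A + E') η')).1
      have : ‖A + E'‖ * ‖η'‖ ≤ (Λ * ‖w'‖ + Λ) * N := by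
        gcongr
        exact (norm_add_le _ _).trans (by linarith)
      linarith
    have a2 : 2 * (η * g) * (-((Λ * ‖w'‖ + Λ) * N)) ≤ 2 * (η * g) * ⟪A + E', η'⟫_ℝ := by gcongr
    have a3 : 2 * (η * g) * (-((Λ * ‖w'‖ + Λ) * N)) = -(2 * g * N * Λ * (W + η)) := by
      rw [hW]; ring
    have a4 : 2 * g * N * Λ * (W + η) ≤ 2 * g * N * Λ * (W + 1) := by gcongr
    linarith
  have h5 : -(Λ * g * (1 + W)) ≤ d₀ * (η * (η * g)) := by
    have a1 := (abs_le.1 hd).1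
    have a2 : (-(Λ * (1 + ‖w'‖))) * (η * (η * g)) ≤ d₀ * (η * (η * g)) := by gcongr
    have a3 : (-(Λ * (1 + ‖w'‖))) * (η * (η * g)) = -(Λ * g * (η * η + η * W)) := by
      rw [hW]; ring
    have a4 : Λ * g * (η * η + η * W) ≤ Λ * g * (1 + W) := by
      have : η * η ≤ 1 := by nlinarith
      have : η * W ≤ 1 * W := by gcongr
      gcongr; linarith
    linarith
  set S := 1 + 2 * g * N + g with hS
  have hS1 : 1 ≤ S := by
    have : 0 ≤ 2 * g * N := by positivity
    linarith
  have h6 : Λ * W * S ≤ lam / 2 * W ^ 2 + Λ ^ 2 / (2 * lam) * S ^ 2 := by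
    have a1 : 0 ≤ (lam * W - Λ * S) ^ 2 / (2 * lam) := by positivity
    have a2 : (lam * W - Λ * S) ^ 2 / (2 * lam) =
      lam / 2 * W ^ 2 + Λ ^ 2 / (2 * lam) * S ^ 2 - Λ * W * S := by field_simp; ring
    linarith
  have h7 : Λ * (2 * g * N + g) ≤ Λ * S ^ 2 := by
    gcongr
    calc 2 * g * N + g ≤ S := by linarith
      _ ≤ S ^ 2 := le_self_pow₀ hS1 two_ne_zero
  have h8 : S ^ 2 ≤ 12 * (1 + g ^ 2 * N ^ 2 + g ^ 2) := by
    have a1 : S ^ 2 = 3 * (1 + (2 * g * N) ^ 2 + g ^ 2) - (1 - 2 * g * N) ^ 2 - (1 - g) ^ 2 -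
        (2 * g * N - g) ^ 2 := by rw [hS]; ring
    have a2 : (2 * g * N) ^ 2 = 4 * (g ^ 2 * N ^ 2) := by ring
    linarith [sq_nonneg (1 - 2 * g * N), sq_nonneg (1 - g), sq_nonneg (2 * g * N - g), sq_nonneg g,
      sq_nonneg (g * N), mul_pow g N 2]
  have h9 : (Λ ^ 2 / (2 * lam) + Λ) * S ^ 2 ≤
      12 * (Λ ^ 2 / (2 * lam) + Λ) * (1 + g ^ 2 * N ^ 2 + g ^ 2) := by
    calc _ ≤ (Λ ^ 2 / (2 * lam) + Λ) * (12 * (1 + g ^ 2 * N ^ 2 + g ^ 2)) := by gcongr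
      _ = _ := by ring
  have h10 : lam / 2 * (g ^ 2 * N ^ 2) ≤ lam * (1 + g ^ 2 * N ^ 2 + g ^ 2) := by
    have : 0 ≤ g ^ 2 * N ^ 2 := by positivity
    have : 0 ≤ g ^ 2 := by positivity
    gcongr <;> linarith
  have h11 : lam / 4 * ‖η • w' + g • η'‖ ^ 2 ≤ lam / 2 * W ^ 2 + lam / 2 * (g ^ 2 * N ^ 2) := by
    calc _ ≤ lam / 4 * (2 * W ^ 2 + 2 * (g ^ 2 * N ^ 2)) := by gcongr
      _ = _ := by ring
  have h12 : η ^ 2 * (lam * ‖w'‖ ^ 2) = lam * W ^ 2 := by rw [hW]; ring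
  have h13 : Λ * W * S = Λ * W + 2 * g * N * Λ * W + Λ * g * W := by rw [hS]; ring
  have h14 : caccK lam Λ * (1 + g ^ 2 * N ^ 2 + g ^ 2) =
      12 * (Λ ^ 2 / (2 * lam) + Λ) * (1 + g ^ 2 * N ^ 2 + g ^ 2) +
        lam * (1 + g ^ 2 * N ^ 2 + g ^ 2) := by rw [caccK]; ring
  have h15 : (Λ ^ 2 / (2 * lam) + Λ) * S ^ 2 = Λ ^ 2 / (2 * lam) * S ^ 2 + Λ * S ^ 2 := by ring
  have h16 : 2 * g * N * Λ * (W + 1) = 2 * g * N * Λ * W + Λ * (2 * g * N) := by ring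
  have h17 : Λ * g * (1 + W) = Λ * g + Λ * g * W := by ring
  have h18 : Λ * (2 * g * N + g) = Λ * (2 * g * N) + Λ * g := by ring
  rw [e, h14]
  linarith

end Caccioppoli

section DifferenceQuotient

lemma gradient_translate (f : Eucl n → ℝ) (v x : Eucl n) :
    gradient (fun y => f (y + v)) x = gradient f (x + v) := by
  simp only [gradient, fderiv_comp_add_right]

lemma hasGradientAt_translate {f : Eucl n → ℝ} {g v x : Eucl n} (h : HasGradientAt f g (x + v)) :
    HasGradientAt (fun y => f (y + v)) g x := by
  rw [hasGradientAt_iff_hasFDerivAt] at *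
  exact (hasFDerivAt_comp_add_right v).2 h

lemma hasGradientAt_sub {f g : Eucl n → ℝ} {f' g' x : Eucl n} (hf : HasGradientAt f f' x)
    (hg : HasGradientAt g g' x) : HasGradientAt (fun y => f y - g y) (f' - g') x := by
  rw [hasGradientAt_iff_hasFDerivAt] at *
  rw [map_sub]
  exact hf.sub hg

lemma hasGradientAt_const_mul {f : Eucl n → ℝ} {f' x : Eucl n} (c : ℝ)
    (hf : HasGradientAt f f' x) : HasGradientAt (fun y => c * f y) (c • f') x := by
  rw [hasGradientAt_iff_hasFDerivAt] at *
  rw [map_smul]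
  exact hf.const_mul c

lemma ae_translate {p : Eucl n → Prop} (h : ∀ᵐ x, p x) (v : Eucl n) :
    ∀ᵐ x : Eucl n, p (x + v) :=
  (measurePreserving_add_right volume v).quasiMeasurePreserving.ae h

variable {F : Eucl n → ℝ → Eucl n → Eucl n} {F₀ : Eucl n → ℝ → Eucl n → ℝ} {u : Eucl n → ℝ}
  {L : ℝ≥0} {ρ lam Lam M : ℝ}

lemma integral_upper_translate {V φ' : Eucl n → Eucl n} {V₀ φ : Eucl n → ℝ} {x₀ v : Eucl n} {R : ℝ}
    (hv : ∀ x ∈ ball x₀ R, x + v ∈ upper n ↔ x ∈ upper n) (h0 : ∀ x, x ∉ ball x₀ R → φ x = 0)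
    (h0' : ∀ x, x ∉ ball x₀ R → φ' x = 0) :
    ∫ x in upper n, (⟪V x, φ' (x - v)⟫_ℝ + V₀ x * φ (x - v)) =
      ∫ x in upper n, (⟪V (x + v), φ' x⟫_ℝ + V₀ (x + v) * φ x) := by
  rw [← integral_indicator (measurableSet_upper), ← integral_indicator (measurableSet_upper),
    ← integral_add_right_eq_self _ v]
  congr 1
  ext x
  by_cases hx : x ∈ ball x₀ R
  · by_cases hu : x ∈ upper n
    · rw [Set.indicator_of_mem ((hv x hx).2 hu), Set.indicator_of_mem hu, add_sub_cancel_right]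
    · rw [Set.indicator_of_notMem (fun h => hu ((hv x hx).1 h)), Set.indicator_of_notMem hu]
  · simp only [Set.indicator, add_sub_cancel_right, h0 x hx, h0' x hx]
    simp

/-- The De Giorgi constant of difference quotients of a solution. -/
def dqQ (L : ℝ≥0) (lam Lam : ℝ) : ℝ := 8 * caccK lam (Lam * (1 + L)) / lam

lemma caccK_pos {lam Λ : ℝ} (h : 0 < lam) (h' : 0 < Λ) : 0 < caccK lam Λ := by
  unfold caccK; positivity

lemma dqQ_pos (hlam : 0 < lam) (hLam : 0 < Lam) : 0 < dqQ L lam Lam := by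
  have := caccK_pos hlam (Λ := Lam * (1 + L)) (by positivity)
  unfold dqQ; positivity

lemma Sol.diffQuot_pairing_nonpos (hs : Sol F F₀ u L ρ lam Lam M) {x₀ v : Eucl n} {R c ε : ℝ}
    {φ : Eucl n → ℝ} (hφ : LipBdd φ) {r : ℝ} (hrR : r < R)
    (hφ0 : ∀ x, x ∉ ball x₀ r → φ x = 0) (hR : ‖x₀‖ + R + ‖v‖ < ρ)
    (hv : ∀ x ∈ ball x₀ R, x + v ∈ upper n ↔ x ∈ upper n) (hε : 0 < ε)
    (hadm : ∀ x ∈ ball (0 : Eucl n) ρ, x (Fin.last n) = 0 → 0 ≤ u x + c * ε * (φ x - φ (x - v))) :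
    Integrable (fun x => c * (⟪F (x + v) (u (x + v)) (gradient u (x + v)) -
      F x (u x) (gradient u x), gradient φ x⟫_ℝ + (F₀ (x + v) (u (x + v)) (gradient u (x + v)) -
      F₀ x (u x) (gradient u x)) * φ x)) ∧
    ∫ x in upper n, c * (⟪F (x + v) (u (x + v)) (gradient u (x + v)) -
      F x (u x) (gradient u x), gradient φ x⟫_ℝ + (F₀ (x + v) (u (x + v)) (gradient u (x + v)) -
      F₀ x (u x) (gradient u x)) * φ x) ≤ 0 := by
  set V : Eucl n → Eucl n := fun x => F x (u x) (gradient u x) with hV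
  set V₀ : Eucl n → ℝ := fun x => F₀ x (u x) (gradient u x) with hV₀
  have hVm : Measurable V := measurable_flux hs.lipF hs.lip.continuous (measurable_gradient u)
  have hV₀m : Measurable V₀ :=
    measurable_flux (E := ℝ) (fun x y z z' p q => hs.lipF₀ x y z z' p q) hs.lip.continuous
      (measurable_gradient u)
  obtain ⟨K₁, hK₁⟩ := norm_flux_le hs.Lam_pos hs.lipF hs.lip (norm_gradient_le hs.lip) 1
  obtain ⟨K₂, hK₂⟩ := norm_flux_le (E := ℝ) hs.Lam_pos (fun x y z z' p q => hs.lipF₀ x y z z' p q)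
    hs.lip (norm_gradient_le hs.lip) 1
  have hφR : ∀ x, x ∉ ball x₀ R → φ x = 0 := fun x hx => hφ0 x fun h => hx (ball_subset_ball hrR.le h)
  have hg0 : ∀ x, x ∉ ball x₀ R → gradient φ x = 0 := fun x hx =>
    gradient_eq_zero_of_support hrR hφ0 hx
  have hcb : ∀ x ∈ closedBall x₀ R, x ∈ closedBall (0 : Eucl n) 1 ∧ x + v ∈ closedBall (0 : Eucl n) 1 := by
    intro x hx
    have h1 : dist x x₀ ≤ R := hx
    have h2 : ‖x‖ ≤ ‖x - x₀‖ + ‖x₀‖ := by simpa using norm_add_le (x - x₀) x₀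
    rw [dist_eq_norm] at h1
    have h3 := norm_add_le x v
    have := hs.rho_le
    have := norm_nonneg v
    rw [mem_closedBall_zero_iff, mem_closedBall_zero_iff]
    constructor <;> linarith
  have i1 : Integrable fun x => ⟪V (x + v), gradient φ x⟫_ℝ + V₀ (x + v) * φ x :=
    integrable_pairing (V := fun x => V (x + v)) (V₀ := fun x => V₀ (x + v)) (K := max K₁ K₂)
      (hVm.comp (measurable_id.add_const v))
      (hV₀m.comp (measurable_id.add_const v))
      (fun x hx => (hK₁ _ (hcb x hx).2).trans (le_max_left _ _))
      (fun x hx => (hK₂ _ (hcb x hx).2).trans (le_max_right _ _)) hφ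
      fun x hx => hφR x fun h => hx (ball_subset_closedBall h)
  have i2 : Integrable fun x => ⟪V x, gradient φ x⟫_ℝ + V₀ x * φ x :=
    integrable_pairing (K := max K₁ K₂) hVm hV₀m
      (fun x hx => (hK₁ _ (hcb x hx).1).trans (le_max_left _ _))
      (fun x hx => (hK₂ _ (hcb x hx).1).trans (le_max_right _ _)) hφ
      fun x hx => hφR x fun h => hx (ball_subset_closedBall h)
  have e : ∀ x, c * (⟪V (x + v) - V x, gradient φ x⟫_ℝ + (V₀ (x + v) - V₀ x) * φ x) =
      c * ((⟪V (x + v), gradient φ x⟫_ℝ + V₀ (x + v) * φ x) -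
        (⟪V x, gradient φ x⟫_ℝ + V₀ x * φ x)) := fun x => by
    rw [inner_sub_left]; ring
  show Integrable (fun x => c * (⟪V (x + v) - V x, gradient φ x⟫_ℝ + (V₀ (x + v) - V₀ x) * φ x)) ∧
    ∫ x in upper n, c * (⟪V (x + v) - V x, gradient φ x⟫_ℝ + (V₀ (x + v) - V₀ x) * φ x) ≤ 0
  simp only [e]
  refine ⟨(i1.sub i2).const_mul c, ?_⟩
  rw [integral_const_mul, integral_sub i1.integrableOn i2.integrableOn,
    ← integral_upper_translate hv hφR hg0]
  -- the test function
  have hφt : LipBdd fun x => φ (x - v) := by simpa [sub_eq_add_neg] using hφ.translate (-v)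
  have hζ : LipBdd fun x => c * ε * (φ x - φ (x - v)) := (LipBdd.const (c * ε)).mul (hφ.sub hφt)
  have hz0 : ∀ x, x ∉ ball (0 : Eucl n) (‖x₀‖ + R + ‖v‖) → c * ε * (φ x - φ (x - v)) = 0 := by
    intro x hx
    have hx : ‖x₀‖ + R + ‖v‖ ≤ ‖x‖ := by simpa using hx
    have := norm_nonneg v
    rw [hφR x, hφR (x - v)]
    · simp
    · intro h
      have h1 : dist (x - v) x₀ < R := h
      rw [dist_eq_norm] at h1
      have h2 : ‖x‖ ≤ ‖x - v - x₀‖ + ‖x₀‖ + ‖v‖ := by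
        have := norm_add_le (x - v - x₀ + x₀) v
        have := norm_add_le (x - v - x₀) x₀
        simp at *; linarith
      linarith
    · intro h
      have h1 : dist x x₀ < R := h
      rw [dist_eq_norm] at h1
      have h2 : ‖x‖ ≤ ‖x - x₀‖ + ‖x₀‖ := by simpa using norm_add_le (x - x₀) x₀
      linarith
  have hvi := hs.vi _ hζ _ hR hz0 hadm
  obtain ⟨C, hC, -⟩ := id hφ
  have hd := ae_hasGradientAt hC
  have hd' := ae_translate hd (-v)
  have hgt : ∀ x, gradient (fun y => φ (y - v)) x = gradient φ (x - v) := fun x => by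
    simpa [sub_eq_add_neg] using gradient_translate φ (-v) x
  have i3 : Integrable fun x => ⟪V x, gradient φ (x - v)⟫_ℝ + V₀ x * φ (x - v) := by
    have := i1.comp_sub_right v
    simpa using this
  have e2 : ∫ x in upper n, (⟪F x (u x) (gradient u x),
      gradient (fun x => c * ε * (φ x - φ (x - v))) x⟫_ℝ +
      F₀ x (u x) (gradient u x) * (c * ε * (φ x - φ (x - v)))) =
      ∫ x in upper n, c * ε * ((⟪V x, gradient φ x⟫_ℝ + V₀ x * φ x) -
        (⟪V x, gradient φ (x - v)⟫_ℝ + V₀ x * φ (x - v))) := by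
    refine integral_congr_ae (ae_restrict_of_ae ?_)
    filter_upwards [hd, hd'] with x h1 h2
    have h3 : HasGradientAt (fun y => φ (y - v)) (gradient φ (x - v)) x := by
      simpa [sub_eq_add_neg] using hasGradientAt_translate h2
    have h4 := hasGradientAt_const_mul (c * ε) (hasGradientAt_sub h1 h3)
    rw [h4.gradient, inner_smul_right, inner_sub_right]
    simp only [hV, hV₀]
    ring
  rw [e2, integral_const_mul, integral_sub i2.integrableOn i3.integrableOn] at hvi
  have h5 : 0 ≤ ε * (-(c * ((∫ x in upper n, (⟪V x, gradient φ (x - v)⟫_ℝ + V₀ x * φ (x - v))) -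
      ∫ x in upper n, (⟪V x, gradient φ x⟫_ℝ + V₀ x * φ x)))) := by
    refine hvi.trans_eq ?_
    ring
  have := nonneg_of_mul_nonneg_right h5 hε
  linarith

/-- The pointwise energy estimate for difference quotients. -/
lemma Sol.diffQuot_pointwise (hs : Sol F F₀ u L ρ lam Lam M) {x₀ v : Eucl n} {c : ℝ}
    (hcv : |c| * ‖v‖ = 1) {r r' : ℝ} (hrr : r < r') (hR : ‖x₀‖ + r' + ‖v‖ < ρ) (k : ℝ)
    {x : Eucl n} (h1 : HasGradientAt u (gradient u x) x)
    (h2 : HasGradientAt u (gradient u (x + v)) (x + v))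
    (h3 : HasGradientAt (cutoff x₀ r r') (gradient (cutoff x₀ r r') x) x) :
    lam / 4 * ‖gradient (fun y => cutoff x₀ r r' y * max (c * (u (y + v) - u y) - k) 0) x‖ ^ 2 ≤
      c * (⟪F (x + v) (u (x + v)) (gradient u (x + v)) -
      F x (u x) (gradient u x), gradient (fun y => cutoff x₀ r r' y * (cutoff x₀ r r' y *
        max (c * (u (y + v) - u y) - k) 0)) x⟫_ℝ + (F₀ (x + v) (u (x + v)) (gradient u (x + v)) -
      F₀ x (u x) (gradient u x)) * (cutoff x₀ r r' x * (cutoff x₀ r r' x *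
        max (c * (u (x + v) - u x) - k) 0))) +
      (ball x₀ r' ∩ {x | k < c * (u (x + v) - u x)}).indicator
        (fun x => caccK lam (Lam * (1 + L)) * (1 + ((r' - r)⁻¹ ^ 2 + 1) *
          max (c * (u (x + v) - u x) - k) 0 ^ 2)) x := by
  set w : Eucl n → ℝ := fun x => c * (u (x + v) - u x) with hw
  set η := cutoff x₀ r r' with hη
  set Λ := Lam * (1 + L) with hΛ
  have hΛ0 : 0 < Λ := by have := hs.Lam_pos; positivity
  have hLΛ : Lam ≤ Λ := by
    rw [hΛ]; have := hs.Lam_pos; have : 0 ≤ Lam * L := by positivity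
    linarith
  have hη0 : ∀ y, 0 ≤ η y := fun y => cutoff_nonneg
  have hK := caccK_pos hs.lam_pos hΛ0
  by_cases hx : x ∈ ball x₀ r' ∩ {x | k < w x}
  · rw [Set.indicator_of_mem hx]
    obtain ⟨hxb, hxk⟩ := hx
    have hxk : k < w x := hxk
    have hx1 : x ∈ ball (0 : Eucl n) ρ := by
      have h1 : dist x x₀ < r' := hxb
      have h2 : ‖x‖ ≤ ‖x - x₀‖ + ‖x₀‖ := by simpa using norm_add_le (x - x₀) x₀
      rw [dist_eq_norm] at h1
      rw [mem_ball_zero_iff]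
      have := norm_nonneg v
      linarith
    set a := gradient u (x + v) with ha
    set b := gradient u x with hb
    set w' := c • (a - b) with hw'
    have hwd : HasGradientAt w w' x :=
      hasGradientAt_const_mul c (hasGradientAt_sub (hasGradientAt_translate h2) h1)
    have hmax : (fun y => max (w y - k) 0) =ᶠ[𝓝 x] fun y => w y - k := by
      filter_upwards [hwd.continuousAt.eventually_const_lt hxk] with y hy
      rw [max_eq_left (by linarith)]
    have hmd : HasGradientAt (fun y => max (w y - k) 0) w' x := by
      rw [hasGradientAt_iff_hasFDerivAt] at *
      exact (hwd.sub_const k).congr_of_eventuallyEq hmax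
    have hfd := hasGradientAt_mul h3 hmd
    have hφd := hasGradientAt_mul h3 hfd
    rw [hφd.gradient, hfd.gradient]
    set η' := gradient η x with hη'
    set g := max (w x - k) 0 with hg
    have hN : ‖η'‖ ≤ (r' - r)⁻¹ := by
      have hl : LipschitzWith (Real.toNNReal (r' - r)⁻¹) η :=
        LipschitzWith.of_dist_le_mul fun y z => by
          rw [Real.coe_toNNReal _ (inv_nonneg.2 (by linarith)), Real.dist_eq]
          exact abs_cutoff_sub_le hrr y z
      have := norm_gradient_le hl x
      rwa [Real.coe_toNNReal _ (inv_nonneg.2 (by linarith))] at this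
    have hLM : (L : ℝ) ≤ M := by have := hs.M_ge; have := L.2; simp at *; linarith
    have hbM : ‖b‖ ≤ M := (norm_gradient_le hs.lip x).trans hLM
    have haM : ‖a‖ ≤ M := (norm_gradient_le hs.lip _).trans hLM
    have hux : |u (x + v) - u x| ≤ L * ‖v‖ := by
      have := hs.lip.dist_le_mul (x + v) x
      rwa [Real.dist_eq, dist_eq_norm, add_sub_cancel_left] at this
    have hw'n : ‖w'‖ = |c| * ‖a - b‖ := by rw [hw', norm_smul, Real.norm_eq_abs]
    have key := cacc_pointwise (η := η x) (g := g) (η' := η') (w' := w')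
      (A := c • (F x (u x) a - F x (u x) b)) (E' := c • (F (x + v) (u (x + v)) a - F x (u x) a))
      (d₀ := c * (F₀ (x + v) (u (x + v)) a - F₀ x (u x) b)) hs.lam_pos hΛ0 (hη0 x) cutoff_le_one
      (le_max_right _ _) ?_ ?_ ?_ ?_
    · rw [← smul_add, add_comm (F x (u x) a - F x (u x) b), sub_add_sub_cancel,
        real_inner_smul_left] at key
      have hN2 : ‖η'‖ ^ 2 ≤ (r' - r)⁻¹ ^ 2 := by gcongr
      have hlast : caccK lam Λ * (1 + g ^ 2 * ‖η'‖ ^ 2 + g ^ 2) ≤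
          caccK lam Λ * (1 + ((r' - r)⁻¹ ^ 2 + 1) * g ^ 2) := by
        have : g ^ 2 * ‖η'‖ ^ 2 ≤ g ^ 2 * (r' - r)⁻¹ ^ 2 := by gcongr
        refine mul_le_mul_of_nonneg_left ?_ hK.le
        linarith
      refine key.trans ?_
      have : c * (F₀ (x + v) (u (x + v)) a - F₀ x (u x) b) * (η x * (η x * g)) =
        c * ((F₀ (x + v) (u (x + v)) a - F₀ x (u x) b) * (η x * (η x * g))) := by ring
      rw [this, ← mul_add]
      exact add_le_add le_rfl hlast
    · rw [hw'n, hw', real_inner_smul_left, real_inner_smul_right]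
      have := hs.mono x hx1 (u x) (hs.bdd x hx1) a b haM hbM
      have h5 : c * c * (lam * ‖a - b‖ ^ 2) ≤ c * c * ⟪F x (u x) a - F x (u x) b, a - b⟫_ℝ := by
        gcongr; exact mul_self_nonneg c
      have h6 : lam * (|c| * ‖a - b‖) ^ 2 = c * c * (lam * ‖a - b‖ ^ 2) := by
        rw [mul_pow, sq_abs]; ring
      linarith
    · rw [norm_smul, hw'n, Real.norm_eq_abs]
      have := hs.lipF x x (u x) (u x) a b
      simp only [dist_self, sub_self, abs_zero, zero_add] at this
      calc |c| * ‖F x (u x) a - F x (u x) b‖ ≤ |c| * (Lam * ‖a - b‖) := by gcongr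
        _ = Lam * (|c| * ‖a - b‖) := by ring
        _ ≤ Λ * (|c| * ‖a - b‖) := by gcongr
    · rw [norm_smul, Real.norm_eq_abs]
      have := hs.lipF (x + v) x (u (x + v)) (u x) a a
      rw [sub_self, norm_zero, add_zero, dist_eq_norm, add_sub_cancel_left] at this
      have hl := hs.Lam_pos
      calc |c| * ‖F (x + v) (u (x + v)) a - F x (u x) a‖ ≤ |c| * (Lam * (‖v‖ + L * ‖v‖)) := by
            gcongr; exact this.trans (by gcongr)
        _ = (|c| * ‖v‖) * Λ := by rw [hΛ]; ring
        _ = Λ := by rw [hcv, one_mul]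
    · rw [abs_mul, hw'n]
      have := hs.lipF₀ (x + v) x (u (x + v)) (u x) a b
      rw [dist_eq_norm, add_sub_cancel_left] at this
      have hl := hs.Lam_pos
      calc |c| * |F₀ (x + v) (u (x + v)) a - F₀ x (u x) b|
            ≤ |c| * (Lam * (‖v‖ + L * ‖v‖ + ‖a - b‖)) := by
            gcongr; exact this.trans (by gcongr)
        _ = (|c| * ‖v‖) * Λ + Lam * (|c| * ‖a - b‖) := by rw [hΛ]; ring
        _ ≤ 1 * Λ + Λ * (|c| * ‖a - b‖) := by rw [hcv]; gcongr
        _ = _ := by ring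
  · rw [Set.indicator_of_notMem hx]
    have hz : η x * max (w x - k) 0 = 0 := by
      by_cases hxb : x ∈ ball x₀ r'
      · have : ¬ k < w x := fun h => hx ⟨hxb, h⟩
        rw [max_eq_right (by linarith), mul_zero]
      · rw [hη, cutoff_eq_zero hrr hxb, zero_mul]
    have g1 : gradient (fun y => η y * max (w y - k) 0) x = 0 :=
      gradient_eq_zero_of_nonneg (fun y => mul_nonneg (hη0 y) (le_max_right _ _)) hz
    have hz' : η x * (η x * max (w x - k) 0) = 0 := by rw [hz, mul_zero]
    have g2 : gradient (fun y => η y * (η y * max (w y - k) 0)) x = 0 :=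
      gradient_eq_zero_of_nonneg
        (fun y => mul_nonneg (hη0 y) (mul_nonneg (hη0 y) (le_max_right _ _))) hz'
    rw [g1, g2, hz']
    simp

lemma lipBdd_diffQuot (hu : LipschitzWith L u) (c : ℝ) (v : Eucl n) :
    LipBdd fun x => c * (u (x + v) - u x) := by
  have hd : ∀ x y, |u x - u y| ≤ L * dist x y := fun x y => by
    simpa [Real.dist_eq] using hu.dist_le_mul x y
  refine LipBdd.of_bounds (C := |c| * (2 * L)) (A := |c| * (L * ‖v‖)) (fun x y => ?_) fun x => ?_
  · rw [← mul_sub, abs_mul, mul_assoc]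
    gcongr
    have h1 := hd (x + v) (y + v)
    have h2 := hd x y
    rw [dist_add_right] at h1
    have := abs_sub (u (x + v) - u (y + v)) (u x - u y)
    rw [show u (x + v) - u x - (u (y + v) - u y) = u (x + v) - u (y + v) - (u x - u y) by ring]
    linarith
  · rw [abs_mul]; gcongr
    have := hd (x + v) x
    rwa [dist_eq_norm, add_sub_cancel_left] at this

/-- Difference quotients of solutions belong to De Giorgi's class. -/
lemma Sol.cacc_diffQuot (hs : Sol F F₀ u L ρ lam Lam M) {x₀ v : Eucl n} {R c k₀ : ℝ}
    (hcv : |c| * ‖v‖ = 1) (hR : ‖x₀‖ + R + ‖v‖ < ρ)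
    (hv : ∀ x ∈ ball x₀ R, x + v ∈ upper n ↔ x ∈ upper n)
    (hadm : ∀ k, k₀ ≤ k → ∃ ε, 0 < ε ∧ ∀ x ∈ ball (0 : Eucl n) ρ, x (Fin.last n) = 0 →
      (x ∈ ball x₀ R → -c * ε * max (c * (u (x + v) - u x) - k) 0 ≤ u x) ∧
      (x - v ∈ ball x₀ R → c * ε * max (c * (u x - u (x - v)) - k) 0 ≤ u x)) :
    ∀ R' < R, Cacc (fun x => c * (u (x + v) - u x)) (dqQ L lam Lam) x₀ R' k₀ := by
  intro R' hR' k hk r r' hr hrr hr'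
  obtain ⟨ε, hε, hadm⟩ := hadm k hk
  set w : Eucl n → ℝ := fun x => c * (u (x + v) - u x) with hw
  have hwL : LipBdd w := lipBdd_diffQuot hs.lip c v
  set η := cutoff x₀ r r' with hη
  have hηL : LipBdd η := cutoff_lipBdd hrr
  set φ : Eucl n → ℝ := fun y => η y * (η y * max (w y - k) 0) with hφ
  have hφL : LipBdd φ := hηL.mul (hηL.mul (hwL.trunc k))
  have hφ0 : ∀ x, x ∉ ball x₀ r' → φ x = 0 := fun x hx => by
    simp only [hφ, hη]; rw [cutoff_eq_zero hrr hx, zero_mul]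
  have hφn : ∀ x, 0 ≤ φ x := fun x =>
    mul_nonneg cutoff_nonneg (mul_nonneg cutoff_nonneg (le_max_right _ _))
  have hφle : ∀ x, φ x ≤ max (w x - k) 0 := fun x => by
    have h0 : 0 ≤ max (w x - k) 0 := le_max_right _ _
    have h1 : η x * max (w x - k) 0 ≤ 1 * max (w x - k) 0 := by gcongr; exact cutoff_le_one
    have h2 : η x * (η x * max (w x - k) 0) ≤ 1 * (1 * max (w x - k) 0) :=
      mul_le_mul cutoff_le_one h1 (mul_nonneg cutoff_nonneg h0) zero_le_one
    simpa using h2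
  have hφadm : ∀ x ∈ ball (0 : Eucl n) ρ, x (Fin.last n) = 0 →
      0 ≤ u x + c * ε * (φ x - φ (x - v)) := by
    intro x hx hx0
    obtain ⟨h1, h2⟩ := hadm x hx hx0
    have hu0 := hs.nonneg x hx hx0
    have hr'R : r' ≤ R := hr'.trans hR'.le
    rcases le_total 0 c with hc | hc
    · have h3 : c * ε * φ (x - v) ≤ u x := by
        by_cases hb : x - v ∈ ball x₀ R
        · refine le_trans ?_ (h2 hb)
          have := hφle (x - v)
          simp only [hw, sub_add_cancel] at this
          gcongr
        · rw [hφ0 _ fun h => hb (ball_subset_ball hr'R h), mul_zero]; exact hu0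
      have h4 : 0 ≤ c * ε * φ x := mul_nonneg (mul_nonneg hc hε.le) (hφn x)
      linarith
    · have h3 : -c * ε * φ x ≤ u x := by
        by_cases hb : x ∈ ball x₀ R
        · refine le_trans ?_ (h1 hb)
          have := hφle x
          have : 0 ≤ -c * ε := mul_nonneg (by linarith) hε.le
          gcongr
        · rw [hφ0 _ fun h => hb (ball_subset_ball hr'R h), mul_zero]; exact hu0
      have h4 : 0 ≤ -c * ε * φ (x - v) := mul_nonneg (mul_nonneg (by linarith) hε.le) (hφn _)
      linarith
  obtain ⟨hI, hneg⟩ := hs.diffQuot_pairing_nonpos hφL (hr'.trans_lt hR') hφ0 hR hv hε hφadm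
  obtain ⟨C, hC, -⟩ := id hηL
  have hae := ae_hasGradientAt hs.lip
  set S := ball x₀ r' ∩ {x | k < w x} with hS
  have hSm : MeasurableSet S :=
    measurableSet_ball.inter (isOpen_lt continuous_const hwL.continuous).measurableSet
  set Kc := caccK lam (Lam * (1 + L)) with hKc
  have hKpos : 0 < Kc := caccK_pos hs.lam_pos (by have := hs.Lam_pos; positivity)
  set T := ball x₀ r' ∩ upper n ∩ {x | k < w x} with hT
  have hTS : upper n ∩ S = T := by rw [hS, hT]; ext x; simp only [Set.mem_inter_iff]; tauto
  have hTfin : volume T ≠ ∞ :=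
    ((measure_mono Set.inter_subset_left).trans_lt (volume_inter_upper_lt_top _ _ _)).ne
  have ig : IntegrableOn (fun x => max (w x - k) 0 ^ 2) (ball x₀ r' ∩ upper n) :=
    integrableOn_trunc hwL.continuous _ _ _ _
  have iT : IntegrableOn (fun x => max (w x - k) 0 ^ 2) T := ig.mono_set Set.inter_subset_left
  have i1T : Integrable (fun _ : Eucl n => (1 : ℝ)) (volume.restrict T) := integrableOn_const hTfin
  have iK : IntegrableOn (fun x => Kc * (1 + ((r' - r)⁻¹ ^ 2 + 1) * max (w x - k) 0 ^ 2)) T :=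
    ((integrableOn_const hTfin).add (iT.const_mul _)).const_mul _
  have iind : IntegrableOn (S.indicator fun x =>
      Kc * (1 + ((r' - r)⁻¹ ^ 2 + 1) * max (w x - k) 0 ^ 2)) (upper n) := by
    rw [IntegrableOn, integrable_indicator_iff hSm, IntegrableOn, Measure.restrict_restrict hSm,
      Set.inter_comm, hTS]
    exact iK
  have hpt : ∀ᵐ x ∂volume.restrict (upper n), lam / 4 * ‖gradient (fun y => η y * max (w y - k) 0) x‖ ^ 2 ≤
      c * (⟪F (x + v) (u (x + v)) (gradient u (x + v)) -
      F x (u x) (gradient u x), gradient φ x⟫_ℝ + (F₀ (x + v) (u (x + v)) (gradient u (x + v)) -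
      F₀ x (u x) (gradient u x)) * φ x) + S.indicator (fun x =>
      Kc * (1 + ((r' - r)⁻¹ ^ 2 + 1) * max (w x - k) 0 ^ 2)) x := by
    refine ae_restrict_of_ae ?_
    filter_upwards [hae, ae_translate hae v, ae_hasGradientAt hC] with x h1 h2 h3
    exact hs.diffQuot_pointwise hcv hrr (by linarith) k h1 h2 h3
  have hint := integral_mono_of_nonneg (μ := volume.restrict (upper n))
    (Eventually.of_forall fun x => by have := hs.lam_pos; positivity)
    (hI.integrableOn.add iind) hpt
  have eK : ∫ x in T, Kc * (1 + ((r' - r)⁻¹ ^ 2 + 1) * max (w x - k) 0 ^ 2) =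
      Kc * (volume.real T + ((r' - r)⁻¹ ^ 2 + 1) * ∫ x in T, max (w x - k) 0 ^ 2) := by
    rw [integral_const_mul, integral_add i1T (iT.const_mul _), integral_const_mul,
      setIntegral_const, smul_eq_mul, mul_one]
  rw [integral_const_mul] at hint
  simp only [Pi.add_apply] at hint
  rw [integral_add hI.integrableOn iind,
    setIntegral_indicator hSm, hTS, eK] at hint
  have hIT : ∫ x in T, max (w x - k) 0 ^ 2 ≤ ∫ x in ball x₀ r' ∩ upper n, max (w x - k) 0 ^ 2 :=
    setIntegral_mono_set ig (Eventually.of_forall fun x => by positivity)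
      Set.inter_subset_left.eventuallyLE
  set I := ∫ x in ball x₀ r' ∩ upper n, max (w x - k) 0 ^ 2 with hIdef
  have hI0 : 0 ≤ I := integral_nonneg fun x => by positivity
  set J := ∫ x in upper n, ‖gradient (fun y => η y * max (w y - k) 0) x‖ ^ 2 with hJ
  set m := volume.real T with hm
  have hm0 : 0 ≤ m := measureReal_nonneg
  have hd1 : r' - r ≤ 1 := by
    have := hs.rho_le; have := norm_nonneg v; have := norm_nonneg x₀; linarith
  have hd0 : 0 < r' - r := by linarith
  have hinv : 1 ≤ (r' - r)⁻¹ ^ 2 := one_le_pow₀ (one_le_inv_iff₀.2 ⟨hd0, hd1⟩)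
  have h1 : lam / 4 * J ≤ Kc * (m + (r' - r)⁻¹ ^ 2 * 2 * I) := by
    have h2 : ((r' - r)⁻¹ ^ 2 + 1) * (∫ x in T, max (w x - k) 0 ^ 2) ≤ (r' - r)⁻¹ ^ 2 * 2 * I := by
      calc _ ≤ ((r' - r)⁻¹ ^ 2 + 1) * I := by gcongr
        _ ≤ _ := by gcongr; linarith
    have h3 : Kc * (m + ((r' - r)⁻¹ ^ 2 + 1) * (∫ x in T, max (w x - k) 0 ^ 2)) ≤
      Kc * (m + (r' - r)⁻¹ ^ 2 * 2 * I) := by gcongr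
    linarith
  have hl := hs.lam_pos
  have h2 : J ≤ 4 * Kc / lam * (m + (r' - r)⁻¹ ^ 2 * 2 * I) := by
    rw [div_mul_eq_mul_div, le_div_iff₀ hl]
    linarith
  have hQ : dqQ L lam Lam = 8 * Kc / lam := rfl
  rw [hQ]
  refine h2.trans ?_
  have h3 : 8 * Kc / lam / (r' - r) ^ 2 * I + 8 * Kc / lam * m =
      4 * Kc / lam * (m + (r' - r)⁻¹ ^ 2 * 2 * I) + 4 * Kc / lam * m := by
    field_simp; ring
  have : 0 ≤ 4 * Kc / lam * m := by positivity
  linarith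

end DifferenceQuotient

section Oscillation

lemma abs_sub_inner_le_of_shift {f : Eucl n → ℝ} {S : Set (Eucl n)} (hS : Convex ℝ S)
    {x₁ p v : Eucl n} (hp : HasGradientAt f p x₁) {ε : ℝ}
    (h : ∀ᶠ N : ℕ in atTop, ∀ z ∈ S,
      |(f (z + (N : ℝ)⁻¹ • v) - f z) - (f (x₁ + (N : ℝ)⁻¹ • v) - f x₁)| ≤ ε * ‖(N : ℝ)⁻¹ • v‖)
    {x : Eucl n} (hx : x ∈ S) (hxv : x + v ∈ S) :
    |f (x + v) - f x - ⟪p, v⟫_ℝ| ≤ ε * ‖v‖ := by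
  have hlim : Tendsto (fun N : ℕ => (N : ℝ) * (f (x₁ + (N : ℝ)⁻¹ • v) - f x₁)) atTop
      (𝓝 ⟪p, v⟫_ℝ) := by
    have h1 : HasLineDerivAt ℝ f ⟪p, v⟫_ℝ x₁ v := by
      have := (hasGradientAt_iff_hasFDerivAt.1 hp).hasLineDerivAt v
      simpa using this
    have h2 := h1.tendsto_slope_zero
    have h3 : Tendsto (fun N : ℕ => (N : ℝ)⁻¹) atTop (𝓝[≠] 0) := by
      refine tendsto_nhdsWithin_iff.2 ⟨tendsto_inv_atTop_nhds_zero_nat, ?_⟩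
      filter_upwards [eventually_gt_atTop 0] with N hN
      have : (0 : ℝ) < N := by exact_mod_cast hN
      exact (inv_pos.2 this).ne'
    have h4 := h2.comp h3
    refine h4.congr fun N => ?_
    simp
  have hle : ∀ᶠ N : ℕ in atTop,
      |f (x + v) - f x - (N : ℝ) * (f (x₁ + (N : ℝ)⁻¹ • v) - f x₁)| ≤ ε * ‖v‖ := by
    filter_upwards [h, eventually_gt_atTop 0] with N hN hN0
    have hN0 : (0 : ℝ) < N := by exact_mod_cast hN0
    have htel : f (x + v) - f x =
        ∑ j ∈ Finset.range N, (f (x + ((j : ℝ) / N) • v + (N : ℝ)⁻¹ • v) - f (x + ((j : ℝ) / N) • v)) := by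
      have h1 := Finset.sum_range_sub (fun j : ℕ => f (x + ((j : ℝ) / N) • v)) N
      rw [div_self hN0.ne', one_smul, Nat.cast_zero, zero_div, zero_smul, add_zero] at h1
      rw [← h1]
      refine Finset.sum_congr rfl fun j _ => ?_
      congr 2
      rw [add_assoc, ← add_smul]
      congr 2
      push_cast
      field_simp
    have hconst : (N : ℝ) * (f (x₁ + (N : ℝ)⁻¹ • v) - f x₁) =
        ∑ j ∈ Finset.range N, (f (x₁ + (N : ℝ)⁻¹ • v) - f x₁) := by simp [mul_sub]
    rw [htel, hconst, ← Finset.sum_sub_distrib]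
    refine (Finset.abs_sum_le_sum_abs _ _).trans ?_
    have hb : ∀ j ∈ Finset.range N, |f (x + ((j : ℝ) / N) • v + (N : ℝ)⁻¹ • v) -
        f (x + ((j : ℝ) / N) • v) - (f (x₁ + (N : ℝ)⁻¹ • v) - f x₁)| ≤ ε * ‖(N : ℝ)⁻¹ • v‖ := by
      intro j hj
      refine hN _ ?_
      have hj : (j : ℝ) < N := by exact_mod_cast Finset.mem_range.1 hj
      refine hS.add_smul_mem hx hxv ⟨by positivity, ?_⟩
      rw [div_le_one hN0]; exact hj.le
    refine (Finset.sum_le_sum hb).trans_eq ?_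
    rw [Finset.sum_const, Finset.card_range, nsmul_eq_mul, norm_smul, norm_inv,
      Real.norm_of_nonneg hN0.le]
    field_simp
  exact le_of_tendsto (tendsto_const_nhds.sub hlim).abs hle

variable {F : Eucl n → ℝ → Eucl n → Eucl n} {F₀ : Eucl n → ℝ → Eucl n → ℝ} {u : Eucl n → ℝ}
  {L : ℝ≥0} {ρ lam Lam M : ℝ}

lemma abs_diff_le (hu : LipschitzWith L u) (x v : Eucl n) : |u (x + v) - u x| ≤ L * ‖v‖ := by
  have := hu.dist_le_mul (x + v) x
  rwa [Real.dist_eq, dist_eq_norm, add_sub_cancel_left] at this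

/-- Small oscillation of difference quotients away from the contact set. -/
lemma Sol.osc_diffQuot (hs : Sol F F₀ u L ρ lam Lam M) {ε : ℝ} (hε : 0 < ε) :
    ∃ c ρ₀, 0 < c ∧ c ≤ 1 / 4 ∧ 0 < ρ₀ ∧ ∀ (x₀ : Eucl n) (R : ℝ), 0 < R → R ≤ ρ₀ →
      0 ≤ x₀ (Fin.last n) → ‖x₀‖ + R < ρ →
      (∃ δ, 0 < δ ∧ ∀ x ∈ ball x₀ R, x (Fin.last n) = 0 → δ ≤ u x) →
      ∀ v, ‖v‖ < R / 2 → (∀ x ∈ ball x₀ (R / 2), x + v ∈ upper n ↔ x ∈ upper n) →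
      ∀ x ∈ ball x₀ (c * R) ∩ upper n, ∀ y ∈ ball x₀ (c * R) ∩ upper n,
        |(u (x + v) - u x) - (u (y + v) - u y)| ≤ ε * ‖v‖ := by
  obtain ⟨c, ρ₀, hc, hc1, hρ₀, H⟩ := deGiorgi_osc n (dqQ_pos (L := L) hs.lam_pos hs.Lam_pos)
    (L := L + 1) (by positivity) hε
  refine ⟨c / 4, ρ₀, by positivity, by linarith, hρ₀, ?_⟩
  rintro x₀ R hR hRρ hx₀ hRn ⟨δ, hδ, hδu⟩ v hvR hv x hx y hy
  rcases eq_or_ne v 0 with rfl | hv0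
  · simp
  have hvn : 0 < ‖v‖ := norm_pos_iff.2 hv0
  have key : ∀ c : ℝ, |c| * ‖v‖ = 1 → ∀ k, Cacc (fun x => c * (u (x + v) - u x)) (dqQ L lam Lam) x₀
      (R / 4) k := by
    intro c hcv k
    have hbd : ∀ x, |c * (u (x + v) - u x)| ≤ L := fun x => by
      rw [abs_mul]
      calc |c| * |u (x + v) - u x| ≤ |c| * (L * ‖v‖) := by gcongr; exact abs_diff_le hs.lip x v
        _ = (|c| * ‖v‖) * L := by ring
        _ = L := by rw [hcv, one_mul]
    refine hs.cacc_diffQuot (R := R / 2) hcv (by linarith) hv (fun k _ => ?_) _ (by linarith)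
    have hc0 : 0 < |c| := by
      by_contra h
      have : |c| = 0 := le_antisymm (not_lt.1 h) (abs_nonneg c)
      rw [this, zero_mul] at hcv; exact zero_ne_one hcv
    have hLk : 0 < (L : ℝ) + |k| + 1 := by positivity
    have hmax : ∀ x, max (c * (u (x + v) - u x) - k) 0 ≤ L + |k| + 1 := fun x =>
      max_le (by linarith [(abs_le.1 (hbd x)).2, neg_abs_le k]) hLk.le
    refine ⟨δ / (|c| * (L + |k| + 1)), by positivity, fun x hx hx0 => ⟨fun hb => ?_, fun hb => ?_⟩⟩
    · have h1 := hδu x (ball_subset_ball (by linarith) hb) hx0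
      refine le_trans ?_ h1
      calc -c * (δ / (|c| * (L + |k| + 1))) * max (c * (u (x + v) - u x) - k) 0
          ≤ |c| * (δ / (|c| * (L + |k| + 1))) * (L + |k| + 1) := by
            gcongr
            · exact neg_le_abs c
            · exact hmax x
        _ = δ := by field_simp
    · have hxb : x ∈ ball x₀ R := by
        have h1 : dist (x - v) x₀ < R / 2 := hb
        have h2 := dist_triangle x (x - v) x₀
        rw [dist_eq_norm x (x - v), sub_sub_cancel] at h2
        exact mem_ball.2 (by linarith)
      have h1 := hδu x hxb hx0
      refine le_trans ?_ h1
      have h2 := hmax (x - v)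
      rw [sub_add_cancel] at h2
      calc c * (δ / (|c| * (L + |k| + 1))) * max (c * (u x - u (x - v)) - k) 0
          ≤ |c| * (δ / (|c| * (L + |k| + 1))) * (L + |k| + 1) := by
            gcongr
            exact le_abs_self c
        _ = δ := by field_simp
  have hi : |‖v‖⁻¹| * ‖v‖ = 1 := by rw [abs_of_pos (inv_pos.2 hvn)]; field_simp
  have h1 := H (fun x => ‖v‖⁻¹ * (u (x + v) - u x)) x₀ (R / 4) (lipBdd_diffQuot hs.lip _ _)
    (by positivity) (by linarith) hx₀ (key _ hi) (fun k => by
      have := key (-‖v‖⁻¹) (by rwa [abs_neg]) k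
      simpa only [neg_mul] using this) (fun x _ => by
      rw [abs_mul]
      calc |‖v‖⁻¹| * |u (x + v) - u x| ≤ |‖v‖⁻¹| * (L * ‖v‖) := by
            gcongr; exact abs_diff_le hs.lip x v
        _ = (|‖v‖⁻¹| * ‖v‖) * L := by ring
        _ ≤ L + 1 := by rw [hi]; linarith)
    x ⟨ball_subset_ball (by linarith) hx.1, hx.2⟩ y ⟨ball_subset_ball (by linarith) hy.1, hy.2⟩
  rw [← mul_sub, abs_mul, abs_of_pos (inv_pos.2 hvn), inv_mul_le_iff₀ hvn] at h1
  linarith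

lemma convex_half_ball (x : Eucl n) (r : ℝ) : Convex ℝ (ball x r ∩ upper n) :=
  (convex_ball x r).inter convex_upper

lemma exists_hasGradientAt (hu : LipschitzWith L u) {U : Set (Eucl n)} (hU : IsOpen U)
    (hne : U.Nonempty) : ∃ x ∈ U, HasGradientAt u (gradient u x) x := by
  have := (ae_hasGradientAt hu).frequently
  by_contra! h
  have h1 : volume U = 0 := by
    refine measure_mono_null (fun x hx => ?_) (ae_hasGradientAt hu)
    exact h x hx
  exact (hU.measure_pos volume hne).ne' h1

/-- Interior flatness: a solution is uniformly close to affine functions in small balls. -/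
lemma Sol.interior_flat (hs : Sol F F₀ u L ρ lam Lam M) {ε : ℝ} (hε : 0 < ε) :
    ∃ c ρ₀, 0 < c ∧ c ≤ 1 / 4 ∧ 0 < ρ₀ ∧ ∀ (x₀ : Eucl n) (R : ℝ), 0 < R → R ≤ ρ₀ →
      ‖x₀‖ + R < ρ → ball x₀ R ⊆ upper n → ∃ p : Eucl n, ‖p‖ ≤ L ∧
      ∀ x ∈ ball x₀ (c * R), ∀ y ∈ ball x₀ (c * R), |u y - u x - ⟪p, y - x⟫_ℝ| ≤ ε * ‖y - x‖ := by
  obtain ⟨c, ρ₀, hc, hc1, hρ₀, H⟩ := hs.osc_diffQuot hε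
  refine ⟨c, ρ₀, hc, hc1, hρ₀, fun x₀ R hR hRρ hRn hsub => ?_⟩
  have hcR : c * R ≤ R := by nlinarith
  have hsub' : ball x₀ (c * R) ⊆ upper n := (ball_subset_ball hcR).trans hsub
  obtain ⟨x₁, hx₁, hd⟩ := exists_hasGradientAt hs.lip (isOpen_ball (x := x₀) (ε := c * R))
    ⟨x₀, mem_ball_self (by positivity)⟩
  refine ⟨_, norm_gradient_le hs.lip x₁, fun x hx y hy => ?_⟩
  have hx₀ : x₀ ∈ upper n := hsub (mem_ball_self hR)
  have h0 : 0 ≤ x₀ (Fin.last n) := le_of_lt hx₀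
  have h1 := abs_sub_inner_le_of_shift (convex_ball x₀ (c * R)) hd (v := y - x) (ε := ε) ?_ hx
    (by rwa [add_sub_cancel])
  · rwa [add_sub_cancel] at h1
  · have ht : Tendsto (fun N : ℕ => ‖(N : ℝ)⁻¹ • (y - x)‖) atTop (𝓝 0) := by
      have := ((tendsto_inv_atTop_nhds_zero_nat (𝕜 := ℝ)).smul_const (y - x)).norm
      simpa using this
    filter_upwards [ht.eventually_lt_const (half_pos hR)] with N hN z hz
    refine H x₀ R hR hRρ h0 hRn ⟨1, one_pos, fun x hx hx0 => ?_⟩ _ hN (fun x hx => ?_) z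
      ⟨hz, hsub' hz⟩ x₁ ⟨hx₁, hsub' hx₁⟩
    · have : 0 < x (Fin.last n) := hsub hx
      exact absurd hx0 this.ne'
    · refine ⟨fun _ => hsub (ball_subset_ball (by linarith) hx), fun _ => hsub ?_⟩
      have h1 : dist x x₀ < R / 2 := hx
      rw [mem_ball, dist_eq_norm, add_sub_right_comm]
      refine (norm_add_le _ _).trans_lt ?_
      rw [dist_eq_norm] at h1
      linarith

lemma hasGradientAt_of_flat {f : Eucl n → ℝ} {x : Eucl n} {C : ℝ}
    (h : ∀ ε > 0, ∃ p : Eucl n, ‖p‖ ≤ C ∧ ∀ᶠ y in 𝓝 x, |f y - f x - ⟪p, y - x⟫_ℝ| ≤ ε * ‖y - x‖) :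
    HasGradientAt f (gradient f x) x := by
  choose! p hp hpf using h
  have hseq : ∀ k : ℕ, p (1 / ((k : ℝ) + 1)) ∈ closedBall (0 : Eucl n) C := fun k => by
    rw [mem_closedBall_zero_iff]; exact hp _ (by positivity)
  obtain ⟨q, -, φ, hφ, hlim⟩ := (isCompact_closedBall (0 : Eucl n) C).tendsto_subseq hseq
  have : HasGradientAt f q x := by
    rw [hasGradientAt_iff_hasFDerivAt, hasFDerivAt_iff_isLittleO, Asymptotics.isLittleO_iff]
    intro ε hε
    have h1 : Tendsto (fun k : ℕ => 1 / (((φ k : ℕ) : ℝ) + 1)) atTop (𝓝 0) :=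
      (tendsto_one_div_add_atTop_nhds_zero_nat (𝕜 := ℝ)).comp hφ.tendsto_atTop
    have h2 := (tendsto_iff_norm_sub_tendsto_zero.1 hlim)
    obtain ⟨k, hk1, hk2⟩ := ((h1.eventually_lt_const (half_pos hε)).and
      (h2.eventually_lt_const (half_pos hε))).exists
    filter_upwards [hpf (1 / (((φ k : ℕ) : ℝ) + 1)) (by positivity)] with y hy
    rw [Real.norm_eq_abs, InnerProductSpace.toDual_apply_apply]
    set p' := p (1 / (((φ k : ℕ) : ℝ) + 1)) with hp'
    have h3 : f y - f x - ⟪q, y - x⟫_ℝ = (f y - f x - ⟪p', y - x⟫_ℝ) + ⟪p' - q, y - x⟫_ℝ := by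
      rw [inner_sub_left]; ring
    have h4 := abs_real_inner_le_norm (p' - q) (y - x)
    have hk2 : ‖p' - q‖ < ε / 2 := hk2
    rw [h3]
    refine (abs_add_le _ _).trans ?_
    have h5 : ‖p' - q‖ * ‖y - x‖ ≤ ε / 2 * ‖y - x‖ := by gcongr
    have h6 : 1 / (((φ k : ℕ) : ℝ) + 1) * ‖y - x‖ ≤ ε / 2 * ‖y - x‖ := by gcongr
    linarith
  rwa [this.gradient]

lemma norm_sub_le_of_flat {f : Eucl n → ℝ} {x p q : Eucl n} {ε : ℝ} (hf : HasGradientAt f q x)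
    (h : ∀ᶠ y in 𝓝 x, |f y - f x - ⟪p, y - x⟫_ℝ| ≤ ε * ‖y - x‖) (v : Eucl n) :
    |⟪q - p, v⟫_ℝ| ≤ ε * ‖v‖ := by
  have h1 : HasLineDerivAt ℝ f ⟪q, v⟫_ℝ x v := by
    have := (hasGradientAt_iff_hasFDerivAt.1 hf).hasLineDerivAt v
    simpa using this
  have h2 := (h1.tendsto_slope_zero.mono_left (nhdsGT_le_nhdsNE 0)).sub_const ⟪p, v⟫_ℝ
  rw [inner_sub_left]
  refine le_of_tendsto h2.abs ?_
  have h3 : Tendsto (fun t : ℝ => x + t • v) (𝓝[>] 0) (𝓝 x) := by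
    have : Tendsto (fun t : ℝ => x + t • v) (𝓝 0) (𝓝 (x + (0 : ℝ) • v)) :=
      (Continuous.tendsto (by fun_prop) 0)
    rw [zero_smul, add_zero] at this
    exact this.mono_left nhdsWithin_le_nhds
  filter_upwards [h3.eventually h, self_mem_nhdsWithin] with t ht ht0
  have ht0 : 0 < t := ht0
  rw [add_sub_cancel_left, inner_smul_right, norm_smul, Real.norm_of_nonneg ht0.le] at ht
  rw [smul_eq_mul, show t⁻¹ * (f (x + t • v) - f x) - ⟪p, v⟫_ℝ =
    t⁻¹ * (f (x + t • v) - f x - t * ⟪p, v⟫_ℝ) by field_simp, abs_mul, abs_of_pos (inv_pos.2 ht0),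
    inv_mul_le_iff₀ ht0]
  linarith

lemma norm_le_of_inner_le {w : Eucl n} {ε : ℝ} (h : |⟪w, w⟫_ℝ| ≤ ε * ‖w‖) (hε : 0 ≤ ε) : ‖w‖ ≤ ε := by
  rcases eq_or_ne w 0 with rfl | hw
  · simpa using hε
  · have : 0 < ‖w‖ := norm_pos_iff.2 hw
    rw [real_inner_self_eq_norm_sq, abs_of_nonneg (by positivity), sq] at h
    exact le_of_mul_le_mul_right h this

/-- Solutions are differentiable in the interior. -/
lemma Sol.hasGradientAt (hs : Sol F F₀ u L ρ lam Lam M) {x : Eucl n}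
    (hx : x ∈ ball (0 : Eucl n) ρ) (hxu : x ∈ upper n) : HasGradientAt u (gradient u x) x := by
  refine hasGradientAt_of_flat (C := L) fun ε hε => ?_
  obtain ⟨c, ρ₀, hc, hc1, hρ₀, H⟩ := hs.interior_flat hε
  obtain ⟨r, hr, hball⟩ := Metric.isOpen_iff.1 isOpen_upper x hxu
  have hx : ‖x‖ < ρ := by simpa using hx
  set R := min (min ρ₀ r) ((ρ - ‖x‖) / 2) with hR
  have hR0 : 0 < R := by
    have : 0 < (ρ - ‖x‖) / 2 := by linarith
    positivity
  obtain ⟨p, hp, hpf⟩ := H x R hR0 ((min_le_left _ _).trans (min_le_left _ _))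
    (by have := min_le_right (min ρ₀ r) ((ρ - ‖x‖) / 2); linarith)
    ((ball_subset_ball ((min_le_left _ _).trans (min_le_right _ _))).trans hball)
  have hc0 : 0 < c * R := by positivity
  exact ⟨p, hp, by filter_upwards [ball_mem_nhds x hc0] with y hy using hpf x (mem_ball_self hc0) y hy⟩

lemma Sol.interior_gradient (hs : Sol F F₀ u L ρ lam Lam M) {ε : ℝ} (hε : 0 < ε) :
    ∃ c ρ₀, 0 < c ∧ c ≤ 1 / 4 ∧ 0 < ρ₀ ∧ ∀ (x₀ : Eucl n) (R : ℝ), 0 < R → R ≤ ρ₀ →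
      ‖x₀‖ + R < ρ → ball x₀ R ⊆ upper n → ∃ p : Eucl n,
      (∀ x ∈ ball x₀ (c * R), ∀ y ∈ ball x₀ (c * R), |u y - u x - ⟪p, y - x⟫_ℝ| ≤ ε * ‖y - x‖) ∧
      ∀ x ∈ ball x₀ (c * R), ‖gradient u x - p‖ ≤ ε := by
  obtain ⟨c, ρ₀, hc, hc1, hρ₀, H⟩ := hs.interior_flat hε
  refine ⟨c, ρ₀, hc, hc1, hρ₀, fun x₀ R hR hRρ hRn hsub => ?_⟩
  obtain ⟨p, hp, hpf⟩ := H x₀ R hR hRρ hRn hsub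
  refine ⟨p, hpf, fun x hx => ?_⟩
  have hxR : x ∈ ball x₀ R := ball_subset_ball (by nlinarith) hx
  have hx0 : x ∈ ball (0 : Eucl n) ρ := by
    have h1 : dist x x₀ < R := hxR
    rw [dist_eq_norm] at h1
    have := norm_add_le (x - x₀) x₀
    rw [sub_add_cancel] at this
    rw [mem_ball_zero_iff]; linarith
  refine norm_le_of_inner_le (norm_sub_le_of_flat (hs.hasGradientAt hx0 (hsub hxR)) ?_ _) hε.le
  filter_upwards [isOpen_ball.mem_nhds hx] with y hy using hpf x hx y hy

lemma Sol.continuousAt_gradient (hs : Sol F F₀ u L ρ lam Lam M) {x : Eucl n}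
    (hx : x ∈ ball (0 : Eucl n) ρ) (hxu : x ∈ upper n) : ContinuousAt (gradient u) x := by
  rw [Metric.continuousAt_iff']
  intro ε hε
  obtain ⟨c, ρ₀, hc, hc1, hρ₀, H⟩ := hs.interior_gradient (show 0 < ε / 3 by positivity)
  obtain ⟨r, hr, hball⟩ := Metric.isOpen_iff.1 isOpen_upper x hxu
  have hx : ‖x‖ < ρ := by simpa using hx
  set R := min (min ρ₀ r) ((ρ - ‖x‖) / 2) with hR
  have hR0 : 0 < R := by
    have : 0 < (ρ - ‖x‖) / 2 := by linarith
    positivity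
  obtain ⟨p, -, hpf⟩ := H x R hR0 ((min_le_left _ _).trans (min_le_left _ _))
    (by have := min_le_right (min ρ₀ r) ((ρ - ‖x‖) / 2); linarith)
    ((ball_subset_ball ((min_le_left _ _).trans (min_le_right _ _))).trans hball)
  have hc0 : 0 < c * R := by positivity
  filter_upwards [ball_mem_nhds x hc0] with y hy
  have h1 := hpf y hy
  have h2 := hpf x (mem_ball_self hc0)
  rw [dist_eq_norm]
  have h3 : gradient u y - gradient u x = (gradient u y - p) - (gradient u x - p) := by abel
  rw [h3]
  exact (norm_sub_le _ _).trans_lt (by linarith)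

/-- If a solution is close to an affine function in an interior ball, then so are the gradients. -/
lemma Sol.gradient_close (hs : Sol F F₀ u L ρ lam Lam M) {ε : ℝ} (hε : 0 < ε) :
    ∃ c ρ₀, 0 < c ∧ 0 < ρ₀ ∧ ∀ (x₀ : Eucl n) (R : ℝ), 0 < R → R ≤ ρ₀ →
      ‖x₀‖ + R < ρ → ball x₀ R ⊆ upper n → ∀ (b : Eucl n) (β σ : ℝ),
      (∀ x ∈ ball x₀ R, |u x - β - ⟪b, x - x₀⟫_ℝ| ≤ σ * R) → ‖gradient u x₀ - b‖ ≤ ε + σ / c := by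
  obtain ⟨c, ρ₀, hc, hc1, hρ₀, H⟩ := hs.interior_gradient (show 0 < ε / 2 by positivity)
  refine ⟨c / 4, ρ₀, by positivity, hρ₀, fun x₀ R hR hRρ hRn hsub b β σ hb => ?_⟩
  obtain ⟨p, hpf, hpg⟩ := H x₀ R hR hRρ hRn hsub
  have hcR : 0 < c * R := by positivity
  have hσ : 0 ≤ σ := by
    have := (abs_nonneg _).trans (hb x₀ (mem_ball_self hR))
    exact nonneg_of_mul_nonneg_left this hR
  have h1 : ‖p - b‖ ≤ ε / 2 + σ / (c / 4) := by
    rcases eq_or_ne (p - b) 0 with h0 | h0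
    · rw [h0, norm_zero]; positivity
    have hn : 0 < ‖p - b‖ := norm_pos_iff.2 h0
    set t := c * R / 2 / ‖p - b‖ with ht
    have ht0 : 0 < t := by positivity
    have hnt : ‖t • (p - b)‖ = c * R / 2 := by
      rw [norm_smul, Real.norm_of_nonneg ht0.le, ht]; field_simp
    have hy : x₀ + t • (p - b) ∈ ball x₀ (c * R) := by
      rw [mem_ball, dist_eq_norm, add_sub_cancel_left, hnt]; linarith
    have a1 := hpf x₀ (mem_ball_self hcR) _ hy
    have a2 := hb _ (ball_subset_ball (by nlinarith) hy)
    have a3 := hb _ (mem_ball_self hR)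
    rw [add_sub_cancel_left] at a1 a2
    rw [hnt] at a1
    rw [sub_self, inner_zero_right, sub_zero] at a3
    have a4 : ⟪p, t • (p - b)⟫_ℝ - ⟪b, t • (p - b)⟫_ℝ = t * ‖p - b‖ ^ 2 := by
      rw [← inner_sub_left, inner_smul_right, real_inner_self_eq_norm_sq]
    have a5 : t * ‖p - b‖ ^ 2 = c * R / 2 * ‖p - b‖ := by rw [ht]; field_simp
    have a6 : c * R / 2 * ‖p - b‖ ≤ c * R / 2 * (ε / 2 + σ / (c / 4)) := by
      have : c * R / 2 * (ε / 2 + σ / (c / 4)) = ε / 2 * (c * R / 2) + 2 * (σ * R) := by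
        field_simp; ring
      rw [this]
      have b1 := abs_le.1 a1
      have b2 := abs_le.1 a2
      have b3 := abs_le.1 a3
      linarith
    exact le_of_mul_le_mul_left a6 (by positivity)
  have h2 := hpg x₀ (mem_ball_self hcR)
  have h3 : gradient u x₀ - b = (gradient u x₀ - p) + (p - b) := by abel
  rw [h3]
  exact (norm_add_le _ _).trans (by linarith)

end Oscillation

section Tangential

variable {F : Eucl n → ℝ → Eucl n → Eucl n} {F₀ : Eucl n → ℝ → Eucl n → ℝ} {u : Eucl n → ℝ}
  {L : ℝ≥0} {ρ lam Lam M : ℝ}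

lemma add_mem_upper_iff {x v : Eucl n} (hv : v (Fin.last n) = 0) : x + v ∈ upper n ↔ x ∈ upper n := by
  show 0 < (x + v) (Fin.last n) ↔ 0 < x (Fin.last n)
  rw [PiLp.add_apply, hv, add_zero]

lemma sum_diff_shift (f : Eucl n → ℝ) (x v : Eucl n) (N : ℕ) :
    f x - f (x - (N : ℝ) • v) = ∑ j ∈ Finset.range N,
      (f (x - ((j : ℝ) + 1) • v + v) - f (x - ((j : ℝ) + 1) • v)) := by
  have h := Finset.sum_range_sub (fun j : ℕ => f (x - (j : ℝ) • v)) N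
  have h' : f x - f (x - (N : ℝ) • v) = -(f (x - (N : ℝ) • v) - f (x - ((0 : ℕ) : ℝ) • v)) := by
    simp
  rw [h', ← h, ← Finset.sum_neg_distrib]
  refine Finset.sum_congr rfl fun j _ => ?_
  rw [neg_sub]
  congr 2
  · rw [add_smul, one_smul]; abel
  · push_cast; rfl

/-- If every translate chain started in `A` meets `B` with frequency at least `c`, then `B` has
measure at least `c` times that of `A`. -/
lemma mul_volume_le_of_frequency {A B : Set (Eucl n)} (hA : volume A ≠ ∞) (hB : MeasurableSet B)
    (hBt : volume B ≠ ∞) {N : ℕ} (hN : 0 < N) {c : ℝ} (w : ℕ → Eucl n)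
    (h : ∀ x ∈ A, c * N ≤ ∑ j ∈ Finset.range N, B.indicator (fun _ => (1 : ℝ)) (x - w j))
    (hAm : MeasurableSet A) :
    c * volume.real A ≤ volume.real B := by
  have hN' : (0 : ℝ) < N := by exact_mod_cast hN
  have hint : ∀ j, Integrable (fun x => B.indicator (fun _ => (1 : ℝ)) (x - w j)) := fun j =>
    ((integrable_indicator_iff hB).2 (integrableOn_const hBt)).comp_sub_right (w j)
  have h1 : ∫ _ in A, c * N ≤ ∫ x in A, ∑ j ∈ Finset.range N,
      B.indicator (fun _ => (1 : ℝ)) (x - w j) :=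
    setIntegral_mono_on (integrableOn_const hA)
      (integrable_finsetSum _ fun j _ => (hint j).integrableOn) hAm h
  rw [setIntegral_const, smul_eq_mul, integral_finsetSum _ fun j _ => (hint j).integrableOn] at h1
  have h2 : ∀ j ∈ Finset.range N, ∫ x in A, B.indicator (fun _ => (1 : ℝ)) (x - w j) ≤
      volume.real B := fun j _ => by
    refine (setIntegral_le_integral (hint j) (ae_of_all _ fun x =>
      Set.indicator_nonneg (fun _ _ => zero_le_one) _)).trans ?_
    rw [integral_sub_right_eq_self (fun x => B.indicator (fun _ => (1 : ℝ)) x) (w j),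
      integral_indicator hB, setIntegral_const, smul_eq_mul, mul_one]
  have h3 := h1.trans (Finset.sum_le_sum h2)
  rw [Finset.sum_const, Finset.card_range, nsmul_eq_mul] at h3
  have h4 : (N : ℝ) * (c * volume.real A) ≤ N * volume.real B := by linarith
  exact le_of_mul_le_mul_left h4 hN'

set_option maxHeartbeats 1000000 in
/-- One improvement step for the tangential difference quotients at a contact point. -/
lemma Sol.tangential_step (hs : Sol F F₀ u L ρ lam Lam M) {ε : ℝ} (hε : 0 < ε) :
    ∃ κ, 0 < κ ∧ ∀ x₀ : Eucl n, ‖x₀‖ < ρ → x₀ (Fin.last n) = 0 → u x₀ = 0 → ∀ m R, ε ≤ m →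
      m ≤ L + 1 → 0 < R →
      (∀ x ∈ ball x₀ R ∩ upper n, ∀ v, v (Fin.last n) = 0 → x + v ∈ ball x₀ R →
        u (x + v) - u x ≤ m * ‖v‖) →
      ∃ R', 0 < R' ∧ ∀ x ∈ ball x₀ R' ∩ upper n, ∀ v, v (Fin.last n) = 0 → x + v ∈ ball x₀ R' →
        u (x + v) - u x ≤ (m - κ) * ‖v‖ := by
  have hL1 : (0 : ℝ) < L + 1 := by positivity
  have hbv := halfVol_pos (n := n)
  set δ : ℝ := min (1 / 2) (ε / (64 * (L + 1))) with hδ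
  have hδ0 : 0 < δ := by positivity
  have hδ1 : δ ≤ 1 / 2 := min_le_left _ _
  have hδ2 : δ * (64 * (L + 1)) ≤ ε := by
    rw [← le_div_iff₀ (by positivity)]; exact min_le_right _ _
  set θ : ℝ := ε / (16 * (L + 1)) * (δ ^ (n + 1) * halfVol n) with hθ
  have hθ0 : 0 < θ := by positivity
  obtain ⟨κ, hκ0, hκ1, hgr⟩ := deGiorgi_growth n
    (dqQ_pos (L := L) hs.lam_pos hs.Lam_pos) hθ0
  refine ⟨κ * ε / 2, by positivity, fun x₀ hx₀ hx₀t hux₀ m R hm hmL hR hP => ?_⟩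
  set R₁ : ℝ := min (R / 8) (min (κ * ε / 4) ((ρ - ‖x₀‖) / 8)) with hR₁
  have hρx : 0 < ρ - ‖x₀‖ := by linarith
  have hR₁0 : 0 < R₁ := by positivity
  have hR₁a : R₁ ≤ R / 8 := min_le_left _ _
  have hR₁b : R₁ ≤ κ * ε / 4 := (min_le_right _ _).trans (min_le_left _ _)
  have hR₁c : R₁ ≤ (ρ - ‖x₀‖) / 8 := (min_le_right _ _).trans (min_le_right _ _)
  refine ⟨R₁ / 8, by positivity, fun x hx v hv hxv => ?_⟩
  rcases eq_or_ne v 0 with rfl | hv0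
  · simp
  have hvn : 0 < ‖v‖ := norm_pos_iff.2 hv0
  have hvR : ‖v‖ < R₁ / 4 := by
    have h1 : dist x x₀ < R₁ / 8 := hx.1
    have h2 : dist (x + v) x₀ < R₁ / 8 := hxv
    have h3 := dist_triangle_right (x + v) x x₀
    rw [dist_eq_norm (x + v) x, add_sub_cancel_left] at h3
    linarith
  set c : ℝ := ‖v‖⁻¹ with hc
  have hc0 : 0 < c := inv_pos.2 hvn
  have hcv : c * ‖v‖ = 1 := inv_mul_cancel₀ hvn.ne'
  set w : Eucl n → ℝ := fun x => c * (u (x + v) - u x) with hw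
  have hm0 : 0 < m := hε.trans_le hm
  have hadd : ∀ {y : Eucl n} {r : ℝ}, y ∈ ball x₀ r → y + v ∈ ball x₀ (r + ‖v‖) := by
    intro y r hy
    have h1 : dist y x₀ < r := hy
    have h2 := dist_triangle (y + v) y x₀
    rw [dist_eq_norm (y + v) y, add_sub_cancel_left] at h2
    exact mem_ball.2 (by linarith)
  have hsub : ∀ {y : Eucl n} {r : ℝ}, y ∈ ball x₀ r → y - v ∈ ball x₀ (r + ‖v‖) := by
    intro y r hy
    have h1 : dist y x₀ < r := hy
    have h2 := dist_triangle (y - v) y x₀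
    rw [dist_eq_norm (y - v) y, sub_sub_cancel_left, norm_neg] at h2
    exact mem_ball.2 (by linarith)
  have hbρ : ∀ {y : Eucl n} {r : ℝ}, y ∈ ball x₀ r → r ≤ 8 * R₁ → y ∈ ball (0 : Eucl n) ρ := by
    intro y r hy hr
    have h1 : dist y x₀ < r := hy
    have h2 := dist_triangle y x₀ 0
    rw [dist_zero_right x₀] at h2
    exact mem_ball.2 (by linarith)
  have hwm : ∀ y ∈ ball x₀ (2 * R₁) ∩ upper n, w y ≤ m := by
    intro y hy
    have h1 := hP y ⟨ball_subset_ball (by linarith) hy.1, hy.2⟩ v hv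
      (ball_subset_ball (by linarith) (hadd hy.1))
    calc w y = c * (u (y + v) - u y) := rfl
      _ ≤ c * (m * ‖v‖) := by gcongr
      _ = (c * ‖v‖) * m := by ring
      _ = m := by rw [hcv, one_mul]
  have hC : Cacc w (dqQ L lam Lam) x₀ (2 * R₁) (m / 2) := by
    refine hs.cacc_diffQuot (R := 4 * R₁) (by rwa [abs_of_pos hc0]) (by linarith)
      (fun y _ => add_mem_upper_iff hv) (fun k hk => ?_) _ (by linarith)
    have hk0 : 0 ≤ k := by linarith
    refine ⟨1 / c ^ 2, by positivity, fun y hy hyt => ⟨fun _ => ?_, fun hyb => ?_⟩⟩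
    · refine le_trans ?_ (hs.nonneg y hy hyt)
      have : 0 ≤ c * (1 / c ^ 2) * max (c * (u (y + v) - u y) - k) 0 := by positivity
      linarith
    · have h1 := hs.nonneg y hy hyt
      have h2 := hs.nonneg (y - v) (hbρ hyb (by linarith)) (by rw [PiLp.sub_apply, hyt, hv, sub_zero])
      have h3 : max (c * (u y - u (y - v)) - k) 0 ≤ c * u y := by
        refine max_le ?_ (by positivity)
        have : c * (u y - u (y - v)) ≤ c * u y := by gcongr; linarith
        linarith
      calc c * (1 / c ^ 2) * max (c * (u y - u (y - v)) - k) 0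
          ≤ c * (1 / c ^ 2) * (c * u y) := by gcongr
        _ = u y := by field_simp
  have hwL : ∀ y, -(L : ℝ) ≤ w y := fun y => by
    have h1 := (abs_le.1 (abs_diff_le hs.lip y v)).1
    calc -(L : ℝ) = c * (-(L * ‖v‖)) := by
          rw [show c * (-(L * ‖v‖)) = -(c * ‖v‖) * L by ring, hcv]; ring
      _ ≤ w y := by show _ ≤ c * (u (y + v) - u y); gcongr
  have hwB := lipBdd_diffQuot hs.lip c v
  set B : Set (Eucl n) := ball x₀ R₁ ∩ upper n ∩ {x | w x ≤ m / 2} with hB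
  by_cases hbig : θ * R₁ ^ (n + 1) ≤ volume.real B
  · have h1 := hgr w x₀ R₁ (m / 2) m hwB hR₁0 (by linarith) (by nlinarith) hC hwm hbig x
      ⟨ball_subset_ball (by linarith) hx.1, hx.2⟩
    have h2 : c * (u (x + v) - u x) ≤ m - κ * (m - m / 2) := h1
    have h3 : κ * ε ≤ κ * m := by gcongr
    calc u (x + v) - u x = (c * (u (x + v) - u x)) * ‖v‖ := by
          rw [show c * (u (x + v) - u x) * ‖v‖ = (c * ‖v‖) * (u (x + v) - u x) by ring, hcv, one_mul]
      _ ≤ (m - κ * (m - m / 2)) * ‖v‖ := by gcongr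
      _ ≤ (m - κ * ε / 2) * ‖v‖ := by gcongr; linarith
  · exfalso
    apply hbig
    set A : Set (Eucl n) := ball x₀ (δ * R₁) ∩ upper n with hA
    have hδR : 0 < δ * R₁ := by positivity
    have hAv : (δ * R₁) ^ (n + 1) * halfVol n ≤ volume.real A :=
      le_volume_ball_inter_upper hx₀t.ge hδR
    have hBm : MeasurableSet B := (measurableSet_half_ball _ _).inter
      (measurableSet_le hwB.continuous.measurable measurable_const)
    have hBt : volume B ≠ ∞ :=
      ((measure_mono Set.inter_subset_left).trans_lt (volume_inter_upper_lt_top _ _ _)).ne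
    set N : ℕ := ⌊R₁ / 2 / ‖v‖⌋₊ with hN
    have hN1 : (N : ℝ) * ‖v‖ ≤ R₁ / 2 := by
      rw [← le_div_iff₀ hvn]; exact Nat.floor_le (by positivity)
    have hN2 : R₁ / 4 ≤ N * ‖v‖ := by
      have h1 : R₁ / 2 / ‖v‖ < N + 1 := Nat.lt_floor_add_one _
      rw [div_lt_iff₀ hvn] at h1
      linarith
    have hN0 : 0 < N := by
      rcases Nat.eq_zero_or_pos N with h | h
      · rw [h, Nat.cast_zero, zero_mul] at hN2; linarith
      · exact h
    have hkey : ε / (16 * (L + 1)) * volume.real A ≤ volume.real B := by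
      refine mul_volume_le_of_frequency (volume_inter_upper_lt_top _ _ _).ne hBm hBt hN0
        (fun j => ((j : ℝ) + 1) • v) (fun y hy => ?_) (measurableSet_half_ball _ _)
      have hyd : dist y x₀ < δ * R₁ := hy.1
      have hd : ∀ t : ℝ, 0 ≤ t → t ≤ N → dist (y - t • v) y ≤ R₁ / 2 := by
        intro t ht htN
        rw [dist_eq_norm, sub_sub_cancel_left, norm_neg, norm_smul, Real.norm_of_nonneg ht]
        exact (mul_le_mul_of_nonneg_right htN hvn.le).trans hN1
      have hj : ∀ j ∈ Finset.range N, y - ((j : ℝ) + 1) • v ∈ ball x₀ R₁ ∩ upper n := by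
        intro j hj
        have h1 : (j : ℝ) + 1 ≤ N := by exact_mod_cast Finset.mem_range.1 hj
        have h2 := hd _ (by positivity) h1
        have h3 := dist_triangle (y - ((j : ℝ) + 1) • v) y x₀
        have h4 : δ * R₁ ≤ 1 / 2 * R₁ := by gcongr
        refine ⟨mem_ball.2 (by linarith), ?_⟩
        rw [sub_eq_add_neg]
        refine (add_mem_upper_iff ?_).2 hy.2
        rw [PiLp.neg_apply, PiLp.smul_apply, hv, smul_zero, neg_zero]
      have hwj : ∀ j ∈ Finset.range N, m / 2 - 2 * (L + 1) *
          B.indicator (fun _ => (1 : ℝ)) (y - ((j : ℝ) + 1) • v) ≤ w (y - ((j : ℝ) + 1) • v) := by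
        intro j hjN
        by_cases hb : y - ((j : ℝ) + 1) • v ∈ B
        · rw [Set.indicator_of_mem hb]
          linarith [hwL (y - ((j : ℝ) + 1) • v)]
        · rw [Set.indicator_of_notMem hb]
          have : ¬ w (y - ((j : ℝ) + 1) • v) ≤ m / 2 := fun h => hb ⟨hj j hjN, h⟩
          linarith
      have hsum := Finset.sum_le_sum hwj
      rw [Finset.sum_sub_distrib, Finset.sum_const, Finset.card_range, nsmul_eq_mul,
        ← Finset.mul_sum] at hsum
      have htel := sum_diff_shift u y v N
      have hww : ∑ j ∈ Finset.range N, w (y - ((j : ℝ) + 1) • v) =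
          c * (u y - u (y - (N : ℝ) • v)) := by
        rw [htel, Finset.mul_sum]
      rw [hww] at hsum
      set I := ∑ j ∈ Finset.range N, B.indicator (fun _ => (1 : ℝ)) (y - ((j : ℝ) + 1) • v) with hI
      have hu1 : u y ≤ L * (δ * R₁) := by
        have h1 := hs.lip.dist_le_mul y x₀
        rw [Real.dist_eq, hux₀, sub_zero] at h1
        have h2 : (L : ℝ) * dist y x₀ ≤ L * (δ * R₁) := by gcongr
        linarith [le_abs_self (u y)]
      have hu2 : -(L * (δ * R₁)) ≤ u (y - (N : ℝ) • v) := by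
        have h1 := hs.lip.dist_le_mul (y - (N : ℝ) • v) (x₀ - (N : ℝ) • v)
        rw [Real.dist_eq, dist_sub_right] at h1
        have h2 : (L : ℝ) * dist y x₀ ≤ L * (δ * R₁) := by gcongr
        have h3 : x₀ - (N : ℝ) • v ∈ ball x₀ R₁ := by
          rw [mem_ball, dist_eq_norm, sub_sub_cancel_left, norm_neg, norm_smul,
            Real.norm_of_nonneg (by positivity)]
          linarith
        have h4 := hs.nonneg _ (hbρ h3 (by linarith)) (by
          rw [PiLp.sub_apply, PiLp.smul_apply, hv, hx₀t, smul_zero, sub_zero])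
        linarith [neg_abs_le (u (y - (N : ℝ) • v) - u (x₀ - (N : ℝ) • v))]
      have hcN : c * R₁ ≤ 4 * N := by
        calc c * R₁ ≤ c * (4 * (N * ‖v‖)) := by gcongr; linarith
          _ = (c * ‖v‖) * (4 * N) := by ring
          _ = 4 * N := by rw [hcv, one_mul]
      have hN0' : (0 : ℝ) < N := by exact_mod_cast hN0
      have h5 : c * (u y - u (y - (N : ℝ) • v)) ≤ N * (ε / 8) := by
        calc c * (u y - u (y - (N : ℝ) • v)) ≤ c * (2 * (L * (δ * R₁))) := by gcongr; linarith
          _ = 2 * L * δ * (c * R₁) := by ring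
          _ ≤ 2 * L * δ * (4 * N) := by gcongr
          _ = N * (8 * δ * L) := by ring
          _ ≤ N * (ε / 8) := by gcongr; nlinarith
      have h6 : (N : ℝ) * (ε / 8) ≤ 2 * (L + 1) * I := by
        have : (N : ℝ) * ε ≤ N * m := by gcongr
        nlinarith
      rw [div_mul_eq_mul_div, div_le_iff₀ (by positivity)]
      linarith
    refine le_trans ?_ hkey
    calc θ * R₁ ^ (n + 1) = ε / (16 * (L + 1)) * ((δ * R₁) ^ (n + 1) * halfVol n) := by
          rw [hθ, mul_pow]; ring
      _ ≤ _ := by gcongr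

/-- The tangential increments of `u` in the closed half ball are `ε`-close to those of the linear
map `a`. -/
def TanFlat (u : Eucl n → ℝ) (a : Eucl n) (ε : ℝ) (x₀ : Eucl n) (r : ℝ) : Prop :=
  ∀ x ∈ ball x₀ r, 0 ≤ x (Fin.last n) → ∀ v, v (Fin.last n) = 0 → x + v ∈ ball x₀ r →
    |u (x + v) - u x - ⟪a, v⟫_ℝ| ≤ ε * ‖v‖

lemma TanFlat.of_upper (hu : Continuous u) {a x₀ : Eucl n} {ε r : ℝ}
    (h : ∀ x ∈ ball x₀ r ∩ upper n, ∀ v, v (Fin.last n) = 0 → x + v ∈ ball x₀ r →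
      |u (x + v) - u x - ⟪a, v⟫_ℝ| ≤ ε * ‖v‖) : TanFlat u a ε x₀ r := by
  intro x hx hx0 v hv hxv
  set e : Eucl n := EuclideanSpace.single (Fin.last n) (1 : ℝ) with he
  have hc : ∀ y : Eucl n, Tendsto (fun t : ℝ => y + t • e) (𝓝[>] 0) (𝓝 y) := fun y => by
    have : Continuous fun t : ℝ => y + t • e := by fun_prop
    have h1 := this.tendsto 0
    rw [zero_smul, add_zero] at h1
    exact h1.mono_left nhdsWithin_le_nhds
  have hlim : Tendsto (fun t : ℝ => |u (x + v + t • e) - u (x + t • e) - ⟪a, v⟫_ℝ|) (𝓝[>] 0)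
      (𝓝 |u (x + v) - u x - ⟪a, v⟫_ℝ|) :=
    ((((hu.tendsto _).comp (hc (x + v))).sub ((hu.tendsto _).comp (hc x))).sub_const _).abs
  refine le_of_tendsto hlim ?_
  filter_upwards [(hc x).eventually (isOpen_ball.mem_nhds hx),
    (hc (x + v)).eventually (isOpen_ball.mem_nhds hxv), self_mem_nhdsWithin] with t h1 h2 ht
  have ht : 0 < t := ht
  have h3 := h (x + t • e) ⟨h1, by
    show 0 < (x + t • e) (Fin.last n)
    simp only [he, PiLp.add_apply, PiLp.smul_apply, PiLp.single_apply, if_true, smul_eq_mul, mul_one]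
    linarith⟩ v hv (by rwa [add_right_comm])
  rwa [add_right_comm x] at h3

lemma TanFlat.mono {a x₀ y : Eucl n} {ε r s : ℝ} (h : TanFlat u a ε x₀ r)
    (hsub : ball y s ⊆ ball x₀ r) : TanFlat u a ε y s :=
  fun x hx hx0 v hv hxv => h x (hsub hx) hx0 v hv (hsub hxv)

lemma Sol.tanFlat_contact (hs : Sol F F₀ u L ρ lam Lam M) {x₀ : Eucl n} (hx₀ : ‖x₀‖ < ρ)
    (hx₀t : x₀ (Fin.last n) = 0) (hu0 : u x₀ = 0) {ε : ℝ} (hε : 0 < ε) :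
    ∃ r, 0 < r ∧ TanFlat u 0 ε x₀ r := by
  obtain ⟨κ, hκ, hstep⟩ := hs.tangential_step hε
  have hind : ∀ j : ℕ, ∃ R, 0 < R ∧ ∀ x ∈ ball x₀ R ∩ upper n, ∀ v, v (Fin.last n) = 0 →
      x + v ∈ ball x₀ R → u (x + v) - u x ≤ max ε (L + 1 - j * κ) * ‖v‖ := by
    intro j
    induction j with
    | zero =>
      refine ⟨1, one_pos, fun x _ v _ _ => ?_⟩
      have h1 := (le_abs_self _).trans (abs_diff_le hs.lip x v)
      refine h1.trans ?_
      gcongr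
      refine le_trans ?_ (le_max_right _ _)
      simp
    | succ j ih =>
      obtain ⟨R, hR, ih⟩ := ih
      rcases le_total (max ε (L + 1 - j * κ)) (max ε (L + 1 - (j + 1 : ℕ) * κ)) with hle | hle
      · exact ⟨R, hR, fun x hx v hv hxv => (ih x hx v hv hxv).trans (by gcongr)⟩
      by_cases hmL : max ε (L + 1 - j * κ) ≤ L + 1
      · obtain ⟨R', hR', h⟩ := hstep x₀ hx₀ hx₀t hu0 _ R (le_max_left _ _) hmL hR ih
        refine ⟨R', hR', fun x hx v hv hxv => (h x hx v hv hxv).trans ?_⟩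
        gcongr
        rw [sub_le_iff_le_add]
        refine max_le ?_ ?_
        · linarith [le_max_left ε (L + 1 - (j + 1 : ℕ) * κ)]
        · have := le_max_right ε (L + 1 - (j + 1 : ℕ) * κ)
          push_cast at this ⊢
          linarith
      · have hεL : (L : ℝ) + 1 ≤ ε := by
          rcases lt_max_iff.1 (not_le.1 hmL) with h | h
          · exact h.le
          · have : 0 ≤ j * κ := by positivity
            linarith
        refine ⟨1, one_pos, fun x _ v _ _ => ?_⟩
        have h1 := (le_abs_self _).trans (abs_diff_le hs.lip x v)
        refine h1.trans ?_
        gcongr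
        exact le_trans (by linarith) (le_max_left _ _)
  obtain ⟨j, hj⟩ := exists_nat_gt (((L : ℝ) + 1) / κ)
  rw [div_lt_iff₀ hκ] at hj
  obtain ⟨R, hR, h⟩ := hind j
  rw [max_eq_left (by linarith)] at h
  refine ⟨R, hR, TanFlat.of_upper hs.lip.continuous fun x hx v hv hxv => ?_⟩
  rw [inner_zero_left, sub_zero, abs_le]
  refine ⟨?_, h x hx v hv hxv⟩
  have h1 := h (x + v) ⟨hxv, (add_mem_upper_iff hv).2 hx.2⟩ (-v) (by rw [PiLp.neg_apply, hv, neg_zero])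
    (by rw [add_neg_cancel_right]; exact hx.1)
  rw [add_neg_cancel_right, norm_neg] at h1
  linarith

lemma Sol.tanFlat_noncontact (hs : Sol F F₀ u L ρ lam Lam M) {x₀ : Eucl n} (hx₀ : ‖x₀‖ < ρ)
    (hx₀t : x₀ (Fin.last n) = 0) (hu0 : 0 < u x₀) {ε : ℝ} (hε : 0 < ε) :
    ∃ r a, 0 < r ∧ ‖a‖ ≤ L ∧ TanFlat u a ε x₀ r := by
  obtain ⟨c, ρ₀, hc, hc1, hρ₀, H⟩ := hs.osc_diffQuot hε
  have hev : ∀ᶠ x in 𝓝 x₀, u x₀ / 2 < u x :=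
    hs.lip.continuous.tendsto x₀ |>.eventually_const_lt (by linarith)
  obtain ⟨δ, hδ, hδu⟩ := Metric.eventually_nhds_iff_ball.1 hev
  set R := min δ (min ρ₀ ((ρ - ‖x₀‖) / 2)) with hR
  have hρx : 0 < ρ - ‖x₀‖ := by linarith
  have hR0 : 0 < R := by positivity
  have hRa : R ≤ δ := min_le_left _ _
  have hRb : R ≤ ρ₀ := (min_le_right _ _).trans (min_le_left _ _)
  have hRc : R ≤ (ρ - ‖x₀‖) / 2 := (min_le_right _ _).trans (min_le_right _ _)
  have hne : (ball x₀ (c * R) ∩ upper n).Nonempty := by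
    have hv := le_volume_ball_inter_upper hx₀t.ge (show 0 < c * R by positivity)
    have hp : 0 < volume.real (ball x₀ (c * R) ∩ upper n) :=
      lt_of_lt_of_le (mul_pos (by positivity) halfVol_pos) hv
    exact nonempty_of_measureReal_ne_zero hp.ne'
  obtain ⟨x₁, hx₁, hd⟩ := exists_hasGradientAt hs.lip (isOpen_ball.inter isOpen_upper) hne
  refine ⟨c * R, gradient u x₁, by positivity, norm_gradient_le hs.lip x₁,
    TanFlat.of_upper hs.lip.continuous fun x hx v hv hxv => ?_⟩
  refine abs_sub_inner_le_of_shift (convex_half_ball x₀ (c * R)) hd ?_ hx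
    ⟨hxv, (add_mem_upper_iff hv).2 hx.2⟩
  have ht : Tendsto (fun N : ℕ => ‖(N : ℝ)⁻¹ • v‖) atTop (𝓝 0) := by
    have := ((tendsto_inv_atTop_nhds_zero_nat (𝕜 := ℝ)).smul_const v).norm
    simpa using this
  filter_upwards [ht.eventually_lt_const (half_pos hR0)] with N hN z hz
  refine H x₀ R hR0 hRb hx₀t.ge (by linarith) ⟨u x₀ / 2, by linarith, fun x hx _ =>
    (hδu x (ball_subset_ball hRa hx)).le⟩ _ hN (fun x _ => add_mem_upper_iff ?_) z hz x₁ hx₁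
  rw [PiLp.smul_apply, hv, smul_zero]

end Tangential

section Comparison

lemma exists_bound_closedBall {f : Eucl n → ℝ} (hf : Continuous f) (R : ℝ) :
    ∃ K, 0 ≤ K ∧ ∀ x ∈ closedBall (0 : Eucl n) R, |f x| ≤ K := by
  obtain ⟨K, hK⟩ := (isCompact_closedBall (0 : Eucl n) R).exists_bound_of_continuousOn hf.continuousOn
  exact ⟨|K|, abs_nonneg K, fun x hx => (hK x hx).trans (le_abs_self K)⟩

/-- Integration by parts on the half space, with one-sided bounds on the increments of `f`. -/
lemma integral_mul_inner_gradient_le {f w : Eucl n → ℝ} {e : Eucl n} (he : 0 ≤ e (Fin.last n))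
    (hf : Continuous f) (hw : LipBdd w) (hw0 : ∀ x, 0 ≤ w x) {R a C h₀ : ℝ}
    (hsupp : ∀ x, x ∉ ball (0 : Eucl n) R → w x = 0) (hh₀ : 0 < h₀) (hC : 0 ≤ C)
    (hinc : ∀ h, 0 < h → h < h₀ → ∀ x ∈ upper n, w x ≠ 0 → x - h • e ∈ upper n →
      a * h ≤ f x - f (x - h • e))
    (hbdry : ∀ h, 0 < h → h < h₀ → ∀ x ∈ upper n, x - h • e ∉ upper n → -(f x * w x) ≤ C * h) :
    ∫ x in upper n, f x * ⟪gradient w x, e⟫_ℝ ≤ -a * ∫ x in upper n, w x := by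
  obtain ⟨A, hA, hAb⟩ := id hw
  obtain ⟨K, hK0, hK⟩ := exists_bound_closedBall hf (R + ‖e‖)
  have hwc := hw.continuous
  set h : ℕ → ℝ := fun N => 1 / ((N : ℝ) + 1) with hh
  have hh0 : ∀ N, 0 < h N := fun N => by positivity
  have hh1 : ∀ N, h N ≤ 1 := fun N => by
    rw [hh]; exact (div_le_one (by positivity)).2 (by linarith [(Nat.cast_nonneg N : (0 : ℝ) ≤ N)])
  have hlim : Tendsto h atTop (𝓝 0) := tendsto_one_div_add_atTop_nhds_zero_nat
  have hlim' : Tendsto h atTop (𝓝[≠] 0) :=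
    tendsto_nhdsWithin_iff.2 ⟨hlim, Eventually.of_forall fun N => (hh0 N).ne'⟩
  have hhe : ∀ N, ‖h N • e‖ ≤ ‖e‖ := fun N => by
    rw [norm_smul, Real.norm_of_nonneg (hh0 N).le]
    exact mul_le_of_le_one_left (norm_nonneg _) (hh1 N)
  have hout : ∀ N x, x ∉ closedBall (0 : Eucl n) (R + ‖e‖) → w x = 0 ∧ w (x + h N • e) = 0 := by
    intro N x hx
    rw [mem_closedBall, dist_zero_right, not_le] at hx
    refine ⟨hsupp x ?_, hsupp _ ?_⟩
    · rw [mem_ball, dist_zero_right]; linarith [norm_nonneg e]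
    · rw [mem_ball, dist_zero_right, not_lt]
      have := norm_sub_le (x + h N • e) (h N • e)
      rw [add_sub_cancel_right] at this
      linarith [hhe N]
  have h1 : Tendsto (fun N => ∫ x in upper n, f x * ((h N)⁻¹ * (w (x + h N • e) - w x))) atTop
      (𝓝 (∫ x in upper n, f x * ⟪gradient w x, e⟫_ℝ)) := by
    refine tendsto_integral_of_dominated_convergence
      (fun x => (closedBall (0 : Eucl n) (R + ‖e‖)).indicator (fun _ => K * (A * ‖e‖)) x) ?_ ?_ ?_ ?_
    · intro N
      exact Continuous.aestronglyMeasurable (by fun_prop)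
    · exact ((integrable_indicator_iff measurableSet_closedBall).2
        (integrableOn_const measure_closedBall_lt_top.ne)).integrableOn
    · intro N
      refine ae_of_all _ fun x => ?_
      by_cases hx : x ∈ closedBall (0 : Eucl n) (R + ‖e‖)
      · rw [Set.indicator_of_mem hx, Real.norm_eq_abs, abs_mul, abs_mul, abs_inv,
          abs_of_pos (hh0 N)]
        have h5 : (h N)⁻¹ * |w (x + h N • e) - w x| ≤ A * ‖e‖ := by
          rw [inv_mul_le_iff₀ (hh0 N)]
          have := hA.dist_le_mul (x + h N • e) x
          rw [Real.dist_eq, dist_eq_norm, add_sub_cancel_left, norm_smul,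
            Real.norm_of_nonneg (hh0 N).le] at this
          linarith
        exact mul_le_mul (hK x hx) h5 (by have := hh0 N; positivity) hK0
      · rw [Set.indicator_of_notMem hx, (hout N x hx).1, (hout N x hx).2]
        simp
    · filter_upwards [ae_restrict_of_ae (ae_hasGradientAt hA)] with x hx
      have h2 : HasLineDerivAt ℝ w ⟪gradient w x, e⟫_ℝ x e := by
        have := (hasGradientAt_iff_hasFDerivAt.1 hx).hasLineDerivAt e
        simpa using this
      exact (h2.tendsto_slope_zero.comp hlim').const_mul (f x)
  set S : ℕ → Set (Eucl n) := fun N => ball 0 R ∩ {x | x - h N • e ∉ upper n} with hS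
  have hSm : ∀ N, MeasurableSet (S N) := fun N => by
    refine measurableSet_ball.inter ?_
    have : Continuous fun x : Eucl n => x - h N • e := by fun_prop
    exact (isOpen_upper.preimage this).measurableSet.compl
  set J : ℕ → ℝ := fun N => ∫ x in upper n, (S N).indicator (fun _ => C + |a| * A) x with hJ
  have hSint : ∀ N, Integrable ((S N).indicator fun _ : Eucl n => C + |a| * A) := fun N =>
    (integrable_indicator_iff (hSm N)).2 (integrableOn_const
      ((measure_mono Set.inter_subset_left).trans_lt measure_ball_lt_top).ne)
  have hJ0 : Tendsto J atTop (𝓝 0) := by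
    rw [← integral_zero (Eucl n) ℝ (μ := volume.restrict (upper n))]
    refine tendsto_integral_of_dominated_convergence
      (fun x => (ball (0 : Eucl n) R).indicator (fun _ => C + |a| * A) x)
      (fun N => (hSint N).aestronglyMeasurable.restrict) ?_ ?_ ?_
    · exact ((integrable_indicator_iff measurableSet_ball).2
        (integrableOn_const measure_ball_lt_top.ne)).integrableOn
    · intro N
      refine ae_of_all _ fun x => ?_
      by_cases hx : x ∈ S N
      · rw [Set.indicator_of_mem hx, Set.indicator_of_mem hx.1, Real.norm_of_nonneg (by positivity)]
      · rw [Set.indicator_of_notMem hx, norm_zero]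
        exact Set.indicator_nonneg (fun _ _ => by positivity) _
    · filter_upwards [ae_restrict_mem measurableSet_upper] with x hx
      refine tendsto_const_nhds.congr' ?_
      have hc : Tendsto (fun N => x - h N • e) atTop (𝓝 x) := by
        simpa using tendsto_const_nhds.sub (hlim.smul_const e)
      filter_upwards [hc.eventually (isOpen_upper.mem_nhds hx)] with N hN
      exact (Set.indicator_of_notMem (fun h => h.2 hN) _).symm
  have hwint : Integrable w := integrable_of_bounded_of_support (x₀ := 0) (R := R)
    hwc.aestronglyMeasurable (fun x => hAb x) fun x hx => hsupp x fun h => hx (ball_subset_closedBall h)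
  have key : ∀ᶠ N in atTop, ∫ x in upper n, f x * ((h N)⁻¹ * (w (x + h N • e) - w x)) ≤
      -a * (∫ x in upper n, w x) + J N := by
    filter_upwards [hlim.eventually_lt_const hh₀] with N hN
    have hcw : Continuous fun x : Eucl n => w (x + h N • e) := by fun_prop
    have hup : ∀ x : Eucl n, x - h N • e ∈ upper n → x ∈ upper n := by
      intro x hx
      have h2 : 0 < (x - h N • e) (Fin.last n) := hx
      rw [PiLp.sub_apply, PiLp.smul_apply, smul_eq_mul] at h2
      have h3 : 0 ≤ h N * e (Fin.last n) := mul_nonneg (hh0 N).le he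
      show 0 < x (Fin.last n)
      linarith
    have hi1 : Integrable fun x => f x * ((h N)⁻¹ * w (x + h N • e)) := by
      refine Continuous.integrable_of_hasCompactSupport (by fun_prop)
        (HasCompactSupport.intro (isCompact_closedBall (0 : Eucl n) (R + ‖e‖)) fun x hx => ?_)
      rw [(hout N x hx).2]; simp
    have hi2 : Integrable fun x => f x * ((h N)⁻¹ * w x) := by
      refine Continuous.integrable_of_hasCompactSupport (by fun_prop)
        (HasCompactSupport.intro (isCompact_closedBall (0 : Eucl n) (R + ‖e‖)) fun x hx => ?_)
      rw [(hout N x hx).1]; simp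
    have hi3 : Integrable fun x => f (x - h N • e) * ((h N)⁻¹ * w x) := by
      have := hi1.comp_sub_right (h N • e)
      simpa using this
    have htr : ∫ x in upper n, f x * ((h N)⁻¹ * w (x + h N • e)) =
        ∫ x in upper n, {x | x - h N • e ∈ upper n}.indicator
          (fun x => f (x - h N • e) * ((h N)⁻¹ * w x)) x := by
      rw [← integral_indicator measurableSet_upper, ← integral_indicator measurableSet_upper,
        ← integral_sub_right_eq_self _ (h N • e)]
      congr 1
      ext x
      by_cases hx : x - h N • e ∈ upper n
      · rw [Set.indicator_of_mem hx, Set.indicator_of_mem (hup x hx),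
          Set.indicator_of_mem (show x ∈ {x | x - h N • e ∈ upper n} from hx), sub_add_cancel]
      · rw [Set.indicator_of_notMem hx]
        by_cases hx' : x ∈ upper n
        · rw [Set.indicator_of_mem hx',
            Set.indicator_of_notMem (show x ∉ {x | x - h N • e ∈ upper n} from hx)]
        · rw [Set.indicator_of_notMem hx']
    have hTm : MeasurableSet {x : Eucl n | x - h N • e ∈ upper n} := by
      have : Continuous fun x : Eucl n => x - h N • e := by fun_prop
      exact (isOpen_upper.preimage this).measurableSet
    have heq : ∫ x in upper n, f x * ((h N)⁻¹ * (w (x + h N • e) - w x)) =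
        ∫ x in upper n, ({x | x - h N • e ∈ upper n}.indicator
          (fun x => f (x - h N • e) * ((h N)⁻¹ * w x)) x - f x * ((h N)⁻¹ * w x)) := by
      rw [integral_sub (hi3.indicator hTm).integrableOn hi2.integrableOn, ← htr,
        ← integral_sub hi1.integrableOn hi2.integrableOn]
      congr 1; ext x; ring
    rw [heq]
    have hrhs : -a * (∫ x in upper n, w x) + J N =
        ∫ x in upper n, (-a * w x + (S N).indicator (fun _ => C + |a| * A) x) := by
      rw [integral_add (hwint.const_mul _).integrableOn (hSint N).integrableOn, integral_const_mul]
    rw [hrhs]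
    refine setIntegral_mono_on ((hi3.indicator hTm).sub hi2).integrableOn
      ((hwint.const_mul _).add (hSint N)).integrableOn measurableSet_upper fun x hx => ?_
    have hwx := hw0 x
    by_cases hx' : x - h N • e ∈ upper n
    · rw [Set.indicator_of_mem (show x ∈ {x | x - h N • e ∈ upper n} from hx'),
        Set.indicator_of_notMem (show x ∉ S N from fun h => h.2 hx'), add_zero]
      by_cases hw' : w x = 0
      · rw [hw']; simp
      · have h2 := hinc _ (hh0 N) hN x hx hw' hx'
        have h3 : a ≤ (h N)⁻¹ * (f x - f (x - h N • e)) := by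
          rw [le_inv_mul_iff₀ (hh0 N)]; linarith
        have h4 : a * w x ≤ (h N)⁻¹ * (f x - f (x - h N • e)) * w x := by gcongr
        linarith
    · rw [Set.indicator_of_notMem (show x ∉ {x | x - h N • e ∈ upper n} from hx'), zero_sub]
      have h2 := hbdry _ (hh0 N) hN x hx hx'
      by_cases hxR : x ∈ ball (0 : Eucl n) R
      · rw [Set.indicator_of_mem (show x ∈ S N from ⟨hxR, hx'⟩)]
        have h3 : (h N)⁻¹ * (-(f x * w x)) ≤ C := by
          rw [inv_mul_le_iff₀ (hh0 N)]; linarith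
        have h4 : a * w x ≤ |a| * A := by
          have := hAb x
          rw [abs_of_nonneg hwx] at this
          exact (mul_le_mul_of_nonneg_right (le_abs_self a) hwx).trans (by gcongr)
        linarith
      · rw [Set.indicator_of_notMem (show x ∉ S N from fun h => hxR h.1), hsupp x hxR]
        simp
  have := le_of_tendsto_of_tendsto h1 (tendsto_const_nhds.add hJ0) key
  rwa [add_zero] at this

end Comparison

section Barrier

lemma exists_mem_frontier {D : Set (Eucl n)} (hD : IsOpen D) {x y : Eucl n} (hx : x ∈ D)
    (hy : y ∉ D) : ∃ z ∈ segment ℝ x y, z ∈ frontier D := by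
  by_contra! hcon
  have hsub : segment ℝ x y ⊆ D ∪ (closure D)ᶜ := by
    intro z hz
    by_cases hzD : z ∈ D
    · exact Or.inl hzD
    · refine Or.inr fun hc => hcon z hz ?_
      rw [hD.frontier_eq]; exact ⟨hc, hzD⟩
  have hyc : y ∈ (closure D)ᶜ := (hsub (right_mem_segment ℝ x y)).resolve_left hy
  obtain ⟨z, -, hz1, hz2⟩ := (convex_segment x y).isPreconnected D (closure D)ᶜ hD
    isClosed_closure.isOpen_compl hsub ⟨x, left_mem_segment ℝ x y, hx⟩ ⟨y, right_mem_segment ℝ x y, hyc⟩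
  exact hz2 (subset_closure hz1)

/-- Even reflection of points into the closed upper half space. -/
def reflUp (x : Eucl n) : Eucl n :=
  WithLp.toLp 2 fun i => if i = Fin.last n then |x i| else x i

lemma reflUp_apply (x : Eucl n) (i : Fin (n + 1)) :
    reflUp x i = if i = Fin.last n then |x i| else x i := rfl

lemma reflUp_last (x : Eucl n) : reflUp x (Fin.last n) = |x (Fin.last n)| := by
  rw [reflUp_apply, if_pos rfl]

lemma reflUp_of_nonneg {x : Eucl n} (h : 0 ≤ x (Fin.last n)) : reflUp x = x := by
  ext i
  rw [reflUp_apply]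
  split_ifs with hi
  · subst hi; exact abs_of_nonneg h
  · rfl

lemma dist_reflUp_le (x y : Eucl n) : dist (reflUp x) (reflUp y) ≤ dist x y := by
  rw [EuclideanSpace.dist_eq, EuclideanSpace.dist_eq]
  refine Real.sqrt_le_sqrt (Finset.sum_le_sum fun i _ => ?_)
  rw [reflUp_apply, reflUp_apply]
  split_ifs
  · gcongr
    exact abs_abs_sub_abs_le _ _
  · rfl

lemma norm_reflUp (x : Eucl n) : ‖reflUp x‖ = ‖x‖ := by
  rw [EuclideanSpace.norm_eq, EuclideanSpace.norm_eq]
  congr 1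
  refine Finset.sum_congr rfl fun i _ => ?_
  rw [reflUp_apply]
  split_ifs
  · rw [Real.norm_eq_abs, abs_abs, Real.norm_eq_abs]
  · rfl

lemma lipBdd_glue {f : Eucl n → ℝ} {D : Set (Eucl n)} (hD : IsOpen D) {r C : ℝ}
    (hDr : D ⊆ ball 0 r) (hC : 0 ≤ C)
    (hf : ∀ x ∈ closedBall (0 : Eucl n) r, ∀ y ∈ closedBall (0 : Eucl n) r, |f x - f y| ≤ C * dist x y)
    (h0 : ∀ x ∈ frontier D, 0 ≤ x (Fin.last n) → f x = 0) :
    LipBdd fun x => D.indicator f (reflUp x) := by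
  have hcl : closure D ⊆ closedBall 0 r :=
    closure_minimal (hDr.trans ball_subset_closedBall) isClosed_closedBall
  have hcross : ∀ x y : Eucl n, 0 ≤ x (Fin.last n) → 0 ≤ y (Fin.last n) → x ∈ D → y ∉ D →
      |f x| ≤ C * dist x y := by
    intro x y hx hy hxD hyD
    obtain ⟨z, hz, hzf⟩ := exists_mem_frontier hD hxD hyD
    have hconv : Convex ℝ {x : Eucl n | 0 ≤ x (Fin.last n)} := by
      intro a ha b hb s t hs ht _
      have ha : 0 ≤ a (Fin.last n) := ha
      have hb : 0 ≤ b (Fin.last n) := hb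
      show 0 ≤ (s • a + t • b) (Fin.last n)
      rw [PiLp.add_apply, PiLp.smul_apply, PiLp.smul_apply, smul_eq_mul, smul_eq_mul]
      positivity
    have hz0 : 0 ≤ z (Fin.last n) := hconv.segment_subset hx hy hz
    have h1 := hf x (hcl (subset_closure hxD)) z (hcl (frontier_subset_closure hzf))
    rw [h0 z hzf hz0, sub_zero] at h1
    refine h1.trans ?_
    gcongr
    have := dist_add_dist_of_mem_segment hz
    linarith [dist_nonneg (x := z) (y := y)]
  have hbound : ∃ K, 0 ≤ K ∧ ∀ x ∈ D, |f x| ≤ K := by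
    rcases D.eq_empty_or_nonempty with h | ⟨x₁, hx₁⟩
    · exact ⟨0, le_rfl, fun x hx => by rw [h] at hx; exact absurd hx (Set.notMem_empty x)⟩
    · refine ⟨|f x₁| + C * (2 * r), ?_, fun x hx => ?_⟩
      · have : 0 < r := pos_of_mem_ball (hDr hx₁)
        positivity
      have h1 := hf x (hcl (subset_closure hx)) x₁ (hcl (subset_closure hx₁))
      have h2 : dist x 0 < r := hDr hx
      have h3 : dist x₁ 0 < r := hDr hx₁
      have h4 : dist x x₁ ≤ 2 * r := by linarith [dist_triangle_right x x₁ 0]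
      have h5 := abs_sub_abs_le_abs_sub (f x) (f x₁)
      have h6 : C * dist x x₁ ≤ C * (2 * r) := by gcongr
      linarith
  obtain ⟨K, hK0, hK⟩ := hbound
  refine LipBdd.of_bounds (C := C) (A := K) (fun x y => ?_) fun x => ?_
  · have hd := dist_reflUp_le x y
    have hx0 : 0 ≤ reflUp x (Fin.last n) := by rw [reflUp_last]; exact abs_nonneg _
    have hy0 : 0 ≤ reflUp y (Fin.last n) := by rw [reflUp_last]; exact abs_nonneg _
    have key : |D.indicator f (reflUp x) - D.indicator f (reflUp y)| ≤
        C * dist (reflUp x) (reflUp y) := by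
      by_cases hx : reflUp x ∈ D <;> by_cases hy : reflUp y ∈ D
      · rw [Set.indicator_of_mem hx, Set.indicator_of_mem hy]
        exact hf _ (hcl (subset_closure hx)) _ (hcl (subset_closure hy))
      · rw [Set.indicator_of_mem hx, Set.indicator_of_notMem hy, sub_zero]
        exact hcross _ _ hx0 hy0 hx hy
      · rw [Set.indicator_of_notMem hx, Set.indicator_of_mem hy, zero_sub, abs_neg, dist_comm]
        exact hcross _ _ hy0 hx0 hy hx
      · rw [Set.indicator_of_notMem hx, Set.indicator_of_notMem hy, sub_zero, abs_zero]
        positivity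
    exact key.trans (by gcongr)
  · by_cases hx : reflUp x ∈ D
    · rw [Set.indicator_of_mem hx]; exact hK _ hx
    · rw [Set.indicator_of_notMem hx, abs_zero]; exact hK0

/-- The last coordinate vector. -/
def eLast (n : ℕ) : Eucl n := EuclideanSpace.single (Fin.last n) 1

lemma eLast_last : eLast n (Fin.last n) = 1 := by simp [eLast]

lemma norm_eLast : ‖eLast n‖ = 1 := by simp [eLast]

lemma inner_eLast (x : Eucl n) : ⟪x, eLast n⟫_ℝ = x (Fin.last n) := by
  rw [eLast, EuclideanSpace.inner_single_right]; simp

lemma abs_last_le (x : Eucl n) : |x (Fin.last n)| ≤ ‖x‖ := PiLp.norm_apply_le x _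

/-- Quadratic barriers. -/
def barrier (β : ℝ) (b y : Eucl n) (q K : ℝ) (x : Eucl n) : ℝ :=
  β + ⟪b, x - y⟫_ℝ + q * (K * x (Fin.last n) ^ 2 - ‖x - y‖ ^ 2)

/-- The gradient of a quadratic barrier. -/
def barrierGrad (b y : Eucl n) (q K : ℝ) (x : Eucl n) : Eucl n :=
  b + (2 * q) • ((K * x (Fin.last n)) • eLast n - (x - y))

variable {β q K : ℝ} {b y : Eucl n}

lemma barrier_add (x v : Eucl n) : barrier β b y q K (x + v) = barrier β b y q K x +
    ⟪barrierGrad b y q K x, v⟫_ℝ + q * (K * v (Fin.last n) ^ 2 - ‖v‖ ^ 2) := by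
  have h1 : ⟪(K * x (Fin.last n)) • eLast n - (x - y), v⟫_ℝ =
      K * x (Fin.last n) * v (Fin.last n) - ⟪x - y, v⟫_ℝ := by
    rw [inner_sub_left, real_inner_smul_left, real_inner_comm, inner_eLast]
  simp only [barrier, barrierGrad]
  rw [add_sub_right_comm, inner_add_right, norm_add_sq_real, inner_add_left, real_inner_smul_left,
    h1, PiLp.add_apply]
  ring

lemma barrierGrad_sub (x x' : Eucl n) : barrierGrad b y q K x - barrierGrad b y q K x' =
    (2 * q) • ((K * (x - x') (Fin.last n)) • eLast n - (x - x')) := by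
  simp only [barrierGrad, PiLp.sub_apply]
  module

lemma norm_barrierGrad_sub_le (hK : 1 ≤ K) (x x' : Eucl n) :
    ‖barrierGrad b y q K x - barrierGrad b y q K x'‖ ≤ 2 * |q| * (K + 1) * ‖x - x'‖ := by
  rw [barrierGrad_sub, norm_smul, Real.norm_eq_abs, abs_mul, abs_two, mul_assoc (2 * |q|)]
  gcongr
  refine (norm_sub_le _ _).trans ?_
  rw [norm_smul, norm_eLast, mul_one, Real.norm_eq_abs, abs_mul, abs_of_pos (by linarith : 0 < K)]
  have := abs_last_le (x - x')
  nlinarith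

lemma abs_barrier_rem_le (hK : 1 ≤ K) (v : Eucl n) :
    |q * (K * v (Fin.last n) ^ 2 - ‖v‖ ^ 2)| ≤ |q| * (K + 1) * ‖v‖ ^ 2 := by
  rw [abs_mul, mul_assoc]
  gcongr
  have h1 : v (Fin.last n) ^ 2 ≤ ‖v‖ ^ 2 := by
    rw [← sq_abs]; gcongr; exact abs_last_le v
  rw [abs_le]
  constructor <;> nlinarith [sq_nonneg ‖v‖, sq_nonneg (v (Fin.last n))]

lemma hasGradientAt_barrier (hK : 1 ≤ K) (x : Eucl n) :
    HasGradientAt (barrier β b y q K) (barrierGrad b y q K x) x := by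
  rw [hasGradientAt_iff_hasFDerivAt, hasFDerivAt_iff_isLittleO_nhds_zero]
  refine Asymptotics.IsBigO.trans_isLittleO (g := fun v : Eucl n => ‖v‖ ^ 2) ?_ ?_
  · refine Asymptotics.IsBigO.of_bound (|q| * (K + 1)) (Eventually.of_forall fun v => ?_)
    rw [barrier_add, InnerProductSpace.toDual_apply_apply, Real.norm_eq_abs,
      Real.norm_of_nonneg (by positivity), add_assoc, add_sub_cancel_left, add_sub_cancel_left]
    exact abs_barrier_rem_le hK v
  · exact (Asymptotics.isLittleO_norm_pow_id one_lt_two)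

lemma barrier_lip (hK : 1 ≤ K) (β : ℝ) (b y : Eucl n) (q r : ℝ) (hr : 0 ≤ r) :
    ∃ C, 0 ≤ C ∧ ∀ x ∈ closedBall (0 : Eucl n) r,
    ∀ x' ∈ closedBall (0 : Eucl n) r, |barrier β b y q K x - barrier β b y q K x'| ≤ C * dist x x' := by
  refine ⟨‖barrierGrad b y q K 0‖ + 2 * |q| * (K + 1) * r + |q| * (K + 1) * (2 * r), by positivity,
    fun x hx x' hx' => ?_⟩
  have h1 := barrier_add (β := β) (b := b) (y := y) (q := q) (K := K) x' (x - x')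
  rw [add_sub_cancel] at h1
  rw [h1, add_assoc, add_sub_cancel_left, dist_eq_norm]
  refine (abs_add_le _ _).trans ?_
  rw [add_mul]
  have hx : ‖x‖ ≤ r := by simpa using hx
  have hx' : ‖x'‖ ≤ r := by simpa using hx'
  refine add_le_add ?_ ?_
  · refine (abs_real_inner_le_norm _ _).trans ?_
    gcongr
    have h2 := norm_barrierGrad_sub_le (b := b) (y := y) (q := q) hK x' 0
    rw [sub_zero] at h2
    have h3 := norm_add_le (barrierGrad b y q K 0) (barrierGrad b y q K x' - barrierGrad b y q K 0)
    rw [add_sub_cancel] at h3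
    have h4 : 2 * |q| * (K + 1) * ‖x'‖ ≤ 2 * |q| * (K + 1) * r := by gcongr
    linarith
  · refine (abs_barrier_rem_le hK _).trans ?_
    rw [sq, ← mul_assoc]
    gcongr
    exact (norm_sub_le x x').trans (by linarith)

end Barrier

section ComparisonPrinciple

variable {F : Eucl n → ℝ → Eucl n → Eucl n} {F₀ : Eucl n → ℝ → Eucl n → ℝ} {u : Eucl n → ℝ}
  {L : ℝ≥0} {ρ lam Lam M : ℝ}

lemma inner_single_one (x : Eucl n) (i : Fin (n + 1)) :
    ⟪x, EuclideanSpace.single i (1 : ℝ)⟫_ℝ = x i := by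
  rw [EuclideanSpace.inner_single_right]; simp

lemma inner_eq_sum (x y : Eucl n) :
    ⟪x, y⟫_ℝ = ∑ i, x i * ⟪y, EuclideanSpace.single i (1 : ℝ)⟫_ℝ := by
  rw [PiLp.inner_apply]
  refine Finset.sum_congr rfl fun i _ => ?_
  rw [inner_single_one, mul_comm]; rfl

lemma mem_closure_upper {x : Eucl n} (hx : 0 ≤ x (Fin.last n)) : x ∈ closure (upper n) := by
  have h1 : Tendsto (fun N : ℕ => x + (1 / ((N : ℝ) + 1)) • eLast n) atTop (𝓝 (x + (0 : ℝ) • eLast n)) :=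
    tendsto_const_nhds.add (tendsto_one_div_add_atTop_nhds_zero_nat.smul_const _)
  rw [zero_smul, add_zero] at h1
  refine mem_closure_of_tendsto h1 (Eventually.of_forall fun N => ?_)
  show 0 < (x + (1 / ((N : ℝ) + 1)) • eLast n) (Fin.last n)
  rw [PiLp.add_apply, PiLp.smul_apply, eLast_last, smul_eq_mul, mul_one]
  positivity

lemma eqOn_zero_of_integral_gradient_nonpos {w : Eucl n → ℝ} (hw : LipBdd w) {r : ℝ}
    (hw0 : ∀ x, x ∉ ball (0 : Eucl n) r → w x = 0)
    (hint : ∫ x in upper n, ‖gradient w x‖ ^ 2 ≤ 0) {x : Eucl n} (hx : 0 ≤ x (Fin.last n)) :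
    w x = 0 := by
  obtain ⟨C, hC, hCb⟩ := id hw
  have hcont := hw.continuous
  set V := volume.real ({x | w x ≠ 0} ∩ upper n) with hV
  have hV0 : 0 ≤ V := measureReal_nonneg
  set s : ℝ := 1 + 2 * V / halfVol n with hs
  have hhv := halfVol_pos (n := n)
  have hs1 : 1 ≤ s := by
    have : 0 ≤ 2 * V / halfVol n := by positivity
    linarith
  have h1 := faber_krahn hC (x₀ := 0) (R := r) (s := s) (by linarith) hw0 (by
    have h2 : s ≤ s ^ (n + 1) := le_self_pow₀ hs1 (Nat.succ_ne_zero n)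
    have h3 : 2 * V ≤ s * halfVol n := by
      rw [hs, add_mul, div_mul_cancel₀ _ hhv.ne']; linarith
    exact h3.trans (by gcongr))
  have h4 : ∫ x in upper n, w x ^ 2 ≤ 0 := by
    refine h1.trans ?_
    have : 0 ≤ 2 * s ^ 2 := by positivity
    exact mul_nonpos_of_nonneg_of_nonpos this hint
  have h5 : Integrable (fun x => w x ^ 2) (volume.restrict (upper n)) := by
    refine Integrable.restrict ?_
    refine integrable_of_bounded_of_support (K := C ^ 2) (x₀ := (0 : Eucl n)) (R := r) ?_ ?_ ?_
    · exact (hcont.pow 2).aestronglyMeasurable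
    · intro x
      rw [Real.norm_eq_abs, abs_pow]
      have := hCb x
      gcongr
    · intro x hx
      rw [hw0 x fun h => hx (ball_subset_closedBall h)]; simp
  have h6 : ∫ x in upper n, w x ^ 2 = 0 :=
    le_antisymm h4 (integral_nonneg fun x => sq_nonneg _)
  rw [integral_eq_zero_iff_of_nonneg (fun x => sq_nonneg _) h5] at h6
  have h7 : Set.EqOn (fun x => w x ^ 2) 0 (upper n) :=
    Measure.eqOn_open_of_ae_eq h6 isOpen_upper (hcont.pow 2).continuousOn continuousOn_const
  have h8 : Set.EqOn (fun x => w x ^ 2) 0 (closure (upper n)) :=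
    h7.closure (hcont.pow 2) continuous_const
  have h9 : w x ^ 2 = 0 := h8 (mem_closure_upper hx)
  exact pow_eq_zero_iff two_ne_zero |>.1 h9

lemma Sol.flux_barrier_lip (hs : Sol F F₀ u L ρ lam Lam M) {b y : Eucl n} {q K : ℝ} (hK : 1 ≤ K)
    (x x' : Eucl n) : ‖F x (u x) (barrierGrad b y q K x) - F x' (u x') (barrierGrad b y q K x')‖ ≤
      Lam * (1 + L + 2 * |q| * (K + 1)) * ‖x - x'‖ := by
  have h0 := hs.Lam_pos
  have h1 := hs.lip.dist_le_mul x x'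
  rw [Real.dist_eq] at h1
  refine (hs.lipF _ _ _ _ _ _).trans ?_
  rw [mul_assoc]
  gcongr
  have h2 := norm_barrierGrad_sub_le (b := b) (y := y) (q := q) hK x x'
  rw [dist_eq_norm x x'] at h1 ⊢
  linarith

lemma single_last_of_ne {i : Fin (n + 1)} (hi : i ≠ Fin.last n) :
    (EuclideanSpace.single i (1 : ℝ) : Eucl n) (Fin.last n) = 0 := by
  simp [hi.symm]

/-- Tangential increments of the flux of a barrier. -/
lemma Sol.flux_incr_tangential (hs : Sol F F₀ u L ρ lam Lam M) {b y : Eucl n} {q K : ℝ}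
    {i : Fin (n + 1)} (hi : i ≠ Fin.last n) {h : ℝ} (hh : 0 < h) {x x' : Eucl n}
    (hx' : x' = x - h • EuclideanSpace.single i (1 : ℝ)) :
    |F x (u x) (barrierGrad b y q K x) i - F x' (u x') (barrierGrad b y q K x') i| ≤
      (Lam * (1 + L) + 2 * |q| * Lam) * h := by
  have h0 := hs.Lam_pos
  have hxx : x - x' = h • EuclideanSpace.single i (1 : ℝ) := by rw [hx', sub_sub_cancel]
  have hn : ‖x - x'‖ = h := by
    rw [hxx, norm_smul, Real.norm_of_nonneg hh.le]; simp
  have h1 := hs.lip.dist_le_mul x x'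
  rw [Real.dist_eq, dist_eq_norm, hn] at h1
  rw [← PiLp.sub_apply, ← Real.norm_eq_abs]
  refine (PiLp.norm_apply_le _ _).trans ((hs.lipF _ _ _ _ _ _).trans ?_)
  rw [dist_eq_norm, hn, barrierGrad_sub, hxx, PiLp.smul_apply, single_last_of_ne hi, smul_zero,
    mul_zero, zero_smul, zero_sub, norm_smul, norm_neg, norm_smul, Real.norm_of_nonneg hh.le,
    PiLp.norm_single, norm_one, mul_one, Real.norm_eq_abs, abs_mul, abs_two]
  have : Lam * (h + |u x - u x'| + 2 * |q| * h) ≤ Lam * (h + L * h + 2 * |q| * h) := by gcongr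
  linarith

/-- Normal increments of the flux of a barrier. -/
lemma Sol.flux_incr_normal (hs : Sol F F₀ u L ρ lam Lam M) {b y : Eucl n} {q K ς : ℝ}
    (hς : ς = 1 ∨ ς = -1) (hq : 0 < q) (hK : 1 < K) {h : ℝ} (hh : 0 < h)
    (hh0 : 2 * q * (K + 1) * h ≤ M / 2) {x x' : Eucl n} (hxρ : x ∈ ball (0 : Eucl n) ρ)
    (hp : ‖barrierGrad b y (ς * q) K x‖ ≤ M / 2) (hx' : x' = x - h • eLast n) :
    (2 * q * lam * (K - 1) - Lam * (1 + L)) * h ≤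
      ς * F x (u x) (barrierGrad b y (ς * q) K x) (Fin.last n) -
      ς * F x' (u x') (barrierGrad b y (ς * q) K x') (Fin.last n) := by
  have h0 := hs.Lam_pos
  have hM : 0 ≤ M := by linarith [norm_nonneg (barrierGrad b y (ς * q) K x)]
  have hς1 : |ς| = 1 := by rcases hς with h | h <;> rw [h] <;> simp
  have hς2 : ς * ς = 1 := by rcases hς with h | h <;> rw [h] <;> norm_num
  have hqa : |ς * q| = q := by rw [abs_mul, hς1, one_mul, abs_of_pos hq]
  have hxx : x - x' = h • eLast n := by rw [hx', sub_sub_cancel]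
  have hn : ‖x - x'‖ = h := by
    rw [hxx, norm_smul, Real.norm_of_nonneg hh.le, norm_eLast, mul_one]
  have h1 := hs.lip.dist_le_mul x x'
  rw [Real.dist_eq, dist_eq_norm, hn] at h1
  set p := barrierGrad b y (ς * q) K x with hpd
  set p' := barrierGrad b y (ς * q) K x' with hpd'
  have hpp : p - p' = (ς * (2 * q * (K - 1) * h)) • eLast n := by
    rw [hpd, hpd', barrierGrad_sub, hxx, PiLp.smul_apply, eLast_last, smul_eq_mul, mul_one]
    module
  have hnp : ‖p - p'‖ ≤ M / 2 := by
    have := norm_barrierGrad_sub_le (b := b) (y := y) (q := ς * q) hK.le x x'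
    rw [hn, hqa] at this
    exact this.trans hh0
  have hp' : ‖p'‖ ≤ M := by
    have := norm_sub_le p (p - p')
    rw [sub_sub_cancel] at this
    linarith
  have hmono := hs.mono x hxρ (u x) (hs.bdd x hxρ) p p' (by linarith) hp'
  have hc : 0 < 2 * q * (K - 1) * h := by
    have : 0 < K - 1 := by linarith
    positivity
  rw [hpp, norm_smul, norm_eLast, mul_one, Real.norm_eq_abs, abs_mul, hς1, one_mul, abs_of_pos hc,
    real_inner_smul_right, inner_eLast, PiLp.sub_apply] at hmono
  have h2 : lam * (2 * q * (K - 1) * h) ≤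
      ς * (F x (u x) p (Fin.last n) - F x (u x) p' (Fin.last n)) := by
    refine le_of_mul_le_mul_left ?_ hc
    calc _ = lam * (2 * q * (K - 1) * h) ^ 2 := by ring
      _ ≤ _ := hmono
      _ = _ := by ring
  have h3 : |F x (u x) p' (Fin.last n) - F x' (u x') p' (Fin.last n)| ≤ Lam * (1 + L) * h := by
    rw [← PiLp.sub_apply]
    refine (abs_last_le _).trans ((hs.lipF _ _ _ _ _ _).trans ?_)
    rw [dist_eq_norm, hn, sub_self, norm_zero, add_zero, mul_assoc]
    gcongr
    linarith
  have h4 : |ς * (F x (u x) p' (Fin.last n) - F x' (u x') p' (Fin.last n))| ≤ Lam * (1 + L) * h := by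
    rwa [abs_mul, hς1, one_mul]
  have h5 := (abs_le.1 h4).1
  linarith

end ComparisonPrinciple

section ComparisonMain

variable {F : Eucl n → ℝ → Eucl n → Eucl n} {F₀ : Eucl n → ℝ → Eucl n → ℝ} {u : Eucl n → ℝ}
  {L : ℝ≥0} {ρ lam Lam M : ℝ}

lemma integrable_mul_inner_gradient {f w : Eucl n → ℝ} (hf : Continuous f) (hw : LipBdd w) {R : ℝ}
    (hsupp : ∀ x, x ∉ ball (0 : Eucl n) R → w x = 0) (e : Eucl n) :
    Integrable fun x => f x * ⟪gradient w x, e⟫_ℝ := by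
  have hc : Continuous fun x => ‖f x • e‖ := by fun_prop
  obtain ⟨K, hK0, hK⟩ := exists_bound_closedBall hc R
  have h1 := integrable_pairing (V := fun x => f x • e) (V₀ := fun _ => 0) (K := K) (R := R)
    (x₀ := 0) (by fun_prop) measurable_const (fun x hx => by simpa using hK x hx)
    (fun x _ => by simpa using hK0) hw
    fun x hx => hsupp x fun h => hx (ball_subset_closedBall h)
  refine h1.congr (Eventually.of_forall fun x => ?_)
  simp only [real_inner_smul_left, zero_mul, add_zero]
  rw [real_inner_comm]

lemma Sol.weak_le (hs : Sol F F₀ u L ρ lam Lam M) {w : Eucl n → ℝ} {p : Eucl n → Eucl n}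
    {ς K₀ r ε : ℝ} (hς : ς = 1 ∨ ς = -1) (hε : 0 < ε) (hwL : LipBdd w) (hw0 : ∀ x, 0 ≤ w x)
    (hr : r < ρ) (hsupp : ∀ x, x ∉ ball (0 : Eucl n) r → w x = 0)
    (hadm : ∀ x ∈ ball (0 : Eucl n) ρ, x (Fin.last n) = 0 → 0 ≤ u x + ς * ε * w x)
    (hp : Continuous p)
    (hgrad : ∀ x ∈ upper n, ∀ u', w x ≠ 0 → HasGradientAt u u' x → gradient w x = ς • (p x - u'))
    (hpM : ∀ x ∈ upper n, w x ≠ 0 → ‖p x‖ ≤ M)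
    (hK₀ : ∀ x ∈ ball (0 : Eucl n) ρ, |F₀ x (u x) (gradient u x)| ≤ K₀) :
    lam * ∫ x in upper n, ‖gradient w x‖ ^ 2 ≤
      (∑ i, ∫ x in upper n, ς * F x (u x) (p x) i *
        ⟪gradient w x, EuclideanSpace.single i (1 : ℝ)⟫_ℝ) + K₀ * ∫ x in upper n, w x := by
  obtain ⟨C, hC, hCb⟩ := id hwL
  have hς1 : |ς| = 1 := by rcases hς with h | h <;> rw [h] <;> simp
  have hς2 : ς * ς = 1 := by rcases hς with h | h <;> rw [h] <;> norm_num
  have hsupp' : ∀ x, x ∉ closedBall (0 : Eucl n) r → w x = 0 :=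
    fun x hx => hsupp x fun h => hx (ball_subset_closedBall h)
  have hX : ∀ i, Continuous fun x => ς * F x (u x) (p x) i := fun i => by
    have h1 : Continuous fun x => F x (u x) (p x) :=
      (continuous_of_lip hs.lipF).comp (continuous_id.prodMk (hs.lip.continuous.prodMk hp))
    exact continuous_const.mul ((EuclideanSpace.proj (𝕜 := ℝ) i).continuous.comp h1)
  have hint := fun i => integrable_mul_inner_gradient (hX i) hwL hsupp
    (EuclideanSpace.single i (1 : ℝ))
  set V : Eucl n → Eucl n := fun x => F x (u x) (gradient u x) with hV
  set V₀ : Eucl n → ℝ := fun x => F₀ x (u x) (gradient u x) with hV₀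
  obtain ⟨K₁, hK₁⟩ := norm_flux_le hs.Lam_pos hs.lipF hs.lip (norm_gradient_le hs.lip) r
  obtain ⟨K₂, hK₂⟩ := norm_flux_le (F := F₀) hs.Lam_pos hs.lipF₀ hs.lip (norm_gradient_le hs.lip) r
  have hpair : Integrable fun x => ⟪V x, gradient w x⟫_ℝ + V₀ x * w x := by
    refine integrable_pairing (K := max K₁ K₂) (R := r) (x₀ := 0)
      (measurable_flux hs.lipF hs.lip.continuous (measurable_gradient u))
      (measurable_flux (F := F₀) hs.lipF₀ hs.lip.continuous (measurable_gradient u))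
      (fun x hx => (hK₁ x hx).trans (le_max_left _ _))
      (fun x hx => (hK₂ x hx).trans (le_max_right _ _)) hwL hsupp'
  have hwint : Integrable w := by
    refine integrable_of_bounded_of_support (K := C) hwL.continuous.aestronglyMeasurable
      (fun x => by simpa using hCb x) hsupp'
  have hvi : 0 ≤ ς * ∫ x in upper n, (⟪V x, gradient w x⟫_ℝ + V₀ x * w x) := by
    have h1 := hs.vi (fun x => ς * ε * w x) ((LipBdd.const (ς * ε)).mul hwL) r hr
      (fun x hx => by rw [hsupp x hx, mul_zero]) hadm
    have h2 : ∫ x in upper n, (⟪V x, gradient (fun x => ς * ε * w x) x⟫_ℝ + V₀ x * (ς * ε * w x)) =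
        ε * (ς * ∫ x in upper n, (⟪V x, gradient w x⟫_ℝ + V₀ x * w x)) := by
      rw [← mul_assoc, ← integral_const_mul]
      refine integral_congr_ae (ae_restrict_of_ae ?_)
      filter_upwards [ae_hasGradientAt hC] with x hx
      rw [(hasGradientAt_const_mul (ς * ε) hx).gradient, real_inner_smul_right]
      ring
    rw [h2] at h1
    exact nonneg_of_mul_nonneg_right h1 hε
  have hle : lam * ∫ x in upper n, ‖gradient w x‖ ^ 2 ≤ ∫ x in upper n,
      ((∑ i, ς * F x (u x) (p x) i * ⟪gradient w x, EuclideanSpace.single i (1 : ℝ)⟫_ℝ) + K₀ * w x -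
        ς * (⟪V x, gradient w x⟫_ℝ + V₀ x * w x)) := by
    rw [← integral_const_mul]
    refine integral_mono_ae ?_ ?_ ?_
    · exact ((integrable_norm_gradient_sq hC hsupp').const_mul _).restrict
    · exact (((integrable_finsetSum _ fun i _ => hint i).add (hwint.const_mul _)).sub
        (hpair.const_mul _)).restrict
    · filter_upwards [ae_restrict_of_ae (ae_hasGradientAt hs.lip),
        ae_restrict_mem measurableSet_upper] with x hx hxu
      by_cases hwx : w x = 0
      · rw [gradient_eq_zero_of_nonneg hw0 hwx, hwx]; simp
      have hxr : x ∈ ball (0 : Eucl n) ρ := by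
        by_contra h
        exact hwx (hsupp x fun h' => h (ball_subset_ball hr.le h'))
      have hg := hgrad x hxu _ hwx hx
      have hm := hs.mono x hxr (u x) (hs.bdd x hxr) (p x) (gradient u x) (hpM x hxu hwx)
        ((norm_gradient_le hs.lip x).trans (by linarith [hs.M_ge, (NNReal.coe_nonneg L)]))
      have hsum : ∑ i, ς * F x (u x) (p x) i * ⟪gradient w x, EuclideanSpace.single i (1 : ℝ)⟫_ℝ =
          ς * ⟪F x (u x) (p x), gradient w x⟫_ℝ := by
        rw [inner_eq_sum, Finset.mul_sum]
        refine Finset.sum_congr rfl fun i _ => ?_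
        ring
      have hn : ‖gradient w x‖ = ‖p x - gradient u x‖ := by
        rw [hg, norm_smul, Real.norm_eq_abs, hς1, one_mul]
      have h0 : -(K₀ * w x) ≤ -(ς * (V₀ x * w x)) := by
        have h1 : ς * V₀ x ≤ K₀ := by
          refine (le_abs_self _).trans ?_
          rw [abs_mul, hς1, one_mul]
          exact hK₀ x hxr
        have := mul_le_mul_of_nonneg_right h1 (hw0 x)
        linarith
      have h2 : ⟪F x (u x) (p x) - V x, p x - gradient u x⟫_ℝ =
          ς * ⟪F x (u x) (p x), gradient w x⟫_ℝ - ς * ⟪V x, gradient w x⟫_ℝ := by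
        rw [hg, real_inner_smul_right, real_inner_smul_right, ← mul_assoc, ← mul_assoc, hς2, one_mul,
          one_mul, inner_sub_left]
      have h3 : lam * ‖gradient w x‖ ^ 2 ≤ ς * ⟪F x (u x) (p x), gradient w x⟫_ℝ -
          ς * ⟪V x, gradient w x⟫_ℝ := by rw [hn, ← h2]; exact hm
      show lam * ‖gradient w x‖ ^ 2 ≤ _
      rw [hsum]
      linarith
  refine hle.trans ?_
  have hA := (integrable_finsetSum Finset.univ fun i _ => hint i).restrict (s := upper n)
  have hB := (hwint.const_mul K₀).restrict (s := upper n)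
  have e1 := integral_sub (hA.add hB) ((hpair.const_mul ς).restrict (s := upper n))
  have e2 := integral_add hA hB
  rw [integral_finsetSum _ fun i _ => (hint i).restrict, integral_const_mul] at e2
  rw [integral_const_mul] at e1
  simp only [Pi.add_apply] at e1
  linarith

end ComparisonMain

section ComparisonBarrier

variable {F : Eucl n → ℝ → Eucl n → Eucl n} {F₀ : Eucl n → ℝ → Eucl n → ℝ} {u : Eucl n → ℝ}
  {L : ℝ≥0} {ρ lam Lam M : ℝ}

/-- The boundary term in the divergence inequality for a barrier flux. -/
lemma boundary_term_le {f w : Eucl n → ℝ} {R A B₁ B₂ K₁ : ℝ} (hA : ∀ x, |w x| ≤ A)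
    (hwl : ∀ x x', |w x - w x'| ≤ B₁ * dist x x') (hfl : ∀ x x', |f x - f x'| ≤ B₂ * dist x x')
    (hK : ∀ x ∈ closedBall (0 : Eucl n) R, |f x| ≤ K₁) (hK0 : 0 ≤ K₁) (hB₁ : 0 ≤ B₁)
    (hB₂ : 0 ≤ B₂) (hA0 : 0 ≤ A)
    (hsupp : ∀ x, x ∉ ball (0 : Eucl n) R → w x = 0)
    (hthin : ∀ x, x (Fin.last n) = 0 → 0 ≤ f x * w x) {h : ℝ} {x : Eucl n}
    (hx : x ∈ upper n) (hxh : x - h • eLast n ∉ upper n) :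
    -(f x * w x) ≤ (B₂ * A + K₁ * B₁) * h := by
  have hx0 : 0 < x (Fin.last n) := hx
  have hxh : ¬ 0 < (x - h • eLast n) (Fin.last n) := hxh
  rw [PiLp.sub_apply, PiLp.smul_apply, eLast_last, smul_eq_mul, mul_one, not_lt] at hxh
  set t := x (Fin.last n) with ht
  have hh : 0 ≤ h := by linarith
  by_cases hw : w x = 0
  · rw [hw, mul_zero, neg_zero]; positivity
  have hxR : x ∈ closedBall (0 : Eucl n) R := by
    by_contra h'
    exact hw (hsupp x fun h'' => h' (ball_subset_closedBall h''))
  set x' := x - t • eLast n with hx'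
  have hd : dist x x' = t := by
    rw [dist_eq_norm, hx', sub_sub_cancel, norm_smul, norm_eLast, mul_one,
      Real.norm_of_nonneg hx0.le]
  have h1 := hthin x' (by
    rw [hx', PiLp.sub_apply, PiLp.smul_apply, eLast_last, smul_eq_mul, mul_one, sub_self])
  have h2 := hwl x x'
  have h3 := hfl x x'
  rw [hd] at h2 h3
  have h4 : |f x * (w x - w x')| ≤ K₁ * (B₁ * t) := by
    rw [abs_mul]; exact mul_le_mul (hK x hxR) h2 (abs_nonneg _) hK0
  have h5 : |(f x - f x') * w x'| ≤ (B₂ * t) * A := by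
    rw [abs_mul]; exact mul_le_mul h3 (hA x') (abs_nonneg _) (by positivity)
  have h6 := (abs_le.1 h4).1
  have h7 := (abs_le.1 h5).1
  have h8 : (B₂ * A + K₁ * B₁) * t ≤ (B₂ * A + K₁ * B₁) * h := by
    gcongr; linarith
  linarith

/-- Comparison of a solution with a quadratic barrier. -/
lemma Sol.comparison (hs : Sol F F₀ u L ρ lam Lam M) {β q K ς K₀ r : ℝ} {b y : Eucl n}
    {D : Set (Eucl n)} (hς : ς = 1 ∨ ς = -1) (hq : 0 < q) (hK : 1 < K)
    (hK₀ : ∀ x ∈ ball (0 : Eucl n) ρ, |F₀ x (u x) (gradient u x)| ≤ K₀)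
    (hlarge : Lam * (1 + L) * (n + 1) + 2 * n * q * Lam + K₀ ≤ 2 * q * lam * (K - 1))
    (hD : IsOpen D) (hDr : D ⊆ ball 0 r) (hr : r < ρ)
    (hp : ∀ x ∈ D, ‖barrierGrad b y (ς * q) K x‖ ≤ M / 2)
    (hfr : ∀ x ∈ frontier D, 0 ≤ x (Fin.last n) → ς * (barrier β b y (ς * q) K x - u x) ≤ 0)
    (hneu : ∀ x ∈ D, x (Fin.last n) = 0 → 0 < ς * (barrier β b y (ς * q) K x - u x) →
      0 ≤ ς * F x (u x) (barrierGrad b y (ς * q) K x) (Fin.last n))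
    (hadm : ∃ ε > 0, ∀ x ∈ D, x (Fin.last n) = 0 → 0 < ς * (barrier β b y (ς * q) K x - u x) →
      0 ≤ u x + ε * (barrier β b y (ς * q) K x - u x))
    {x : Eucl n} (hxD : x ∈ D) (hx0 : 0 ≤ x (Fin.last n)) :
    ς * (barrier β b y (ς * q) K x - u x) ≤ 0 := by
  obtain ⟨ε, hε, hadm⟩ := hadm
  have hlam := hs.lam_pos
  have hLam := hs.Lam_pos
  have hL : (0 : ℝ) ≤ L := L.coe_nonneg
  have hM : 0 < M := by linarith [hs.M_ge]
  have hς1 : |ς| = 1 := by rcases hς with h | h <;> rw [h] <;> simp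
  have hς2 : ς * ς = 1 := by rcases hς with h | h <;> rw [h] <;> norm_num
  set φ := barrier β b y (ς * q) K with hφ
  set p := barrierGrad b y (ς * q) K with hpd
  have hφg : ∀ x, HasGradientAt φ (p x) x := hasGradientAt_barrier hK.le
  have hφc : Continuous φ :=
    continuous_iff_continuousAt.2 fun x => (hφg x).hasFDerivAt.continuousAt
  have hpc : Continuous p := by
    refine (LipschitzWith.of_dist_le_mul (K := Real.toNNReal (2 * |ς * q| * (K + 1)))
      fun x x' => ?_).continuous
    rw [dist_eq_norm, dist_eq_norm, Real.coe_toNNReal _ (by positivity)]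
    exact norm_barrierGrad_sub_le hK.le x x'
  set g : Eucl n → ℝ := fun x => ς * (φ x - u x) with hg
  have hgc : Continuous g := continuous_const.mul (hφc.sub hs.lip.continuous)
  have hr0 : 0 ≤ r := (dist_nonneg.trans_lt (hDr hxD : dist x 0 < r)).le
  obtain ⟨C₁, hC₁0, hC₁⟩ := barrier_lip hK.le β b y (ς * q) r hr0
  set w : Eucl n → ℝ := fun x => D.indicator (fun x => max (g x) 0) (reflUp x) with hw
  have hwL : LipBdd w := by
    refine lipBdd_glue hD hDr (C := C₁ + L) (by positivity) (fun x hx x' hx' => ?_)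
      fun x hx hx0 => max_eq_right (hfr x hx hx0)
    refine (abs_max_sub_max_le_abs _ _ _).trans ?_
    have h1 : g x - g x' = ς * ((φ x - φ x') - (u x - u x')) := by simp only [hg]; ring
    rw [h1, abs_mul, hς1, one_mul, add_mul]
    refine (abs_sub _ _).trans (add_le_add (hC₁ x hx x' hx') ?_)
    have := hs.lip.dist_le_mul x x'
    rwa [Real.dist_eq] at this
  have hw0 : ∀ x, 0 ≤ w x := fun x => Set.indicator_nonneg (fun _ _ => le_max_right _ _) _
  have hsupp : ∀ x, x ∉ ball (0 : Eucl n) r → w x = 0 := fun x hx => by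
    refine Set.indicator_of_notMem (fun h => hx ?_) _
    have h1 := hDr h
    rw [mem_ball_zero_iff, norm_reflUp] at h1
    rwa [mem_ball_zero_iff]
  have hwpos : ∀ x, 0 ≤ x (Fin.last n) → w x ≠ 0 → x ∈ D ∧ 0 < g x ∧ w x = g x := by
    intro x hx hwx
    have h1 : w x = D.indicator (fun x => max (g x) 0) x := by
      show D.indicator (fun x => max (g x) 0) (reflUp x) = _
      rw [reflUp_of_nonneg hx]
    have hxD : x ∈ D := by
      by_contra h; exact hwx (by rw [h1, Set.indicator_of_notMem h])
    rw [Set.indicator_of_mem hxD] at h1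
    have hgx : 0 < g x := by
      by_contra h; exact hwx (by rw [h1, max_eq_right (not_lt.1 h)])
    exact ⟨hxD, hgx, by rw [h1, max_eq_left hgx.le]⟩
  have hgrad : ∀ x ∈ upper n, ∀ u', w x ≠ 0 → HasGradientAt u u' x →
      gradient w x = ς • (p x - u') := by
    intro x hx u' hwx hu'
    obtain ⟨hxD, hgx, -⟩ := hwpos x (le_of_lt hx) hwx
    have h1 : w =ᶠ[𝓝 x] g := by
      filter_upwards [hD.mem_nhds hxD, isOpen_upper.mem_nhds hx,
        hgc.continuousAt.eventually_const_lt hgx] with z hz1 hz2 hz3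
      show D.indicator (fun x => max (g x) 0) (reflUp z) = _
      rw [reflUp_of_nonneg (le_of_lt hz2), Set.indicator_of_mem hz1, max_eq_left hz3.le]
    rw [gradient_congr h1]
    exact (hasGradientAt_const_mul ς (hasGradientAt_sub (hφg x) hu')).gradient
  have hadm' : ∀ x ∈ ball (0 : Eucl n) ρ, x (Fin.last n) = 0 → 0 ≤ u x + ς * ε * w x := by
    intro x hx hx0
    by_cases hwx : w x = 0
    · rw [hwx, mul_zero, add_zero]; exact hs.nonneg x hx hx0
    · obtain ⟨hxD, hgx, hwg⟩ := hwpos x hx0.ge hwx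
      have h1 := hadm x hxD hx0 hgx
      have h2 : ς * ε * w x = ε * (φ x - u x) := by
        rw [hwg]; simp only [hg]; linear_combination (ε * (φ x - u x)) * hς2
      rwa [h2]
  have hweak := hs.weak_le hς hε hwL hw0 hr hsupp hadm' hpc hgrad
    (fun x hx hwx => (hp x (hwpos x (le_of_lt hx) hwx).1).trans (by linarith)) hK₀
  have hXl := hs.flux_barrier_lip (b := b) (y := y) (q := ς * q) hK.le
  have hXc : ∀ i, Continuous fun x => ς * F x (u x) (p x) i := fun i => by
    have h1 : Continuous fun x => F x (u x) (p x) :=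
      (continuous_of_lip hs.lipF).comp (continuous_id.prodMk (hs.lip.continuous.prodMk hpc))
    exact continuous_const.mul ((EuclideanSpace.proj (𝕜 := ℝ) i).continuous.comp h1)
  obtain ⟨A, hA0, hAl, hA⟩ := hwL.bounds
  have hqa : |ς * q| = q := by rw [abs_mul, hς1, one_mul, abs_of_pos hq]
  have htang : ∀ i : Fin n, ∫ x in upper n, ς * F x (u x) (p x) i.castSucc *
      ⟪gradient w x, EuclideanSpace.single i.castSucc (1 : ℝ)⟫_ℝ ≤
      (Lam * (1 + L) + 2 * q * Lam) * ∫ x in upper n, w x := by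
    intro i
    have hi : i.castSucc ≠ Fin.last n := (Fin.castSucc_lt_last i).ne
    have h1 := integral_mul_inner_gradient_le (e := EuclideanSpace.single i.castSucc (1 : ℝ))
      (single_last_of_ne hi).ge (hXc i.castSucc) hwL hw0 (a := -(Lam * (1 + L) + 2 * q * Lam))
      (C := 0) (h₀ := 1) hsupp one_pos le_rfl (fun h hh _ x _ _ _ => ?_) (fun h hh _ x hx hx' => ?_)
    · rwa [neg_neg] at h1
    · have h2 := hs.flux_incr_tangential (b := b) (y := y) (q := ς * q) (K := K) hi hh
        (x := x) rfl
      rw [hqa] at h2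
      have h3 : |ς * F x (u x) (p x) i.castSucc - ς * F (x - h • EuclideanSpace.single i.castSucc (1 : ℝ))
          (u (x - h • EuclideanSpace.single i.castSucc (1 : ℝ)))
          (p (x - h • EuclideanSpace.single i.castSucc (1 : ℝ))) i.castSucc| ≤ (Lam * (1 + L) + 2 * q * Lam) * h := by
        rw [← mul_sub, abs_mul, hς1, one_mul]; exact h2
      have h4 := (abs_le.1 h3).1
      linarith
    · refine absurd ?_ hx'
      show 0 < (x - h • EuclideanSpace.single i.castSucc (1 : ℝ)) (Fin.last n)
      rw [PiLp.sub_apply, PiLp.smul_apply, single_last_of_ne hi, smul_zero, sub_zero]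
      exact hx
  have hnorm : ∫ x in upper n, ς * F x (u x) (p x) (Fin.last n) *
      ⟪gradient w x, EuclideanSpace.single (Fin.last n) (1 : ℝ)⟫_ℝ ≤
      -(2 * q * lam * (K - 1) - Lam * (1 + L)) * ∫ x in upper n, w x := by
    obtain ⟨K₁, hK₁0, hK₁⟩ := exists_bound_closedBall (hXc (Fin.last n)) r
    have hB : 0 ≤ Lam * (1 + L + 2 * |ς * q| * (K + 1)) := by positivity
    refine integral_mul_inner_gradient_le (e := eLast n) (by rw [eLast_last]; exact zero_le_one)
      (hXc (Fin.last n)) hwL hw0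
      (C := Lam * (1 + L + 2 * |ς * q| * (K + 1)) * A + K₁ * A) (h₀ := M / (4 * q * (K + 1))) hsupp
      (by positivity) (by positivity) (fun h hh hh0 x hx hwx _ => ?_) (fun h hh _ x hx hx' => ?_)
    · obtain ⟨hxD, hgx, -⟩ := hwpos x (le_of_lt hx) hwx
      refine hs.flux_incr_normal hς hq hK hh ?_ (ball_subset_ball hr.le (hDr hxD)) (hp x hxD) rfl
      rw [lt_div_iff₀ (by positivity)] at hh0
      linarith
    · refine boundary_term_le hA hAl (fun x x' => ?_) hK₁ hK₁0 hA0 hB hA0 hsupp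
        (fun x hx => ?_) hx hx'
      · rw [← mul_sub, abs_mul, hς1, one_mul, ← PiLp.sub_apply, dist_eq_norm]
        exact (abs_last_le _).trans (hXl x x')
      · by_cases hwx : w x = 0
        · rw [hwx, mul_zero]
        · obtain ⟨hxD, hgx, hwg⟩ := hwpos x hx.ge hwx
          exact mul_nonneg (hneu x hxD hx hgx) (hw0 x)
  have hW : 0 ≤ ∫ x in upper n, w x := integral_nonneg fun x => hw0 x
  rw [Fin.sum_univ_castSucc] at hweak
  have hsum := Finset.sum_le_sum fun i (_ : i ∈ Finset.univ) => htang i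
  rw [Finset.sum_const, Finset.card_univ, Fintype.card_fin, nsmul_eq_mul] at hsum
  have hI : lam * ∫ x in upper n, ‖gradient w x‖ ^ 2 ≤ 0 := by
    have h1 := mul_le_mul_of_nonneg_right hlarge hW
    linarith
  have hI' : ∫ x in upper n, ‖gradient w x‖ ^ 2 ≤ 0 := nonpos_of_mul_nonpos_right hI hlam
  have hwx := eqOn_zero_of_integral_gradient_nonpos hwL hsupp hI' hx0
  have h1 : w x = max (g x) 0 := by
    show D.indicator (fun x => max (g x) 0) (reflUp x) = _
    rw [reflUp_of_nonneg hx0, Set.indicator_of_mem hxD]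
  rw [hwx] at h1
  exact max_eq_right_iff.1 h1.symm

end ComparisonBarrier

section Cylinder

/-- The tangential part of a vector. -/
def tang (x : Eucl n) : Eucl n := x - x (Fin.last n) • eLast n

lemma tang_last (x : Eucl n) : tang x (Fin.last n) = 0 := by
  rw [tang, PiLp.sub_apply, PiLp.smul_apply, eLast_last, smul_eq_mul, mul_one, sub_self]

lemma tang_add (x : Eucl n) : tang x + x (Fin.last n) • eLast n = x := sub_add_cancel _ _

lemma continuous_tang : Continuous (tang (n := n)) :=
  continuous_id.sub (continuous_last.smul continuous_const)

lemma inner_tang_eLast (x : Eucl n) : ⟪tang x, eLast n⟫_ℝ = 0 := by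
  rw [inner_eLast, tang_last]

lemma norm_sq_eq_tang (x : Eucl n) : ‖x‖ ^ 2 = ‖tang x‖ ^ 2 + x (Fin.last n) ^ 2 := by
  conv_lhs => rw [← tang_add x]
  rw [norm_add_sq_real, real_inner_smul_right, inner_tang_eLast, norm_smul, norm_eLast, mul_one,
    Real.norm_eq_abs, sq_abs]
  ring

lemma norm_tang_le (x : Eucl n) : ‖tang x‖ ≤ ‖x‖ := by
  refine le_of_sq_le_sq ?_ (norm_nonneg _)
  rw [norm_sq_eq_tang x]
  linarith [sq_nonneg (x (Fin.last n))]

lemma norm_le_tang_add (x : Eucl n) : ‖x‖ ≤ ‖tang x‖ + |x (Fin.last n)| := by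
  conv_lhs => rw [← tang_add x]
  refine (norm_add_le _ _).trans ?_
  rw [norm_smul, norm_eLast, mul_one, Real.norm_eq_abs]

lemma inner_of_last_eq_zero {a : Eucl n} (ha : a (Fin.last n) = 0) (x : Eucl n) :
    ⟪a, x⟫_ℝ = ⟪a, tang x⟫_ℝ := by
  conv_lhs => rw [← tang_add x]
  rw [inner_add_right, real_inner_smul_right, inner_eLast, ha, mul_zero, add_zero]

/-- A cylinder about `y`, symmetric with respect to the thin space. -/
def cyl (y : Eucl n) (ρ₁ T : ℝ) : Set (Eucl n) :=
  {x | ‖tang (x - y)‖ < ρ₁ ∧ |x (Fin.last n)| < T}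

lemma isOpen_cyl (y : Eucl n) (ρ₁ T : ℝ) : IsOpen (cyl y ρ₁ T) :=
  (isOpen_lt (continuous_tang.comp (continuous_id.sub continuous_const)).norm
    continuous_const).inter (isOpen_lt continuous_last.abs continuous_const)

lemma frontier_cyl {y : Eucl n} {ρ₁ T : ℝ} {x : Eucl n} (hx : x ∈ frontier (cyl y ρ₁ T))
    (hx0 : 0 ≤ x (Fin.last n)) : ‖tang (x - y)‖ ≤ ρ₁ ∧ x (Fin.last n) ≤ T ∧
      (‖tang (x - y)‖ = ρ₁ ∨ x (Fin.last n) = T) := by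
  rw [(isOpen_cyl y ρ₁ T).frontier_eq] at hx
  have h1 : cyl y ρ₁ T ⊆ {x | ‖tang (x - y)‖ ≤ ρ₁} ∩ {x | |x (Fin.last n)| ≤ T} :=
    fun z hz => ⟨hz.1.le, hz.2.le⟩
  have h2 := closure_minimal h1 ((isClosed_le (continuous_tang.comp
    (continuous_id.sub continuous_const)).norm continuous_const).inter
    (isClosed_le continuous_last.abs continuous_const)) hx.1
  have h3 : ‖tang (x - y)‖ ≤ ρ₁ := h2.1
  have h4 : |x (Fin.last n)| ≤ T := h2.2
  rw [abs_of_nonneg hx0] at h4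
  refine ⟨h3, h4, ?_⟩
  by_contra! hcon
  refine hx.2 ⟨lt_of_le_of_ne h3 hcon.1, ?_⟩
  rw [abs_of_nonneg hx0]
  exact lt_of_le_of_ne h4 hcon.2

lemma sub_last_of_thin {x y : Eucl n} (hy : y (Fin.last n) = 0) :
    (x - y) (Fin.last n) = x (Fin.last n) := by rw [PiLp.sub_apply, hy, sub_zero]

lemma norm_sub_sq_of_thin {x y : Eucl n} (hy : y (Fin.last n) = 0) :
    ‖x - y‖ ^ 2 = ‖tang (x - y)‖ ^ 2 + x (Fin.last n) ^ 2 := by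
  rw [norm_sq_eq_tang, sub_last_of_thin hy]

lemma cyl_subset_ball {y : Eucl n} (hy : y (Fin.last n) = 0) {ρ₁ T r : ℝ}
    (h : ‖y‖ + (ρ₁ + T) ≤ r) : cyl y ρ₁ T ⊆ ball 0 r := by
  intro x hx
  rw [mem_ball_zero_iff]
  have h1 := norm_le_tang_add (x - y)
  rw [sub_last_of_thin hy] at h1
  have h2 := norm_add_le y (x - y)
  rw [add_sub_cancel] at h2
  linarith [hx.1, hx.2]

lemma add_smul_eLast_last {y : Eucl n} (hy : y (Fin.last n) = 0) (t : ℝ) :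
    (y + t • eLast n) (Fin.last n) = t := by
  rw [PiLp.add_apply, hy, PiLp.smul_apply, eLast_last, smul_eq_mul, mul_one, zero_add]

lemma tang_smul_eLast (t : ℝ) : tang (t • eLast n) = 0 := by
  rw [tang, PiLp.smul_apply, eLast_last, smul_eq_mul, mul_one, sub_self]

/-- Decomposition of a point relative to a thin base point. -/
lemma base_add_tang {x y : Eucl n} (hy : y (Fin.last n) = 0) :
    y + x (Fin.last n) • eLast n + tang (x - y) = x := by
  rw [tang, sub_last_of_thin hy]; abel

/-- The slope of `u` over the vertical segment of length `s` above `y`. -/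
def chord (u : Eucl n → ℝ) (y : Eucl n) (s : ℝ) : ℝ := (u (y + s • eLast n) - u y) / s

lemma abs_chord_le {u : Eucl n → ℝ} {L : ℝ≥0} (hu : LipschitzWith L u) (y : Eucl n) {s : ℝ}
    (hs : 0 < s) : |chord u y s| ≤ L := by
  rw [chord, abs_div, abs_of_pos hs, div_le_iff₀ hs]
  have := abs_diff_le hu y (s • eLast n)
  rwa [norm_smul, norm_eLast, mul_one, Real.norm_of_nonneg hs.le] at this

lemma chord_mul {u : Eucl n → ℝ} {y : Eucl n} {s : ℝ} (hs : 0 < s) :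
    chord u y s * s = u (y + s • eLast n) - u y := div_mul_cancel₀ _ hs.ne'

end Cylinder

section BarrierBounds

variable {F : Eucl n → ℝ → Eucl n → Eucl n} {F₀ : Eucl n → ℝ → Eucl n → ℝ} {u : Eucl n → ℝ}
  {L : ℝ≥0} {ρ lam Lam M : ℝ}

lemma Sol.exists_lower_order_bound (hs : Sol F F₀ u L ρ lam Lam M) :
    ∃ K₀, 0 ≤ K₀ ∧ ∀ x ∈ ball (0 : Eucl n) ρ, |F₀ x (u x) (gradient u x)| ≤ K₀ := by
  obtain ⟨K, hK⟩ := norm_flux_le (F := F₀) hs.Lam_pos hs.lipF₀ hs.lip (norm_gradient_le hs.lip) ρ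
  refine ⟨|K|, abs_nonneg _, fun x hx => (hK x (ball_subset_closedBall hx)).trans (le_abs_self K)⟩

lemma inner_add_smul_eLast {a x y : Eucl n} {m : ℝ} (hy : y (Fin.last n) = 0) :
    ⟪a + m • eLast n, x - y⟫_ℝ = ⟪a, x - y⟫_ℝ + m * x (Fin.last n) := by
  rw [inner_add_left, real_inner_smul_left, real_inner_comm (x - y) (eLast n), inner_eLast,
    sub_last_of_thin hy]

lemma barrier_eq {β Q K m : ℝ} {a y : Eucl n} (hy : y (Fin.last n) = 0) (x : Eucl n) :
    barrier β (a + m • eLast n) y Q K x = β + ⟪a, x - y⟫_ℝ + m * x (Fin.last n) +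
      Q * ((K - 1) * x (Fin.last n) ^ 2 - ‖tang (x - y)‖ ^ 2) := by
  rw [barrier, inner_add_smul_eLast hy, norm_sub_sq_of_thin hy]
  ring

lemma norm_barrierGrad_sub_base_le {Q K m m' : ℝ} {a y : Eucl n} (hK : 1 ≤ K)
    (hy : y (Fin.last n) = 0) (x : Eucl n) :
    ‖barrierGrad (a + m' • eLast n) y Q K x - (a + m • eLast n)‖ ≤
      |m' - m| + 2 * |Q| * (K + 1) * ‖x - y‖ := by
  have h1 := norm_barrierGrad_sub_le (b := a + m' • eLast n) (y := y) (q := Q) hK x y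
  have h2 : barrierGrad (a + m' • eLast n) y Q K y = a + m' • eLast n := by
    rw [barrierGrad, hy, mul_zero, zero_smul, sub_self, sub_self, smul_zero, add_zero]
  rw [h2] at h1
  have h3 : barrierGrad (a + m' • eLast n) y Q K x - (a + m • eLast n) =
      (m' - m) • eLast n + (barrierGrad (a + m' • eLast n) y Q K x - (a + m' • eLast n)) := by
    module
  rw [h3]
  refine (norm_add_le _ _).trans (add_le_add ?_ h1)
  rw [norm_smul, norm_eLast, mul_one, Real.norm_eq_abs]

lemma norm_add_smul_eLast_le {a : Eucl n} {m L : ℝ} (ha : ‖a‖ ≤ L) (hm : |m| ≤ L) :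
    ‖a + m • eLast n‖ ≤ 2 * L := by
  refine (norm_add_le _ _).trans ?_
  rw [norm_smul, norm_eLast, mul_one, Real.norm_eq_abs]
  linarith

/-- The aspect ratio parameter of the barriers. -/
def barK (n : ℕ) (lam Lam : ℝ) : ℝ := 2 + n * Lam / lam

lemma barK_ge (hlam : 0 < lam) (hLam : 0 < Lam) : 2 ≤ barK n lam Lam := by
  have : 0 ≤ n * Lam / lam := by positivity
  rw [barK]; linarith

lemma barK_large (hlam : 0 < lam) {q S : ℝ} (hS : S ≤ 2 * q * lam) :
    S + 2 * n * q * Lam ≤ 2 * q * lam * (barK n lam Lam - 1) := by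
  have : 2 * q * lam * (barK n lam Lam - 1) = 2 * q * lam + 2 * n * q * Lam := by
    rw [barK]; field_simp; ring
  linarith

/-- One-sided bounds from quadratic barriers on cylinders. -/
lemma Sol.barrier_bound (hs : Sol F F₀ u L ρ lam Lam M) : ∃ κ : ℝ, 1 ≤ κ ∧
    ∀ ς σ s γ m β₀ : ℝ, ∀ y a : Eucl n, (ς = 1 ∨ ς = -1) → 0 < σ → κ * σ ≤ 1 → 0 < s → κ * s ≤ σ →
    y (Fin.last n) = 0 → ‖y‖ + s < ρ → ‖a‖ ≤ L → a (Fin.last n) = 0 → |m| ≤ L → 0 ≤ γ → γ ≤ σ * s →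
    (∀ x ∈ ball y s, 0 ≤ x (Fin.last n) →
      |u x - β₀ - ⟪a, x - y⟫_ℝ - m * x (Fin.last n)| ≤ σ * s) →
    (∀ q : ℝ, 0 < q →
      (∀ x ∈ ball y (s / 2), x (Fin.last n) = 0 →
        0 < ς * (β₀ + ⟪a, x - y⟫_ℝ - ς * q * ‖x - y‖ ^ 2 - u x) + γ →
        ∀ p, ‖p - (a + m • eLast n)‖ ≤ κ * σ → 0 ≤ ς * F x (u x) p (Fin.last n)) ∧
      ∃ ε > 0, ∀ x ∈ ball y (s / 2), x (Fin.last n) = 0 →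
        0 < ς * (β₀ + ⟪a, x - y⟫_ℝ - ς * q * ‖x - y‖ ^ 2 - u x) + γ →
        0 ≤ u x + ε * (β₀ + ς * γ + ⟪a, x - y⟫_ℝ - ς * q * ‖x - y‖ ^ 2 - u x)) →
    ∀ t, 0 ≤ t → κ * t < s →
      ς * (β₀ + (m - ς * κ * σ) * t - u (y + t • eLast n)) + γ ≤ 0 := by
  obtain ⟨K₀, hK₀0, hK₀⟩ := hs.exists_lower_order_bound
  have hlam := hs.lam_pos
  have hLam := hs.Lam_pos
  have hL : (0 : ℝ) ≤ L := L.coe_nonneg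
  set K := barK n lam Lam with hKd
  have hK2 : 2 ≤ K := barK_ge hlam hLam
  have hK1 : 1 < K := by linarith
  set S := Lam * (1 + L) * (n + 1) + K₀ with hS
  have hS0 : 0 ≤ S := by positivity
  refine ⟨64 * (K + 1) + S / lam, ?_, ?_⟩
  · have : 0 ≤ S / lam := by positivity
    linarith
  set κ := 64 * (K + 1) + S / lam with hκ
  have hκ1 : 64 * (K + 1) ≤ κ := by
    have : 0 ≤ S / lam := by positivity
    linarith
  have hκ2 : S ≤ κ * lam := by
    have : S / lam * lam = S := div_mul_cancel₀ _ hlam.ne'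
    have h2 : 0 ≤ 64 * (K + 1) * lam := by positivity
    rw [hκ, add_mul, this]; linarith
  clear_value κ S K
  intro ς σ s γ m β₀ y a hς hσ hσ1 hs0 hsσ hy hyρ ha ha0 hm hγ0 hγ hflat hthin t ht0 hts
  have hς1 : |ς| = 1 := by rcases hς with h | h <;> rw [h] <;> simp
  have hς2 : ς * ς = 1 := by rcases hς with h | h <;> rw [h] <;> norm_num
  set q := 16 * σ / s with hq
  have hq0 : 0 < q := by positivity
  have hqs : q * s = 16 * σ := div_mul_cancel₀ _ hs0.ne'
  set T := s / (4 * K) with hT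
  have hT0 : 0 < T := by positivity
  have hTK : T * (4 * K) = s := div_mul_cancel₀ _ (by positivity)
  have hT8 : T ≤ s / 8 := by
    rw [hT]; exact div_le_div_of_nonneg_left hs0.le (by norm_num) (by linarith)
  obtain ⟨hth1, ε, hε, hth2⟩ := hthin q hq0
  set b := a + (m - ς * (16 * K) * σ) • eLast n with hb
  set β := β₀ + ς * γ with hβ
  have hval : ∀ x, ς * (barrier β b y (ς * q) K x - u x) =
      ς * (β₀ + ⟪a, x - y⟫_ℝ + m * x (Fin.last n) - u x) + γ - 16 * K * σ * x (Fin.last n) +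
        q * ((K - 1) * x (Fin.last n) ^ 2 - ‖tang (x - y)‖ ^ 2) := by
    intro x
    rw [hb, barrier_eq hy, hβ]
    linear_combination (γ - 16 * K * σ * x (Fin.last n) +
        q * ((K - 1) * x (Fin.last n) ^ 2 - ‖tang (x - y)‖ ^ 2)) * hς2
  have hvalthin : ∀ x, x (Fin.last n) = 0 → ς * (barrier β b y (ς * q) K x - u x) =
      ς * (β₀ + ⟪a, x - y⟫_ℝ - ς * q * ‖x - y‖ ^ 2 - u x) + γ := by
    intro x hx
    rw [hval x, norm_sub_sq_of_thin hy, hx]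
    linear_combination (q * ‖tang (x - y)‖ ^ 2) * hς2
  have hcyl_thin : ∀ x ∈ cyl y (s / 2) T, x (Fin.last n) = 0 → x ∈ ball y (s / 2) := by
    intro x hx hx0
    have h1 := norm_le_tang_add (x - y)
    rw [sub_last_of_thin hy, hx0, abs_zero, add_zero] at h1
    rw [mem_ball, dist_eq_norm]
    exact h1.trans_lt hx.1
  have hnear : ∀ x, ‖tang (x - y)‖ ≤ s / 2 → |x (Fin.last n)| ≤ T → x ∈ ball y s := by
    intro x h1 h2
    have h3 := norm_le_tang_add (x - y)
    rw [sub_last_of_thin hy] at h3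
    rw [mem_ball, dist_eq_norm]
    linarith
  have hgrad : ∀ x ∈ cyl y (s / 2) T, ‖barrierGrad b y (ς * q) K x - (a + m • eLast n)‖ ≤ κ * σ := by
    intro x hx
    have h1 := norm_barrierGrad_sub_base_le (a := a) (m := m) (m' := m - ς * (16 * K) * σ)
      (Q := ς * q) hK1.le hy x
    have h2 : ‖x - y‖ ≤ s := by
      have := hnear x hx.1.le hx.2.le
      rw [mem_ball, dist_eq_norm] at this
      exact this.le
    have h3 : |m - ς * (16 * K) * σ - m| = 16 * K * σ := by
      rw [sub_sub_cancel_left, abs_neg, abs_mul, abs_mul, hς1, abs_of_pos hσ,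
        abs_of_pos (by positivity)]
      ring
    rw [h3, abs_mul, hς1, one_mul, abs_of_pos hq0] at h1
    have h4 : 2 * q * (K + 1) * ‖x - y‖ ≤ 2 * q * (K + 1) * s := by gcongr
    have h5 : 2 * q * (K + 1) * s = 32 * (K + 1) * σ := by linear_combination (2 * (K + 1)) * hqs
    have h6 : 64 * (K + 1) * σ ≤ κ * σ := by gcongr
    have h7 : 0 < K * σ := by positivity
    linarith
  have hcomp := hs.comparison (β := β) (b := b) (y := y) (q := q) (K := K) (K₀ := K₀)
    (r := ‖y‖ + (s / 2 + T)) (D := cyl y (s / 2) T) hς hq0 hK1 hK₀ (by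
      have h1 : S ≤ 2 * q * lam := by
        have h2 : κ ≤ σ / s := by rw [le_div_iff₀ hs0]; exact hsσ
        have h3 : q = 16 * (σ / s) := by rw [hq]; ring
        have h4 : κ * lam ≤ σ / s * lam := by gcongr
        have h5 : 0 ≤ σ / s * lam := by positivity
        rw [h3]; linarith
      have h2 := barK_large (n := n) (Lam := Lam) hlam h1
      rw [← hKd] at h2
      linarith) (isOpen_cyl _ _ _) (cyl_subset_ball hy le_rfl)
    (by linarith) (fun x hx => by
      have h1 := norm_add_le (barrierGrad b y (ς * q) K x - (a + m • eLast n)) (a + m • eLast n)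
      rw [sub_add_cancel] at h1
      linarith [hgrad x hx, norm_add_smul_eLast_le ha hm, hs.M_ge])
    (fun x hx hx0 => by
      obtain ⟨h1, h2, h3⟩ := frontier_cyl hx hx0
      have h4 := hflat x (hnear x h1 (by rwa [abs_of_nonneg hx0])) hx0
      have h5 : ς * (β₀ + ⟪a, x - y⟫_ℝ + m * x (Fin.last n) - u x) ≤ σ * s := by
        refine (le_abs_self _).trans ?_
        rw [abs_mul, hς1, one_mul]
        refine le_of_eq_of_le ?_ h4
        rw [← abs_neg]
        congr 1
        ring
      rw [hval]
      set z := x (Fin.last n)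
      have hz2 : (K - 1) * z ^ 2 ≤ s ^ 2 / 8 := by
        have h6 : z ^ 2 ≤ T ^ 2 := by gcongr
        have h7 : (K - 1) * z ^ 2 ≤ K * T ^ 2 := by
          refine mul_le_mul (by linarith) h6 (sq_nonneg _) (by linarith)
        have h8 : K * T ^ 2 = s * T / 4 := by rw [← hTK]; ring
        have h9 : s * T ≤ s * (s / 8) := by gcongr
        have h10 : 0 ≤ s ^ 2 := sq_nonneg s
        linarith
      have hq2 : q * s ^ 2 = 16 * σ * s := by rw [sq, ← mul_assoc, hqs]
      rcases h3 with h3 | h3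
      · rw [h3]
        have h6 : q * ((K - 1) * z ^ 2 - (s / 2) ^ 2) ≤ q * (- (s ^ 2 / 8)) := by
          gcongr; linarith
        have h7 : 0 ≤ 16 * K * σ * z := by positivity
        linarith
      · have h6 : q * ((K - 1) * z ^ 2 - ‖tang (x - y)‖ ^ 2) ≤ q * (s ^ 2 / 8) := by
          gcongr; linarith [sq_nonneg ‖tang (x - y)‖]
        have h7 : 16 * K * σ * z = 4 * σ * s := by rw [h3, ← hTK]; ring
        linarith)
    (fun x hx hx0 hpos => by
      rw [hvalthin x hx0] at hpos
      exact hth1 x (hcyl_thin x hx hx0) hx0 hpos _ (hgrad x hx))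
    ⟨ε, hε, fun x hx hx0 hpos => by
      rw [hvalthin x hx0] at hpos
      have h1 := hth2 x (hcyl_thin x hx hx0) hx0 hpos
      have h2 : barrier β b y (ς * q) K x =
          β₀ + ς * γ + ⟪a, x - y⟫_ℝ - ς * q * ‖x - y‖ ^ 2 := by
        rw [hb, barrier_eq hy, hβ, norm_sub_sq_of_thin hy, hx0]; ring
      rwa [h2]⟩
    (x := y + t • eLast n) ⟨by rw [add_sub_cancel_left, tang_smul_eLast, norm_zero]; positivity, by
      rw [add_smul_eLast_last hy, abs_of_nonneg ht0, hT, lt_div_iff₀ (by positivity)]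
      have : t * (4 * K) ≤ κ * t := by rw [mul_comm]; gcongr; linarith
      linarith⟩ (by rwa [add_smul_eLast_last hy])
  rw [hval, add_smul_eLast_last hy, add_sub_cancel_left, tang_smul_eLast, norm_zero,
    real_inner_smul_right, inner_eLast] at hcomp
  have h1 : (ς * κ * σ) * t * ς = κ * (σ * t) := by linear_combination (κ * σ * t) * hς2
  have h2 : 16 * K * (σ * t) ≤ κ * (σ * t) := by gcongr; linarith
  have h3 : 0 ≤ q * (K - 1) * t ^ 2 := by
    have : 0 < K - 1 := by linarith
    positivity
  rw [ha0] at hcomp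
  linarith

end BarrierBounds

section Strip

variable {F : Eucl n → ℝ → Eucl n → Eucl n} {F₀ : Eucl n → ℝ → Eucl n → ℝ} {u : Eucl n → ℝ}
  {L : ℝ≥0} {ρ lam Lam M : ℝ}

set_option maxHeartbeats 2000000 in
lemma Sol.strip_one_sided (hs : Sol F F₀ u L ρ lam Lam M) : ∃ κ : ℝ, 1 ≤ κ ∧
    ∀ ς ε s : ℝ, ∀ y a : Eucl n, (ς = 1 ∨ ς = -1) → 0 < ε → κ * ε ≤ 1 → 0 < s → κ * s ≤ ε →
    y (Fin.last n) = 0 → ‖y‖ + κ * s < ρ → ‖a‖ ≤ L → a (Fin.last n) = 0 →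
    TanFlat u a ε y (κ * s) → ∀ x ∈ ball y s, 0 ≤ x (Fin.last n) →
      ς * (u y + ⟪a, x - y⟫_ℝ + chord u y s * x (Fin.last n) - u x) ≤ κ * ε * s := by
  obtain ⟨K₀, hK₀0, hK₀⟩ := hs.exists_lower_order_bound
  have hlam := hs.lam_pos
  have hLam := hs.Lam_pos
  have hL : (0 : ℝ) ≤ L := L.coe_nonneg
  set K := barK n lam Lam with hKd
  have hK2 : 2 ≤ K := barK_ge hlam hLam
  have hK1 : 1 < K := by linarith
  set S := Lam * (1 + L) * (n + 1) + K₀ with hS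
  have hS0 : 0 ≤ S := by positivity
  have hSl : 0 ≤ 4 * (K + 1) * (S / lam) := by positivity
  refine ⟨64 * (K + 1) + 4 * (K + 1) * (S / lam), by linarith, ?_⟩
  set κ := 64 * (K + 1) + 4 * (K + 1) * (S / lam) with hκ
  have hκ1 : 64 * (K + 1) ≤ κ := by linarith
  have hκ2 : 4 * (K + 1) * S ≤ κ * lam := by
    have : S / lam * lam = S := div_mul_cancel₀ _ hlam.ne'
    have h2 : 0 ≤ 64 * (K + 1) * lam := by positivity
    rw [hκ, add_mul, mul_assoc (4 * (K + 1)), this]; linarith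
  clear_value κ S K
  intro ς ε s y a hς hε hε1 hs0 hsε hy hyρ ha ha0 hflat
  have hς1 : |ς| = 1 := by rcases hς with h | h <;> rw [h] <;> simp
  have hς2 : ς * ς = 1 := by rcases hς with h | h <;> rw [h] <;> norm_num
  set m := chord u y s with hm
  have hmL : |m| ≤ L := abs_chord_le hs.lip y hs0
  set ρ₁ := 16 * (K + 1) * s with hρ₁
  have hρ₁0 : 0 < ρ₁ := by positivity
  have hsρ : s ≤ ρ₁ := by
    have : 0 ≤ (16 * K + 15) * s := by positivity
    rw [hρ₁]; linarith
  have hκs : 2 * ρ₁ < κ * s := by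
    have h1 : 64 * (K + 1) * s ≤ κ * s := by gcongr
    rw [hρ₁]
    have : 0 < (K + 1) * s := by positivity
    linarith
  set G : Eucl n → ℝ := fun x => ς * (u y + ⟪a, x - y⟫_ℝ + m * x (Fin.last n) - u x) with hG
  have hGy : ∀ t, G (y + t • eLast n) = ς * (u y + m * t - u (y + t • eLast n)) := by
    intro t
    simp only [hG]
    rw [add_smul_eLast_last hy, add_sub_cancel_left, real_inner_smul_right, inner_eLast, ha0,
      mul_zero, add_zero]
  have hmem : ∀ v : Eucl n, ∀ t, ‖v‖ ≤ ρ₁ → 0 ≤ t → t ≤ s →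
      y + t • eLast n + v ∈ ball y (κ * s) := by
    intro v t hv ht0 hts
    rw [mem_ball, dist_eq_norm, add_assoc, add_sub_cancel_left]
    refine (norm_add_le _ _).trans_lt ?_
    rw [norm_smul, norm_eLast, mul_one, Real.norm_of_nonneg ht0]
    linarith
  have hGx : ∀ x : Eucl n, ‖tang (x - y)‖ ≤ ρ₁ → 0 ≤ x (Fin.last n) → x (Fin.last n) ≤ s →
      G x ≤ G (y + x (Fin.last n) • eLast n) + ε * ‖tang (x - y)‖ := by
    intro x hx hx0 hxs
    have h0 := hmem 0 _ (by rw [norm_zero]; exact hρ₁0.le) hx0 hxs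
    rw [add_zero] at h0
    have h1 := hflat _ h0 (by rwa [add_smul_eLast_last hy]) (tang (x - y)) (tang_last _)
      (hmem _ _ hx hx0 hxs)
    rw [base_add_tang hy] at h1
    have h2 : G x - G (y + x (Fin.last n) • eLast n) =
        -ς * (u x - u (y + x (Fin.last n) • eLast n) - ⟪a, tang (x - y)⟫_ℝ) := by
      rw [hGy, ← inner_of_last_eq_zero ha0]; simp only [hG]; ring
    have h3 := le_abs_self (G x - G (y + x (Fin.last n) • eLast n))
    rw [h2, abs_mul, abs_neg, hς1, one_mul, ← h2] at h3
    linarith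
  have hGc : Continuous fun t : ℝ => G (y + t • eLast n) := by
    simp only [hGy]
    have := hs.lip.continuous
    fun_prop
  obtain ⟨t₁, ⟨ht0, hts⟩, htmax⟩ := isCompact_Icc.exists_isMaxOn (Set.nonempty_Icc.2 hs0.le)
    hGc.continuousOn
  set D := G (y + t₁ • eLast n) with hD
  have hDmax : ∀ t, 0 ≤ t → t ≤ s → G (y + t • eLast n) ≤ D := fun t h0 h1 => htmax ⟨h0, h1⟩
  have hG0 : G (y + (0 : ℝ) • eLast n) = 0 := by
    rw [hGy, zero_smul, add_zero, mul_zero, add_zero, sub_self, mul_zero]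
  have hGs : G (y + s • eLast n) = 0 := by
    rw [hGy, hm, chord_mul hs0]; ring
  have hD0 : 0 ≤ D := hG0 ▸ hDmax 0 le_rfl hs0.le
  have hDL : D ≤ 2 * L * s := by
    rw [hD, hGy]
    refine (le_abs_self _).trans ?_
    rw [abs_mul, hς1, one_mul]
    have h1 := abs_diff_le hs.lip y (t₁ • eLast n)
    rw [norm_smul, norm_eLast, mul_one, Real.norm_of_nonneg ht0] at h1
    have h2 : |m * t₁| ≤ L * t₁ := by rw [abs_mul, abs_of_nonneg ht0]; gcongr
    have h3 : u y + m * t₁ - u (y + t₁ • eLast n) = m * t₁ - (u (y + t₁ • eLast n) - u y) := by ring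
    rw [h3]
    refine (abs_sub _ _).trans ?_
    have h4 : L * t₁ ≤ L * s := by gcongr
    linarith
  set q := (D + 2 * ε * ρ₁) / ρ₁ ^ 2 with hq
  have hq0 : 0 < q := by positivity
  have hqρ : q * ρ₁ ^ 2 = D + 2 * ε * ρ₁ := div_mul_cancel₀ _ (by positivity)
  set γ := ε * ρ₁ + q * (K - 1) * s ^ 2 with hγ
  have hqK : 0 ≤ q * (K - 1) := mul_nonneg hq0.le (by linarith)
  have hval : ∀ x, ς * (barrier (u y - ς * γ) (a + m • eLast n) y (ς * q) K x - u x) =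
      G x - γ + q * (K - 1) * x (Fin.last n) ^ 2 - q * ‖tang (x - y)‖ ^ 2 := by
    intro x
    rw [barrier_eq hy]
    simp only [hG]
    linear_combination (-γ + q * (K - 1) * x (Fin.last n) ^ 2 - q * ‖tang (x - y)‖ ^ 2) * hς2
  have hz : ∀ z : ℝ, 0 ≤ z → z ≤ s → q * (K - 1) * z ^ 2 ≤ q * (K - 1) * s ^ 2 := by
    intro z h0 h1; gcongr
  have hthin : ∀ x ∈ cyl y ρ₁ s, x (Fin.last n) = 0 →
      ¬ 0 < ς * (barrier (u y - ς * γ) (a + m • eLast n) y (ς * q) K x - u x) := by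
    intro x hx hx0
    have h1 := hGx x hx.1.le hx0.ge (by rw [hx0]; exact hs0.le)
    rw [hx0, hG0] at h1
    rw [hval, hx0, not_lt]
    have h2 : ε * ‖tang (x - y)‖ ≤ ε * ρ₁ := mul_le_mul_of_nonneg_left hx.1.le hε.le
    have h3 : 0 ≤ q * (K - 1) * s ^ 2 := by positivity
    have h4 : 0 ≤ q * ‖tang (x - y)‖ ^ 2 := by positivity
    linarith
  have hcomp : ∀ t, 0 ≤ t → t < s → G (y + t • eLast n) ≤ γ := by
    intro t ht0 hts
    have h0 := hs.comparison (β := u y - ς * γ) (b := a + m • eLast n) (y := y) (q := q) (K := K)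
      (K₀ := K₀) (r := ‖y‖ + (ρ₁ + s)) (D := cyl y ρ₁ s) hς hq0 hK1 hK₀ (by
        have h1 : S ≤ 2 * q * lam := by
          have h2 : 2 * ε ≤ q * ρ₁ := by
            refine le_of_mul_le_mul_right ?_ hρ₁0
            rw [mul_assoc q, ← sq, hqρ]; linarith
          have h3 : 2 * κ ≤ q * (16 * (K + 1)) := by
            refine le_of_mul_le_mul_right ?_ hs0
            rw [hρ₁] at h2; linarith
          have h4 := mul_le_mul_of_nonneg_right h3 hlam.le
          refine le_of_mul_le_mul_left ?_ (by positivity : 0 < 8 * (K + 1))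
          linarith
        have h2 := barK_large (n := n) (Lam := Lam) hlam h1
        rw [← hKd] at h2
        linarith) (isOpen_cyl _ _ _) (cyl_subset_ball hy le_rfl) (by linarith)
      (fun x hx => by
        have h1 := norm_barrierGrad_sub_base_le (a := a) (m := m) (m' := m) (Q := ς * q) hK1.le hy x
        rw [sub_self, abs_zero, zero_add, abs_mul, hς1, one_mul, abs_of_pos hq0] at h1
        have h2 := norm_le_tang_add (x - y)
        rw [sub_last_of_thin hy] at h2
        have h3 : ‖x - y‖ ≤ 2 * ρ₁ := by linarith [hx.1, hx.2]
        have h4 : 2 * q * (K + 1) * ‖x - y‖ ≤ 2 * q * (K + 1) * (2 * ρ₁) := by gcongr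
        have h5 : q * ρ₁ * (16 * (K + 1)) ≤ 2 * L + 2 * ε * (16 * (K + 1)) := by
          refine le_of_mul_le_mul_right ?_ hs0
          have e1 : q * ρ₁ * (16 * (K + 1)) * s = q * ρ₁ ^ 2 := by rw [hρ₁]; ring
          have e2 : 2 * ε * (16 * (K + 1)) * s = 2 * ε * ρ₁ := by rw [hρ₁]; ring
          rw [e1, hqρ, add_mul, e2]; linarith
        have h6 : 64 * (K + 1) * ε ≤ κ * ε := by gcongr
        have h7 := norm_add_le (barrierGrad (a + m • eLast n) y (ς * q) K x - (a + m • eLast n))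
          (a + m • eLast n)
        rw [sub_add_cancel] at h7
        linarith [norm_add_smul_eLast_le ha hmL, hs.M_ge])
      (fun x hx hx0 => by
        obtain ⟨h1, h2, h3⟩ := frontier_cyl hx hx0
        have h4 := hGx x h1 hx0 h2
        have h5 := hz _ hx0 h2
        rw [hval]
        rcases h3 with h3 | h3
        · have h6 := hDmax _ hx0 h2
          rw [h3] at h4 ⊢
          rw [hqρ]
          have : 0 < ε * ρ₁ := by positivity
          linarith
        · rw [h3, hGs] at h4
          have h6 : 0 ≤ q * ‖tang (x - y)‖ ^ 2 := by positivity
          have h7 : ε * ‖tang (x - y)‖ ≤ ε * ρ₁ := by gcongr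
          linarith)
      (fun x hx hx0 hpos => absurd hpos (hthin x hx hx0))
      ⟨1, one_pos, fun x hx hx0 hpos => absurd hpos (hthin x hx hx0)⟩
      (x := y + t • eLast n) ⟨by rwa [add_sub_cancel_left, tang_smul_eLast, norm_zero], by
        rwa [add_smul_eLast_last hy, abs_of_nonneg ht0]⟩ (by rwa [add_smul_eLast_last hy])
    rw [hval, add_smul_eLast_last hy, add_sub_cancel_left, tang_smul_eLast, norm_zero] at h0
    have h1 : 0 ≤ q * (K - 1) * t ^ 2 := by positivity
    linarith
  have hDle : D ≤ 2 * (ε * ρ₁) := by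
    rcases hts.lt_or_eq with h | h
    · have h1 := hcomp t₁ ht0 h
      have h2 : q * (K - 1) * s ^ 2 ≤ (D + 2 * ε * ρ₁) / 4 := by
        rw [← hqρ]
        have h3 : 4 * ((K - 1) * s ^ 2) ≤ ρ₁ ^ 2 := by
          have e1 : ρ₁ ^ 2 = (256 * (K + 1) ^ 2) * s ^ 2 := by rw [hρ₁]; ring
          rw [e1, ← mul_assoc]
          refine mul_le_mul_of_nonneg_right ?_ (sq_nonneg s)
          linarith [sq_nonneg K]
        have h4 := mul_le_mul_of_nonneg_left h3 hq0.le
        linarith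
      have h5 : D ≤ ε * ρ₁ + q * (K - 1) * s ^ 2 := h1
      linarith
    · have h1 : D = 0 := by rw [hD, h, hGs]
      rw [h1]; positivity
  intro x hx hx0
  rw [mem_ball, dist_eq_norm] at hx
  have h1 := norm_tang_le (x - y)
  have h2 : x (Fin.last n) ≤ s := by
    have := abs_last_le (x - y)
    rw [sub_last_of_thin hy] at this
    exact (le_abs_self _).trans (this.trans hx.le)
  have h3 := hGx x (by linarith) hx0 h2
  have h4 := hDmax _ hx0 h2
  have h5 : ε * ‖tang (x - y)‖ ≤ ε * s := by gcongr; linarith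
  have h6 : 64 * (K + 1) * (ε * s) ≤ κ * (ε * s) := by gcongr
  have h7 : 2 * (ε * ρ₁) = 32 * (K + 1) * (ε * s) := by rw [hρ₁]; ring
  have h8 : 0 < (32 * K + 31) * (ε * s) := by positivity
  show G x ≤ _
  linarith

/-- Tangential flatness implies one-dimensional affine approximation in the normal direction. -/
lemma Sol.strip (hs : Sol F F₀ u L ρ lam Lam M) : ∃ κ : ℝ, 1 ≤ κ ∧
    ∀ ε s : ℝ, ∀ y a : Eucl n, 0 < ε → κ * ε ≤ 1 → 0 < s → κ * s ≤ ε →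
    y (Fin.last n) = 0 → ‖y‖ + κ * s < ρ → ‖a‖ ≤ L → a (Fin.last n) = 0 →
    TanFlat u a ε y (κ * s) → ∀ x ∈ ball y s, 0 ≤ x (Fin.last n) →
      |u x - u y - ⟪a, x - y⟫_ℝ - chord u y s * x (Fin.last n)| ≤ κ * ε * s := by
  obtain ⟨κ, hκ, h⟩ := hs.strip_one_sided
  refine ⟨κ, hκ, fun ε s y a hε hε1 hs0 hsε hy hyρ ha ha0 hflat x hx hx0 => ?_⟩
  have h1 := h 1 ε s y a (Or.inl rfl) hε hε1 hs0 hsε hy hyρ ha ha0 hflat x hx hx0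
  have h2 := h (-1) ε s y a (Or.inr rfl) hε hε1 hs0 hsε hy hyρ ha ha0 hflat x hx hx0
  rw [abs_le]
  constructor <;> linarith

end Strip

section BoundaryEstimates

variable {F : Eucl n → ℝ → Eucl n → Eucl n} {F₀ : Eucl n → ℝ → Eucl n → ℝ} {u : Eucl n → ℝ}
  {L : ℝ≥0} {ρ lam Lam M : ℝ}

lemma Sol.flux_last_close (hs : Sol F F₀ u L ρ lam Lam M) (x y p q : Eucl n) :
    |F x (u x) p (Fin.last n) - F y (u y) q (Fin.last n)| ≤
      Lam * ((1 + L) * dist x y + ‖p - q‖) := by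
  have h1 := abs_last_le (F x (u x) p - F y (u y) q)
  have h2 := hs.lipF x y (u x) (u y) p q
  have h3 : |u x - u y| ≤ L * dist x y := by
    rw [← Real.dist_eq]; exact hs.lip.dist_le_mul x y
  refine h1.trans (h2.trans (mul_le_mul_of_nonneg_left ?_ hs.Lam_pos.le))
  linarith

lemma Sol.flux_last_mono (hs : Sol F F₀ u L ρ lam Lam M) {x a : Eucl n} (hx : x ∈ ball 0 ρ)
    (ha : ‖a‖ ≤ L) {m m' : ℝ} (hm : |m| ≤ L) (hm' : |m'| ≤ L) {c : ℝ} (hc : 0 ≤ c)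
    (h : F x (u x) (a + m' • eLast n) (Fin.last n) - F x (u x) (a + m • eLast n) (Fin.last n) ≤ c) :
    m' - m ≤ c / lam := by
  rcases le_or_gt m' m with hmm | hmm
  · have : 0 ≤ c / lam := div_nonneg hc hs.lam_pos.le
    linarith
  have hL : (0 : ℝ) ≤ L := L.coe_nonneg
  have hM : ∀ k : ℝ, |k| ≤ L → ‖a + k • eLast n‖ ≤ M := by
    intro k hk
    refine (norm_add_le _ _).trans ?_
    rw [norm_smul, norm_eLast, mul_one, Real.norm_eq_abs]
    linarith [hs.M_ge]
  have h1 := hs.mono x hx (u x) (hs.bdd x hx) _ _ (hM m' hm') (hM m hm)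
  have h2 : a + m' • eLast n - (a + m • eLast n) = (m' - m) • eLast n := by module
  rw [h2, real_inner_smul_right, inner_eLast, norm_smul, norm_eLast, mul_one, Real.norm_eq_abs,
    sq_abs, sq, ← mul_assoc, mul_comm _ (m' - m)] at h1
  have h3 := le_of_mul_le_mul_left (a := m' - m) (by linarith) (by linarith : (0 : ℝ) < m' - m)
    (b := lam * (m' - m))
    (c := (F x (u x) (a + m' • eLast n) - F x (u x) (a + m • eLast n)) (Fin.last n))
  rw [le_div_iff₀ hs.lam_pos]
  have h4 : (F x (u x) (a + m' • eLast n) - F x (u x) (a + m • eLast n)) (Fin.last n) =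
    F x (u x) (a + m' • eLast n) (Fin.last n) - F x (u x) (a + m • eLast n) (Fin.last n) := rfl
  linarith

lemma exists_mul_add_nonneg (hu : Continuous u) {y : Eucl n} {s : ℝ}
    (hpos : ∀ x ∈ closedBall y s, x (Fin.last n) = 0 → 0 < u x) {f : Eucl n → ℝ}
    (hf : Continuous f) :
    ∃ ε : ℝ, 0 < ε ∧ ∀ x ∈ closedBall y s, x (Fin.last n) = 0 → 0 ≤ u x + ε * f x := by
  have hK : IsCompact (closedBall y s ∩ {x : Eucl n | x (Fin.last n) = 0}) :=
    (isCompact_closedBall y s).inter_right (isClosed_eq continuous_last continuous_const)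
  rcases (closedBall y s ∩ {x : Eucl n | x (Fin.last n) = 0}).eq_empty_or_nonempty with h | h
  · exact ⟨1, one_pos, fun x hx hx0 => (h.subset ⟨hx, hx0⟩).elim⟩
  obtain ⟨x₁, hx₁, hmin⟩ := hK.exists_isMinOn h hu.continuousOn
  obtain ⟨B, hB⟩ := hK.exists_bound_of_continuousOn hf.continuousOn
  have hc : 0 < u x₁ := hpos x₁ hx₁.1 hx₁.2
  have hB0 : 0 ≤ B := (norm_nonneg _).trans (hB x₁ hx₁)
  refine ⟨u x₁ / (B + 1), by positivity, fun x hx hx0 => ?_⟩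
  have h1 : u x₁ ≤ u x := hmin ⟨hx, hx0⟩
  have h2 := hB x ⟨hx, hx0⟩
  rw [Real.norm_eq_abs] at h2
  have h3 : u x₁ / (B + 1) * -(B + 1) ≤ u x₁ / (B + 1) * f x := by
    refine mul_le_mul_of_nonneg_left ?_ (by positivity)
    linarith [neg_abs_le (f x)]
  have h4 : u x₁ / (B + 1) * (B + 1) = u x₁ := div_mul_cancel₀ _ (by positivity)
  linarith

/-- Consequences of flatness near a boundary point: bounds for the normal flux, and comparison with
linear functions. -/
lemma Sol.boundary_estimates (hs : Sol F F₀ u L ρ lam Lam M) : ∃ κ : ℝ, 1 ≤ κ ∧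
    ∀ σ s m β₀ : ℝ, ∀ y a : Eucl n, 0 < σ → κ * σ ≤ 1 → 0 < s → κ * s ≤ σ →
    y (Fin.last n) = 0 → ‖y‖ + s < ρ → ‖a‖ ≤ L → a (Fin.last n) = 0 → |m| ≤ L →
    (∀ x ∈ ball y s, 0 ≤ x (Fin.last n) →
      |u x - β₀ - ⟪a, x - y⟫_ℝ - m * x (Fin.last n)| ≤ σ * s) →
    (β₀ = u y → F y (u y) (a + m • eLast n) (Fin.last n) ≤ κ * σ) ∧
    (β₀ = u y → (∀ x ∈ closedBall y (s / 2), x (Fin.last n) = 0 → 0 < u x) →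
      -(κ * σ) ≤ F y (u y) (a + m • eLast n) (Fin.last n)) ∧
    (a = 0 → β₀ = 0 → ∀ t, 0 ≤ t → κ * t < s → (m - κ * σ) * t ≤ u (y + t • eLast n)) ∧
    (a = 0 → β₀ = 0 → F y (u y) (a + m • eLast n) (Fin.last n) ≤ -(κ * σ) →
      ∀ t, 0 ≤ t → κ * t < s → u (y + t • eLast n) ≤ (m + κ * σ) * t) := by
  obtain ⟨κ, hκ, h⟩ := hs.barrier_bound
  have hLam := hs.Lam_pos
  have hL : (0 : ℝ) ≤ L := L.coe_nonneg
  set κ' := κ + Lam * ((1 + L) + κ) with hκ'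
  have hκκ : κ ≤ κ' := by
    have : 0 ≤ Lam * ((1 + L) + κ) := by positivity
    linarith
  refine ⟨κ', hκ.trans hκκ, fun σ s m β₀ y a hσ hσ1 hs0 hsσ hy hyρ ha ha0 hm hflat => ?_⟩
  have hσ1' : κ * σ ≤ 1 := (mul_le_mul_of_nonneg_right hκκ hσ.le).trans hσ1
  have hsσ' : κ * s ≤ σ := (mul_le_mul_of_nonneg_right hκκ hs0.le).trans hsσ
  have hs1 : s ≤ σ := (le_mul_of_one_le_left hs0.le hκ).trans hsσ'
  have hclose : ∀ x ∈ ball y (s / 2), ∀ p, ‖p - (a + m • eLast n)‖ ≤ κ * σ →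
      |F x (u x) p (Fin.last n) - F y (u y) (a + m • eLast n) (Fin.last n)| ≤ κ' * σ := by
    intro x hx p hp
    refine (hs.flux_last_close x y p (a + m • eLast n)).trans ?_
    have h1 : dist x y ≤ σ := by linarith [mem_ball.1 hx]
    have h2 : Lam * ((1 + L) * dist x y + ‖p - (a + m • eLast n)‖) ≤
        Lam * ((1 + L) * σ + κ * σ) := by gcongr
    have h3 : 0 ≤ κ * σ := by positivity
    rw [hκ']
    linarith
  have hbound := fun ς γ => h ς σ s γ m β₀ y a
  have huc := hs.lip.continuous
  have hthin : ∀ x ∈ ball y (s / 2), x (Fin.last n) = 0 → 0 ≤ u x := fun x hx hx0 => by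
    refine hs.nonneg x ?_ hx0
    rw [mem_ball_zero_iff]
    have h1 := norm_add_le y (x - y)
    have h2 : ‖x - y‖ < s / 2 := by rw [← dist_eq_norm]; exact hx
    rw [add_sub_cancel] at h1
    linarith
  refine ⟨fun hβ => ?_, fun hβ hpos => ?_, fun ha' hβ t ht hts => ?_, fun ha' hβ hneg t ht hts => ?_⟩
  · by_contra! hcon
    have h1 := hbound 1 (σ * s) (Or.inl rfl) hσ hσ1' hs0 hsσ' hy hyρ ha ha0 hm (by positivity) le_rfl
      hflat (fun q hq => ⟨fun x hx _ _ p hp => by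
        have := abs_le.1 (hclose x hx p hp)
        linarith [this.1], 1, one_pos, fun x hx hx0 hlt => by linarith [hthin x hx hx0]⟩) 0 le_rfl
      (by rwa [mul_zero])
    rw [zero_smul, add_zero, hβ] at h1
    have : 0 < σ * s := by positivity
    linarith
  · by_contra! hcon
    have h1 := hbound (-1) (σ * s) (Or.inr rfl) hσ hσ1' hs0 hsσ' hy hyρ ha ha0 hm (by positivity)
      le_rfl hflat (fun q hq => ⟨fun x hx _ _ p hp => by
        have := abs_le.1 (hclose x hx p hp)
        linarith [this.2], by
        obtain ⟨ε, hε, hε'⟩ := exists_mul_add_nonneg huc hpos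
          (f := fun x => β₀ + -1 * (σ * s) + ⟪a, x - y⟫_ℝ - -1 * q * ‖x - y‖ ^ 2 - u x)
          (by fun_prop)
        exact ⟨ε, hε, fun x hx hx0 _ => hε' x (ball_subset_closedBall hx) hx0⟩⟩) 0 le_rfl
      (by rwa [mul_zero])
    rw [zero_smul, add_zero, hβ] at h1
    have : 0 < σ * s := by positivity
    linarith
  · have h1 := hbound 1 0 (Or.inl rfl) hσ hσ1' hs0 hsσ' hy hyρ ha ha0 hm le_rfl (by positivity)
      hflat (fun q hq => by
        have hno : ∀ x ∈ ball y (s / 2), x (Fin.last n) = 0 →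
            ¬ 0 < 1 * (β₀ + ⟪a, x - y⟫_ℝ - 1 * q * ‖x - y‖ ^ 2 - u x) + 0 := by
          intro x hx hx0
          rw [ha', hβ, inner_zero_left]
          have : 0 ≤ q * ‖x - y‖ ^ 2 := by positivity
          linarith [hthin x hx hx0]
        exact ⟨fun x hx hx0 hlt => absurd hlt (hno x hx hx0), 1, one_pos,
          fun x hx hx0 hlt => absurd hlt (hno x hx hx0)⟩) t ht
      ((mul_le_mul_of_nonneg_right hκκ ht).trans_lt hts)
    rw [hβ] at h1
    have h2 : κ * (σ * t) ≤ κ' * (σ * t) := by gcongr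
    linarith
  · have h1 := hbound (-1) 0 (Or.inr rfl) hσ hσ1' hs0 hsσ' hy hyρ ha ha0 hm le_rfl (by positivity)
      hflat (fun q hq => ⟨fun x hx _ _ p hp => by
        have := abs_le.1 (hclose x hx p hp)
        linarith [this.2], 1, one_pos, fun x hx hx0 _ => by
          rw [ha', hβ, inner_zero_left]
          have : 0 ≤ q * ‖x - y‖ ^ 2 := by positivity
          linarith⟩) t ht
      ((mul_le_mul_of_nonneg_right hκκ ht).trans_lt hts)
    rw [hβ] at h1
    have h2 : κ * (σ * t) ≤ κ' * (σ * t) := by gcongr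
    linarith

end BoundaryEstimates

section BoundaryLimit

variable {F : Eucl n → ℝ → Eucl n → Eucl n} {F₀ : Eucl n → ℝ → Eucl n → ℝ} {u : Eucl n → ℝ}
  {L : ℝ≥0} {ρ lam Lam M : ℝ}

/-- On all small half balls centred at boundary points near `x₀`, the function `u` is within
`σ` times the radius of the affine function with tangential slope `a` and normal slope given by the
chord of `u`. -/
def ChordFlat (u : Eucl n → ℝ) (a : Eucl n) (σ : ℝ) (x₀ : Eucl n) (r : ℝ) : Prop :=
  ∀ y ∈ ball x₀ r, y (Fin.last n) = 0 → ∀ s, 0 < s → s < r → ∀ x ∈ ball y s, 0 ≤ x (Fin.last n) →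
    |u x - u y - ⟪a, x - y⟫_ℝ - chord u y s * x (Fin.last n)| ≤ σ * s

lemma norm_lt_of_mem_ball {y x₀ : Eucl n} {r : ℝ} (hy : y ∈ ball x₀ r) : ‖y‖ < ‖x₀‖ + r := by
  rw [mem_ball, dist_eq_norm] at hy
  have := norm_add_le x₀ (y - x₀)
  rw [add_sub_cancel] at this
  linarith

lemma Sol.chordFlat (hs : Sol F F₀ u L ρ lam Lam M) : ∃ κ : ℝ, 1 ≤ κ ∧
    ∀ ε r : ℝ, ∀ x₀ a : Eucl n, 0 < ε → κ * ε ≤ 1 → 0 < r → ‖x₀‖ < ρ → ‖a‖ ≤ L →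
    a (Fin.last n) = 0 → TanFlat u a ε x₀ r → ∃ r₁, 0 < r₁ ∧ ChordFlat u a (κ * ε) x₀ r₁ := by
  obtain ⟨κ, hκ, h⟩ := hs.strip
  refine ⟨κ, hκ, fun ε r x₀ a hε hε1 hr hx₀ ha ha0 hflat => ?_⟩
  set b := min (min r ε) (ρ - ‖x₀‖) with hb
  have hb0 : 0 < b := by
    rw [hb, lt_min_iff, lt_min_iff]; exact ⟨⟨hr, hε⟩, by linarith⟩
  have hbr : b ≤ r := (min_le_left _ _).trans (min_le_left _ _)
  have hbε : b ≤ ε := (min_le_left _ _).trans (min_le_right _ _)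
  have hbρ : b ≤ ρ - ‖x₀‖ := min_le_right _ _
  have hr₁ : b / (2 * κ) * (2 * κ) = b := div_mul_cancel₀ _ (by positivity)
  set r₁ := b / (2 * κ)
  have hr₁0 : 0 < r₁ := by positivity
  have hr₁κ : r₁ ≤ κ * r₁ := le_mul_of_one_le_left hr₁0.le hκ
  refine ⟨r₁, hr₁0, fun y hy hy0 s hs0 hsr => ?_⟩
  have hκs : κ * s < κ * r₁ := by gcongr
  have hyn := norm_lt_of_mem_ball hy
  refine h ε s y a hε hε1 hs0 (by linarith) hy0 (by linarith) ha ha0 (hflat.mono ?_)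
  refine ball_subset_ball' ?_
  linarith [mem_ball.1 hy]

lemma Sol.flux_chord (hs : Sol F F₀ u L ρ lam Lam M) : ∃ κ : ℝ, 1 ≤ κ ∧
    ∀ σ r : ℝ, ∀ x₀ a : Eucl n, 0 < σ → κ * σ ≤ 1 → 0 < r → ‖x₀‖ < ρ → ‖a‖ ≤ L →
    a (Fin.last n) = 0 → ChordFlat u a σ x₀ r → ∃ r₁, 0 < r₁ ∧ r₁ ≤ r ∧
      ∀ y ∈ ball x₀ r₁, y (Fin.last n) = 0 → ∀ s, 0 < s → s < r₁ →
        F x₀ (u x₀) (a + chord u y s • eLast n) (Fin.last n) ≤ κ * σ ∧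
        ((∀ x ∈ closedBall y (s / 2), x (Fin.last n) = 0 → 0 < u x) →
          -(κ * σ) ≤ F x₀ (u x₀) (a + chord u y s • eLast n) (Fin.last n)) := by
  obtain ⟨κ, hκ, h⟩ := hs.boundary_estimates
  have hLam := hs.Lam_pos
  have hL : (0 : ℝ) ≤ L := L.coe_nonneg
  refine ⟨κ + 1, by linarith, fun σ r x₀ a hσ hσ1 hr hx₀ ha ha0 hflat => ?_⟩
  set c := Lam * (1 + L) with hc
  have hc0 : 0 < c := by positivity
  set b := min (min r σ) (ρ - ‖x₀‖) with hb
  have hb0 : 0 < b := by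
    rw [hb, lt_min_iff, lt_min_iff]; exact ⟨⟨hr, hσ⟩, by linarith⟩
  have hbr : b ≤ r := (min_le_left _ _).trans (min_le_left _ _)
  have hbσ : b ≤ σ := (min_le_left _ _).trans (min_le_right _ _)
  have hbρ : b ≤ ρ - ‖x₀‖ := min_le_right _ _
  have hr₁ : b / (2 * κ + c) * (2 * κ + c) = b := div_mul_cancel₀ _ (by positivity)
  set r₁ := b / (2 * κ + c)
  have hr₁0 : 0 < r₁ := by positivity
  have hr₁κ : r₁ ≤ κ * r₁ := le_mul_of_one_le_left hr₁0.le hκ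
  have hr₁c : 0 < c * r₁ := by positivity
  refine ⟨r₁, hr₁0, by linarith, fun y hy hy0 s hs0 hsr => ?_⟩
  have hκs : κ * s < κ * r₁ := by gcongr
  have hyn := norm_lt_of_mem_ball hy
  obtain ⟨h1, h2, -⟩ := h σ s (chord u y s) (u y) y a hσ (by linarith) hs0 (by linarith) hy0
    (by linarith) ha ha0 (abs_chord_le hs.lip y hs0)
    (hflat y (ball_subset_ball (by linarith) hy) hy0 s hs0 (by linarith))
  have h3 := hs.flux_last_close y x₀ (a + chord u y s • eLast n) (a + chord u y s • eLast n)
  rw [sub_self, norm_zero, add_zero, ← mul_assoc, ← hc] at h3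
  have h4 : c * dist y x₀ ≤ c * r₁ := by gcongr; exact (mem_ball.1 hy).le
  obtain ⟨h5, h6⟩ := abs_le.1 h3
  exact ⟨by linarith [h1 rfl], fun hpos => by linarith [h2 rfl hpos]⟩

/-- Once the chords are nearly constant, `u` is nearly affine near `x₀`. -/
lemma ChordFlat.affine {a x₀ : Eucl n} {σ r m c : ℝ} (h : ChordFlat u a σ x₀ r)
    (hm : ∀ y ∈ ball x₀ r, y (Fin.last n) = 0 → ∀ s, 0 < s → s < r → |chord u y s - m| ≤ c) :
    ∀ y ∈ ball x₀ r, y (Fin.last n) = 0 → ∀ s, 0 < s → s < r → ∀ x ∈ ball y s, 0 ≤ x (Fin.last n) →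
      |u x - u y - ⟪a, x - y⟫_ℝ - m * x (Fin.last n)| ≤ (σ + c) * s := by
  intro y hy hy0 s hs0 hsr x hx hx0
  have h1 := h y hy hy0 s hs0 hsr x hx hx0
  have h2 := hm y hy hy0 s hs0 hsr
  have h3 : x (Fin.last n) ≤ s := by
    have := abs_last_le (x - y)
    rw [sub_last_of_thin hy0] at this
    rw [mem_ball, dist_eq_norm] at hx
    exact (le_abs_self _).trans (this.trans hx.le)
  have h4 : |(chord u y s - m) * x (Fin.last n)| ≤ c * s := by
    rw [abs_mul, abs_of_nonneg hx0]
    exact mul_le_mul h2 h3 hx0 ((abs_nonneg _).trans h2)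
  have h5 : u x - u y - ⟪a, x - y⟫_ℝ - m * x (Fin.last n) =
    (u x - u y - ⟪a, x - y⟫_ℝ - chord u y s * x (Fin.last n)) +
      (chord u y s - m) * x (Fin.last n) := by ring
  rw [h5, add_mul]
  exact (abs_add_le _ _).trans (add_le_add h1 h4)

lemma ChordFlat.mono {a x₀ : Eucl n} {σ r r' : ℝ} (h : ChordFlat u a σ x₀ r) (hr : r' ≤ r) :
    ChordFlat u a σ x₀ r' :=
  fun y hy hy0 s hs0 hsr => h y (ball_subset_ball hr hy) hy0 s hs0 (hsr.trans_le hr)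

lemma Sol.affine_noncontact (hs : Sol F F₀ u L ρ lam Lam M) {x₀ : Eucl n} (hx₀ : ‖x₀‖ < ρ)
    (hx₀t : x₀ (Fin.last n) = 0) (hu0 : 0 < u x₀) {η : ℝ} (hη : 0 < η) :
    ∃ r, 0 < r ∧ ∃ a : Eucl n, ∃ m : ℝ, ∀ y ∈ ball x₀ r, y (Fin.last n) = 0 → ∀ s, 0 < s → s < r →
      ∀ x ∈ ball y s, 0 ≤ x (Fin.last n) →
        |u x - u y - ⟪a, x - y⟫_ℝ - m * x (Fin.last n)| ≤ η * s := by
  obtain ⟨κ₁, hκ₁, h1⟩ := hs.chordFlat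
  obtain ⟨κ₂, hκ₂, h2⟩ := hs.flux_chord
  have hlam := hs.lam_pos
  set C := 1 + 2 * κ₂ / lam with hC
  have hC1 : 0 < 2 * κ₂ / lam := by positivity
  set b := min η 1 with hb
  have hb0 : 0 < b := lt_min hη one_pos
  have hb1 : b ≤ 1 := min_le_right _ _
  set σ := b / (κ₂ + C) with hσd
  have hσC : σ * (κ₂ + C) = b := div_mul_cancel₀ _ (by positivity)
  have hσ : 0 < σ := by positivity
  have hσ1 : 0 < C * σ := by positivity
  have hσ2 : 0 < κ₂ * σ := by positivity
  have hσκ : σ ≤ κ₂ * σ := le_mul_of_one_le_left hσ.le hκ₂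
  have hεκ : κ₁ * (σ / κ₁) = σ := mul_div_cancel₀ _ (by positivity)
  obtain ⟨r₀, a₀, hr₀, ha₀, hflat₀⟩ := hs.tanFlat_noncontact hx₀ hx₀t hu0
    (ε := σ / κ₁) (by positivity)
  have hflat : TanFlat u (tang a₀) (σ / κ₁) x₀ r₀ := by
    intro x hx hx0 v hv hxv
    have h3 := hflat₀ x hx hx0 v hv hxv
    rwa [real_inner_comm, inner_of_last_eq_zero hv, real_inner_comm] at h3
  have ha : ‖tang a₀‖ ≤ L := (norm_tang_le a₀).trans ha₀
  obtain ⟨r₁, hr₁, hcf⟩ := h1 (σ / κ₁) r₀ x₀ (tang a₀) (by positivity) (by rw [hεκ]; linarith) hr₀ hx₀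
    ha (tang_last _) hflat
  rw [hεκ] at hcf
  obtain ⟨r₂, hr₂, hr₂₁, hfl⟩ := h2 σ r₁ x₀ (tang a₀) hσ (by linarith) hr₁ hx₀ ha (tang_last _) hcf
  obtain ⟨r₃, hr₃, hpos⟩ := Metric.eventually_nhds_iff_ball.1
    (hs.lip.continuous.continuousAt.eventually (lt_mem_nhds hu0))
  set r := min r₂ (r₃ / 2)
  have hr : 0 < r := lt_min hr₂ (by positivity)
  have hrr₂ : r ≤ r₂ := min_le_left _ _
  have hrr₃ : r ≤ r₃ / 2 := min_le_right _ _
  have hflux : ∀ y ∈ ball x₀ r, y (Fin.last n) = 0 → ∀ s, 0 < s → s < r →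
      |F x₀ (u x₀) (tang a₀ + chord u y s • eLast n) (Fin.last n)| ≤ κ₂ * σ := by
    intro y hy hy0 s hs0 hsr
    obtain ⟨h3, h4⟩ := hfl y (ball_subset_ball hrr₂ hy) hy0 s hs0 (by linarith)
    refine abs_le.2 ⟨h4 fun x hx _ => hpos x ?_, h3⟩
    refine closedBall_subset_ball' ?_ hx
    linarith [mem_ball.1 hy]
  refine ⟨r, hr, tang a₀, chord u x₀ (r / 2), ?_⟩
  have h0 := hflux x₀ (mem_ball_self hr) hx₀t (r / 2) (by positivity) (by linarith)
  have hch0 := abs_chord_le hs.lip x₀ (s := r / 2) (by positivity)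
  have hx₀b : x₀ ∈ ball (0 : Eucl n) ρ := mem_ball_zero_iff.2 hx₀
  have key := (hcf.mono (hrr₂.trans hr₂₁)).affine (m := chord u x₀ (r / 2))
    (c := 2 * (κ₂ * σ) / lam) (fun y hy hy0 s hs0 hsr => by
      have h3 := hflux y hy hy0 s hs0 hsr
      have hch := abs_chord_le hs.lip y hs0
      have h5 := hs.flux_last_mono hx₀b ha hch hch0 (c := 2 * (κ₂ * σ)) (by positivity)
        (by linarith [(abs_le.1 h0).2, (abs_le.1 h3).1])
      have h6 := hs.flux_last_mono hx₀b ha hch0 hch (c := 2 * (κ₂ * σ)) (by positivity)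
        (by linarith [(abs_le.1 h0).1, (abs_le.1 h3).2])
      rw [abs_le]
      constructor <;> linarith)
  intro y hy hy0 s hs0 hsr x hx hx0
  refine (key y hy hy0 s hs0 hsr x hx hx0).trans ?_
  gcongr
  have h7 : σ + 2 * (κ₂ * σ) / lam = C * σ := by rw [hC]; ring
  linarith [min_le_left η 1]

end BoundaryLimit

section ContactLimit

variable {F : Eucl n → ℝ → Eucl n → Eucl n} {F₀ : Eucl n → ℝ → Eucl n → ℝ} {u : Eucl n → ℝ}
  {L : ℝ≥0} {ρ lam Lam M : ℝ}

lemma TanFlat.chord_lower {ε r s c : ℝ} {x₀ y y' : Eucl n} (h : TanFlat u 0 ε x₀ r) (hε : 0 ≤ ε)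
    (hs : 0 < s) (hy : y ∈ ball x₀ (r / 4)) (hsr : s < r / 4) (hy0 : y (Fin.last n) = 0)
    (hy' : y' ∈ closedBall y (s / 2)) (hy'0 : y' (Fin.last n) = 0) (hu' : u y' = 0)
    (hc : c * s ≤ u (y' + s • eLast n)) : c - ε ≤ chord u y s := by
  have hd : ‖y' - y‖ ≤ s / 2 := by rw [← dist_eq_norm]; exact hy'
  rw [mem_ball, dist_eq_norm] at hy
  have hv : (y' - y) (Fin.last n) = 0 := by
    show y' (Fin.last n) - y (Fin.last n) = 0
    rw [hy0, hy'0, sub_zero]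
  have hm : ∀ t, 0 ≤ t → t ≤ s → ∀ v : Eucl n, ‖v‖ ≤ s / 2 → y + t • eLast n + v ∈ ball x₀ r := by
    intro t ht hts v hv
    rw [mem_ball, dist_eq_norm]
    have h1 : y + t • eLast n + v - x₀ = (y - x₀) + t • eLast n + v := by abel
    have h2 := norm_add₃_le (a := y - x₀) (b := t • eLast n) (c := v)
    rw [norm_smul, norm_eLast, mul_one, Real.norm_of_nonneg ht] at h2
    rw [h1]
    linarith
  have key : ∀ t, 0 ≤ t → t ≤ s → |u (y' + t • eLast n) - u (y + t • eLast n)| ≤ ε * (s / 2) := by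
    intro t ht hts
    have h1 := hm t ht hts 0 (by rw [norm_zero]; positivity)
    rw [add_zero] at h1
    have h2 := h _ h1 (by rwa [add_smul_eLast_last hy0]) (y' - y) hv (hm t ht hts _ hd)
    rw [inner_zero_left, sub_zero, show y + t • eLast n + (y' - y) = y' + t • eLast n by abel] at h2
    exact h2.trans (mul_le_mul_of_nonneg_left hd hε)
  have h0 := key 0 le_rfl hs.le
  have h1 := key s hs.le le_rfl
  rw [zero_smul, add_zero, add_zero, hu'] at h0
  have h2 := chord_mul (u := u) (y := y) hs
  refine le_of_mul_le_mul_right ?_ hs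
  rw [h2]
  linarith [(abs_le.1 h0).1, (abs_le.1 h1).2]

lemma abs_chord_sub_le {y : Eucl n} {s m c : ℝ} (hs : 0 < s) (hy : u y = 0)
    (h1 : (m - c) * s ≤ u (y + s • eLast n)) (h2 : u (y + s • eLast n) ≤ (m + c) * s) :
    |chord u y s - m| ≤ c := by
  have h3 := chord_mul (u := u) (y := y) hs
  rw [hy, sub_zero] at h3
  rw [← h3] at h1 h2
  have h4 := le_of_mul_le_mul_right h1 hs
  have h5 := le_of_mul_le_mul_right h2 hs
  rw [abs_le]
  constructor <;> linarith

set_option maxHeartbeats 1000000 in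
lemma Sol.affine_contact (hs : Sol F F₀ u L ρ lam Lam M) {x₀ : Eucl n} (hx₀ : ‖x₀‖ < ρ)
    (hx₀t : x₀ (Fin.last n) = 0) (hu0 : u x₀ = 0) {η : ℝ} (hη : 0 < η) :
    ∃ r, 0 < r ∧ ∃ a : Eucl n, ∃ m : ℝ, ∀ y ∈ ball x₀ r, y (Fin.last n) = 0 → ∀ s, 0 < s → s < r →
      ∀ x ∈ ball y s, 0 ≤ x (Fin.last n) →
        |u x - u y - ⟪a, x - y⟫_ℝ - m * x (Fin.last n)| ≤ η * s := by
  obtain ⟨κ₁, hκ₁, h1⟩ := hs.chordFlat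
  obtain ⟨κ₂, hκ₂, h2⟩ := hs.flux_chord
  obtain ⟨κ₃, hκ₃, h3⟩ := hs.boundary_estimates
  have hlam := hs.lam_pos
  have hLam := hs.Lam_pos
  have hL : (0 : ℝ) ≤ L := L.coe_nonneg
  set A := (2 * κ₂ + 2 * κ₃ + 1) / lam with hA
  have hA0 : 0 < A := by positivity
  set c := A + (2 * κ₃ + 1) with hc
  set b := min η 1 with hb
  have hb0 : 0 < b := lt_min hη one_pos
  have hb1 : b ≤ 1 := min_le_right _ _
  set σ := b / (1 + c + κ₂) with hσd
  have hσC : σ * (1 + c + κ₂) = b := div_mul_cancel₀ _ (by positivity)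
  have hσ : 0 < σ := by positivity
  have hσ1 : 0 < A * σ := by positivity
  have hσ2 : 0 < κ₂ * σ := by positivity
  have hσκ₂ : σ ≤ κ₂ * σ := le_mul_of_one_le_left hσ.le hκ₂
  have hσκ₃ : σ ≤ κ₃ * σ := le_mul_of_one_le_left hσ.le hκ₃
  have hcσ : c * σ = A * σ + (2 * (κ₃ * σ) + σ) := by rw [hc]; ring
  have hAσ : ∀ d : ℝ, d ≤ (2 * κ₂ + 2 * κ₃ + 1) * σ → d / lam ≤ A * σ := by
    intro d hd
    have : A * σ = (2 * κ₂ + 2 * κ₃ + 1) * σ / lam := by rw [hA]; ring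
    rw [this]
    gcongr
  have hεκ : κ₁ * (σ / κ₁) = σ := mul_div_cancel₀ _ (by positivity)
  have hεσ : σ / κ₁ ≤ σ := div_le_self hσ.le hκ₁
  obtain ⟨r₀, hr₀, hflat⟩ := hs.tanFlat_contact hx₀ hx₀t hu0 (ε := σ / κ₁) (by positivity)
  have ha : ‖(0 : Eucl n)‖ ≤ L := by rw [norm_zero]; exact hL
  have ha0 : (0 : Eucl n) (Fin.last n) = 0 := rfl
  obtain ⟨r₁, hr₁, hcf⟩ := h1 (σ / κ₁) r₀ x₀ 0 (by positivity) (by rw [hεκ]; linarith) hr₀ hx₀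
    ha ha0 hflat
  rw [hεκ] at hcf
  obtain ⟨r₂, hr₂, hr₂₁, hfl⟩ := h2 σ r₁ x₀ 0 hσ (by linarith) hr₁ hx₀ ha ha0 hcf
  obtain ⟨s₀, hs₀, hs₀r, hs₀σ, hs₀ρ⟩ : ∃ s₀, 0 < s₀ ∧ s₀ < r₂ ∧ κ₃ * s₀ ≤ σ ∧ ‖x₀‖ + s₀ < ρ := by
    have hd : 0 < min (min r₂ σ) (ρ - ‖x₀‖) := by
      rw [lt_min_iff, lt_min_iff]; exact ⟨⟨hr₂, hσ⟩, by linarith⟩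
    have e1 : min (min r₂ σ) (ρ - ‖x₀‖) ≤ r₂ := (min_le_left _ _).trans (min_le_left _ _)
    have e2 : min (min r₂ σ) (ρ - ‖x₀‖) ≤ σ := (min_le_left _ _).trans (min_le_right _ _)
    have e3 : min (min r₂ σ) (ρ - ‖x₀‖) ≤ ρ - ‖x₀‖ := min_le_right _ _
    have e4 : min (min r₂ σ) (ρ - ‖x₀‖) / (2 * κ₃) * (2 * κ₃) = min (min r₂ σ) (ρ - ‖x₀‖) :=
      div_mul_cancel₀ _ (by positivity)
    set d := min (min r₂ σ) (ρ - ‖x₀‖) / (2 * κ₃)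
    have hd0 : 0 < d := by positivity
    have e5 : d ≤ κ₃ * d := le_mul_of_one_le_left hd0.le hκ₃
    exact ⟨d, hd0, by linarith, by linarith, by linarith⟩
  set m := chord u x₀ s₀ with hm
  have hmL : |m| ≤ L := abs_chord_le hs.lip x₀ hs₀
  have hgm := (hfl x₀ (mem_ball_self hr₂) hx₀t s₀ hs₀ hs₀r).1
  have hest : ∀ y ∈ ball x₀ (s₀ / 2), y (Fin.last n) = 0 → _ := fun y hy hy0 =>
    h3 (2 * σ) (s₀ / 2) m 0 y 0 (by positivity) (by linarith) (by positivity) (by linarith) hy0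
      (by linarith [norm_lt_of_mem_ball hy]) ha ha0 hmL (fun x hx hx0 => by
        have e1 := hcf x₀ (mem_ball_self hr₁) hx₀t s₀ hs₀ (by linarith) x
          (ball_subset_ball' (by linarith [mem_ball.1 hy]) hx) hx0
        rw [hu0, inner_zero_left] at e1
        rw [inner_zero_left]
        linarith)
  set k := Lam * (1 + L) with hk
  have hk0 : 0 < k := by positivity
  obtain ⟨r, hr, hrr₂, hrr₀, hrs₀, hrk⟩ : ∃ r, 0 < r ∧ r ≤ r₂ ∧ r ≤ r₀ / 4 ∧ κ₃ * r ≤ s₀ / 4 ∧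
      k * r ≤ σ := by
    have hd : 0 < min (min r₂ (r₀ / 4)) (min (s₀ / 4) σ) := by positivity
    have e1 : min (min r₂ (r₀ / 4)) (min (s₀ / 4) σ) ≤ r₂ :=
      (min_le_left _ _).trans (min_le_left _ _)
    have e2 : min (min r₂ (r₀ / 4)) (min (s₀ / 4) σ) ≤ r₀ / 4 :=
      (min_le_left _ _).trans (min_le_right _ _)
    have e3 : min (min r₂ (r₀ / 4)) (min (s₀ / 4) σ) ≤ s₀ / 4 :=
      (min_le_right _ _).trans (min_le_left _ _)
    have e4 : min (min r₂ (r₀ / 4)) (min (s₀ / 4) σ) ≤ σ :=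
      (min_le_right _ _).trans (min_le_right _ _)
    have e5 : min (min r₂ (r₀ / 4)) (min (s₀ / 4) σ) / (κ₃ + k) * (κ₃ + k) =
      min (min r₂ (r₀ / 4)) (min (s₀ / 4) σ) := div_mul_cancel₀ _ (by positivity)
    set d := min (min r₂ (r₀ / 4)) (min (s₀ / 4) σ) / (κ₃ + k)
    have hd0 : 0 < d := by positivity
    have e6 : d ≤ κ₃ * d := le_mul_of_one_le_left hd0.le hκ₃
    have e7 : 0 < k * d := by positivity
    exact ⟨d, hd0, by linarith, by linarith, by linarith, by linarith⟩
  have hrκ : r ≤ κ₃ * r := le_mul_of_one_le_left hr.le hκ₃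
  have hx₀b : x₀ ∈ ball (0 : Eucl n) ρ := mem_ball_zero_iff.2 hx₀
  refine ⟨r, hr, 0, m, ?_⟩
  have key := (hcf.mono (hrr₂.trans hr₂₁)).affine (m := m)
    (c := c * σ) (fun y hy hy0 s hs0 hsr => by
      have hch := abs_chord_le hs.lip y hs0
      have hκs : κ₃ * s < κ₃ * r := by gcongr
      have hyr := mem_ball.1 hy
      have hlow : ∀ y' ∈ ball x₀ (s₀ / 2), y' (Fin.last n) = 0 →
          (m - κ₃ * (2 * σ)) * s ≤ u (y' + s • eLast n) := fun y' hy' hy'0 =>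
        (hest y' hy' hy'0).2.2.1 rfl rfl s hs0.le (by linarith)
      by_cases hI : F x₀ (u x₀) (0 + m • eLast n) (Fin.last n) ≤ -(κ₃ * (2 * σ)) - σ
      · have hyb : y ∈ ball x₀ (s₀ / 2) := ball_subset_ball (by linarith) hy
        have e1 := hs.flux_last_close y x₀ (0 + m • eLast n) (0 + m • eLast n)
        rw [sub_self, norm_zero, add_zero, ← mul_assoc, ← hk] at e1
        have e2 : k * dist y x₀ ≤ k * r := by gcongr
        have e3 := (hest y hyb hy0).2.2.2 rfl rfl (by linarith [(abs_le.1 e1).2])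
        have e4 := e3 0 le_rfl (by linarith)
        rw [zero_smul, add_zero, mul_zero] at e4
        have e5 : u y = 0 := le_antisymm e4 (hs.nonneg y
          (mem_ball_zero_iff.2 (by linarith [norm_lt_of_mem_ball hyb])) hy0)
        exact (abs_chord_sub_le hs0 e5 (hlow y hyb hy0) (e3 s hs0.le (by linarith))).trans
          (by linarith)
      · rw [not_le] at hI
        obtain ⟨e1, e2⟩ := hfl y (ball_subset_ball hrr₂ hy) hy0 s hs0 (by linarith)
        have e3 := hs.flux_last_mono hx₀b ha hmL hch (c := κ₂ * σ + κ₃ * (2 * σ) + σ) (by positivity)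
          (by linarith)
        have e4 := hAσ (κ₂ * σ + κ₃ * (2 * σ) + σ) (by linarith)
        rw [abs_le]
        refine ⟨?_, by linarith⟩
        by_cases hpos : ∀ x ∈ closedBall y (s / 2), x (Fin.last n) = 0 → 0 < u x
        · have e5 := e2 hpos
          have e6 := hs.flux_last_mono hx₀b ha hch hmL (c := 2 * (κ₂ * σ)) (by positivity)
            (by linarith)
          have e7 := hAσ (2 * (κ₂ * σ)) (by linarith)
          linarith
        · push Not at hpos
          obtain ⟨y', hy', hy'0, huy'⟩ := hpos
          have hy'b : y' ∈ ball x₀ (s₀ / 2) := by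
            have := dist_triangle y' y x₀
            rw [mem_ball]
            linarith [mem_closedBall.1 hy']
          have e5 : u y' = 0 := le_antisymm huy' (hs.nonneg y'
            (mem_ball_zero_iff.2 (by linarith [norm_lt_of_mem_ball hy'b])) hy'0)
          have e6 := hflat.chord_lower (by positivity) hs0 (ball_subset_ball hrr₀ hy)
            (by linarith) hy0 hy' hy'0 e5 (hlow y' hy'b hy'0)
          linarith)
  intro y hy hy0 s hs0 hsr x hx hx0
  refine (key y hy hy0 s hs0 hsr x hx hx0).trans ?_
  gcongr
  linarith [min_le_left η 1]

/-- The gradient of `u` has small oscillation in half balls centred at boundary points. -/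
lemma Sol.gradient_osc (hs : Sol F F₀ u L ρ lam Lam M) {x₀ : Eucl n} (hx₀ : ‖x₀‖ < ρ)
    (hx₀t : x₀ (Fin.last n) = 0) {ε : ℝ} (hε : 0 < ε) :
    ∃ r, 0 < r ∧ ∃ b : Eucl n, ∀ x ∈ ball x₀ r, x ∈ upper n → ‖gradient u x - b‖ ≤ ε := by
  obtain ⟨c, ρ₀, hc, hρ₀, hgc⟩ := hs.gradient_close (half_pos hε)
  have haff : ∃ r, 0 < r ∧ ∃ a : Eucl n, ∃ m : ℝ, ∀ y ∈ ball x₀ r, y (Fin.last n) = 0 →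
      ∀ s, 0 < s → s < r → ∀ x ∈ ball y s, 0 ≤ x (Fin.last n) →
        |u x - u y - ⟪a, x - y⟫_ℝ - m * x (Fin.last n)| ≤ c * ε / 4 * s := by
    rcases (hs.nonneg x₀ (mem_ball_zero_iff.2 hx₀) hx₀t).lt_or_eq with h | h
    · exact hs.affine_noncontact hx₀ hx₀t h (by positivity)
    · exact hs.affine_contact hx₀ hx₀t h.symm (by positivity)
  obtain ⟨r, hr, a, m, haff⟩ := haff
  set d := min (min (r / 2) ρ₀) ((ρ - ‖x₀‖) / 2) with hd
  have hd0 : 0 < d := by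
    rw [hd, lt_min_iff, lt_min_iff]; exact ⟨⟨by positivity, hρ₀⟩, by linarith⟩
  have hdr : d ≤ r / 2 := (min_le_left _ _).trans (min_le_left _ _)
  have hdρ₀ : d ≤ ρ₀ := (min_le_left _ _).trans (min_le_right _ _)
  have hdρ : d ≤ (ρ - ‖x₀‖) / 2 := min_le_right _ _
  refine ⟨d, hd0, a + m • eLast n, fun x hx hxu => ?_⟩
  set t := x (Fin.last n) with ht
  have ht0 : 0 < t := hxu
  have hxd : ‖x - x₀‖ < d := by rw [← dist_eq_norm]; exact hx
  have htd : t < d := by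
    have h1 := abs_last_le (x - x₀)
    rw [sub_last_of_thin hx₀t] at h1
    linarith [le_abs_self t]
  have hy : tang x + t • eLast n = x := by rw [tang]; abel
  have hyb : tang x ∈ ball x₀ r := by
    have h1 := norm_tang_le (x - x₀)
    have h2 : tang (x - x₀) = tang x - x₀ := by
      rw [tang, tang, sub_last_of_thin hx₀t]; abel
    rw [mem_ball, dist_eq_norm, ← h2]
    linarith
  have hxy : dist x (tang x) = t := by
    rw [dist_eq_norm, tang, sub_sub_cancel, norm_smul, norm_eLast, mul_one,
      Real.norm_of_nonneg ht0.le]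
  have h := hgc x t ht0 (by linarith) (by linarith [norm_lt_of_mem_ball hx]) (fun z hz => by
    have h1 := abs_last_le (z - x)
    rw [mem_ball, dist_eq_norm] at hz
    have h2 : (z - x) (Fin.last n) = z (Fin.last n) - t := rfl
    rw [h2] at h1
    show 0 < z (Fin.last n)
    linarith [(abs_le.1 h1).1]) (a + m • eLast n) (u (tang x) + ⟪a, x - tang x⟫_ℝ + m * t)
    (c * ε / 2) (fun z hz => by
      have hzb : z ∈ ball (tang x) (2 * t) := ball_subset_ball' (by rw [hxy]; linarith) hz
      have hz0 : 0 ≤ z (Fin.last n) := by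
        have h1 := abs_last_le (z - x)
        rw [mem_ball, dist_eq_norm] at hz
        have h2 : (z - x) (Fin.last n) = z (Fin.last n) - t := rfl
        rw [h2] at h1
        linarith [(abs_le.1 h1).1]
      have h3 := haff (tang x) hyb (tang_last x) (2 * t) (by positivity) (by linarith) z hzb hz0
      have h4 : u z - (u (tang x) + ⟪a, x - tang x⟫_ℝ + m * t) - ⟪a + m • eLast n, z - x⟫_ℝ =
          u z - u (tang x) - ⟪a, z - tang x⟫_ℝ - m * z (Fin.last n) := by
        have h5 : (z - x) (Fin.last n) = z (Fin.last n) - t := rfl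
        rw [inner_add_left, real_inner_smul_left, real_inner_comm (z - x) (eLast n), inner_eLast, h5,
          inner_sub_right, inner_sub_right, inner_sub_right]
        ring
      rw [h4]
      linarith)
  have h5 : c * ε / 2 / c = ε / 2 := by field_simp
  rw [h5] at h
  linarith

lemma Sol.exists_tendsto_gradient (hs : Sol F F₀ u L ρ lam Lam M) {x₀ : Eucl n} (hx₀ : ‖x₀‖ < ρ)
    (hx₀t : x₀ (Fin.last n) = 0) : ∃ b, Tendsto (gradient u) (𝓝[upper n] x₀) (𝓝 b) := by
  have : (𝓝[upper n] x₀).NeBot := mem_closure_iff_nhdsWithin_neBot.1 (mem_closure_upper hx₀t.ge)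
  refine CompleteSpace.complete (f := map (gradient u) (𝓝[upper n] x₀)) ?_
  rw [Metric.cauchy_iff]
  refine ⟨inferInstance, fun ε hε => ?_⟩
  obtain ⟨r, hr, b, hb⟩ := hs.gradient_osc hx₀ hx₀t (ε := ε / 3) (by positivity)
  refine ⟨closedBall b (ε / 3), ?_, fun p hp q hq => ?_⟩
  · rw [mem_map, mem_nhdsWithin_iff_exists_mem_nhds_inter]
    exact ⟨ball x₀ r, ball_mem_nhds _ hr, fun x hx => by
      rw [Set.mem_preimage, mem_closedBall, dist_eq_norm]; exact hb x hx.1 hx.2⟩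
  · have := dist_triangle_right p q b
    linarith [mem_closedBall.1 hp, mem_closedBall.1 hq]

end ContactLimit

section Reduction

open TOP (H0 H1 BdrySolution AdmissibleBdry hBall tBall)

variable {F : Eucl n → ℝ → Eucl n → Eucl n} {F₀ : Eucl n → ℝ → Eucl n → ℝ} {g u : Eucl n → ℝ}

/-- A continuously differentiable map agrees with a globally Lipschitz one on the compact set of
arguments that matter. -/
lemma exists_lipschitz_extension {E : Type*} [NormedAddCommGroup E] [NormedSpace ℝ E]
    [FiniteDimensional ℝ E] {f : Eucl n → ℝ → Eucl n → E}
    (hf : ContDiffOn ℝ 1 (fun q : Eucl n × ℝ × Eucl n => f q.1 q.2.1 q.2.2)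
      (ball (0 : Eucl n) 1 ×ˢ (Set.univ : Set ℝ) ×ˢ (Set.univ : Set (Eucl n))))
    {ρ : ℝ} (hρ : ρ < 1) (M : ℝ) : ∃ f' : Eucl n → ℝ → Eucl n → E,
      (∃ C : ℝ, 0 < C ∧ ∀ x y z z' p q,
        ‖f' x z p - f' y z' q‖ ≤ C * (dist x y + |z - z'| + ‖p - q‖)) ∧
      ∀ x ∈ ball (0 : Eucl n) ρ, ∀ z, |z| ≤ M → ∀ p, ‖p‖ ≤ M → f' x z p = f x z p := by
  set K : Set (Eucl n × ℝ × Eucl n) :=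
    closedBall (0 : Eucl n) ρ ×ˢ closedBall (0 : ℝ) M ×ˢ closedBall (0 : Eucl n) M with hK
  have hsub : K ⊆ ball (0 : Eucl n) 1 ×ˢ (Set.univ : Set ℝ) ×ˢ (Set.univ : Set (Eucl n)) :=
    fun q hq => ⟨closedBall_subset_ball hρ hq.1, Set.mem_univ _, Set.mem_univ _⟩
  obtain ⟨C, hC⟩ := (hf.mono hsub).exists_lipschitzOnWith one_ne_zero
    ((convex_closedBall _ _).prod ((convex_closedBall _ _).prod (convex_closedBall _ _)))
    ((isCompact_closedBall _ _).prod ((isCompact_closedBall _ _).prod (isCompact_closedBall _ _)))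
  obtain ⟨C', G, hG, hGeq⟩ : ∃ C' : ℝ≥0, ∃ G : Eucl n × ℝ × Eucl n → E, LipschitzWith C' G ∧
      Set.EqOn (fun q : Eucl n × ℝ × Eucl n => f q.1 q.2.1 q.2.2) G K :=
    ⟨_, hC.extend_finite_dimension⟩
  have h1 : ∀ x y z z' p q, ‖G (x, z, p) - G (y, z', q)‖ ≤
      ((C' : ℝ) + 1) * (dist x y + |z - z'| + ‖p - q‖) := by
    intro x y z z' p q
    rw [← dist_eq_norm, ← dist_eq_norm p q, ← Real.dist_eq]
    refine (hG.dist_le_mul _ _).trans (mul_le_mul (by linarith) ?_ dist_nonneg (by positivity))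
    have h1 := dist_nonneg (x := x) (y := y)
    have h2 := dist_nonneg (x := z) (y := z')
    have h3 := dist_nonneg (x := p) (y := q)
    rw [Prod.dist_eq, Prod.dist_eq]
    exact max_le (by linarith) (max_le (by linarith) (by linarith))
  have h2 : ∀ x ∈ ball (0 : Eucl n) ρ, ∀ z, |z| ≤ M → ∀ p, ‖p‖ ≤ M → G (x, z, p) = f x z p := by
    intro x hx z hz p hp
    have h3 : z ∈ closedBall (0 : ℝ) M := by rwa [mem_closedBall, Real.dist_eq, sub_zero]
    have h4 : (x, z, p) ∈ K :=
      ⟨ball_subset_closedBall hx, h3, mem_closedBall_zero_iff.2 hp⟩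
    exact (hGeq h4).symm
  exact ⟨fun x z p => G (x, z, p), ⟨C' + 1, by positivity, h1⟩, h2⟩

/-- Ellipticity of the derivative gives strong monotonicity. -/
lemma inner_sub_ge_of_fderiv {f : Eucl n → Eucl n} {lam M : ℝ} (hf : Differentiable ℝ f)
    (h : ∀ p, ‖p‖ ≤ M → ∀ ξ, lam * ‖ξ‖ ^ 2 ≤ ⟪fderiv ℝ f p ξ, ξ⟫_ℝ) {p q : Eucl n}
    (hp : ‖p‖ ≤ M) (hq : ‖q‖ ≤ M) : lam * ‖p - q‖ ^ 2 ≤ ⟪f p - f q, p - q⟫_ℝ := by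
  have hd : ∀ t : ℝ, HasDerivAt (fun t : ℝ => ⟪f (q + t • (p - q)), p - q⟫_ℝ)
      ⟪fderiv ℝ f (q + t • (p - q)) (p - q), p - q⟫_ℝ t := by
    intro t
    have h1 : HasDerivAt (fun t : ℝ => q + t • (p - q)) (p - q) t := by
      simpa using ((hasDerivAt_id t).smul_const (p - q)).const_add q
    have h2 := (hf (q + t • (p - q))).hasFDerivAt.comp_hasDerivAt t h1
    simpa using h2.inner ℝ (hasDerivAt_const t (p - q))
  obtain ⟨t, ht, heq⟩ := exists_hasDerivAt_eq_slope _ _ zero_lt_one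
    (fun t _ => (hd t).continuousAt.continuousWithinAt) (fun t _ => hd t)
  rw [one_smul, zero_smul, add_zero, add_sub_cancel, sub_zero, div_one, ← inner_sub_left] at heq
  rw [← heq]
  refine h _ ?_ _
  have h3 : q + t • (p - q) ∈ closedBall (0 : Eucl n) M :=
    (convex_closedBall (0 : Eucl n) M).add_smul_sub_mem (mem_closedBall_zero_iff.2 hq)
      (mem_closedBall_zero_iff.2 hp) ⟨ht.1.le, ht.2.le⟩
  exact mem_closedBall_zero_iff.1 h3

lemma hBall_eq : hBall (0 : Eucl n) 1 = ball 0 1 ∩ upper n := rfl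

/-- A solution of the boundary obstacle problem gives a solution in the sense of `Sol`. -/
lemma exists_sol (hF : H0 F F₀) (hell : H1 F) (hu : BdrySolution F F₀ g u) {L : ℝ≥0}
    {U : Eucl n → ℝ} (hU : LipschitzWith L U)
    (hUu : Set.EqOn u U (closedBall 0 1 ∩ {x : Eucl n | 0 ≤ x (Fin.last n)}))
    {ρ : ℝ} (hρ0 : 0 < ρ) (hρ : ρ < 1) : ∃ F' F₀' lam Lam M, Sol F' F₀' U L ρ lam Lam M := by
  obtain ⟨⟨-, hug, hu0⟩, hvi⟩ := hu
  set M : ℝ := 10 * (L + 1) + (|U 0| + L) with hM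
  have hL : (0 : ℝ) ≤ L := L.coe_nonneg
  have hM0 : 0 < M := by positivity
  have hLM : (L : ℝ) ≤ M := by linarith [abs_nonneg (U 0)]
  have hUM : ∀ x ∈ ball (0 : Eucl n) ρ, |U x| ≤ M := by
    intro x hx
    rw [mem_ball_zero_iff] at hx
    have h1 := abs_diff_le hU 0 x
    rw [zero_add] at h1
    have h2 := abs_sub_abs_le_abs_sub (U x) (U 0)
    have h3 : L * ‖x‖ ≤ L * 1 := by gcongr; linarith
    linarith
  obtain ⟨F', ⟨C, hC, hFC⟩, hFF⟩ := exists_lipschitz_extension hF.1 hρ M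
  obtain ⟨F₀', ⟨C₀, hC₀, hFC₀⟩, hFF₀⟩ := exists_lipschitz_extension hF.2 hρ M
  obtain ⟨lam, hlam, hel⟩ := hell M hM0
  have hthin : ∀ x ∈ ball (0 : Eucl n) 1, x (Fin.last n) = 0 → 0 ≤ U x := fun x hx hx0 => by
    rw [← hUu ⟨ball_subset_closedBall hx, hx0.ge⟩]; exact hu0 x ⟨hx, hx0⟩
  refine ⟨F', F₀', lam, C + C₀, M, hU, hρ0, hρ.le, hlam, by positivity,
    by linarith [abs_nonneg (U 0)], hUM, fun x hx z hz p q hp hq => ?_, fun x y z z' p q => ?_,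
    fun x y z z' p q => ?_, fun x hx => hthin x (ball_subset_ball hρ.le hx),
    fun ζ hζ r hr hζr hζU => ?_⟩
  · rw [hFF x hx z hz p hp, hFF x hx z hz q hq]
    have hx1 : x ∈ ball (0 : Eucl n) 1 := ball_subset_ball hρ.le hx
    refine inner_sub_ge_of_fderiv (fun p => ?_) (hel x hx1 z hz) hp hq
    have h1 : ContDiffAt ℝ 1 (fun q : Eucl n × ℝ × Eucl n => F q.1 q.2.1 q.2.2) (x, z, p) :=
      hF.1.contDiffAt ((isOpen_ball.prod (isOpen_univ.prod isOpen_univ)).mem_nhds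
        ⟨hx1, Set.mem_univ _, Set.mem_univ _⟩)
    exact (h1.differentiableAt one_ne_zero).comp p
      (f := fun p : Eucl n => ((x, z, p) : Eucl n × ℝ × Eucl n)) (by fun_prop)
  · exact (hFC x y z z' p q).trans (by gcongr; linarith)
  · exact (hFC₀ x y z z' p q).trans (by gcongr; linarith)
  · obtain ⟨B, hB, hBζ⟩ := hζ
    have hζ1 : ∀ x, x ∉ ball (0 : Eucl n) ρ → ζ x = 0 := fun x hx =>
      hζr x fun h => hx (ball_subset_ball hr.le h)
    have hadm : AdmissibleBdry g fun x => U x + ζ x := by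
      refine ⟨⟨L + B, (hU.add hB).lipschitzOnWith⟩, fun x hx hx0 => ?_, fun x hx => ?_⟩
      · have h1 : ζ x = 0 := hζ1 x fun h => by
          rw [mem_ball_zero_iff] at h; linarith
        show U x + ζ x = g x
        rw [h1, add_zero, ← hug x hx hx0, hUu ⟨by rw [mem_closedBall_zero_iff, hx], hx0⟩]
      · by_cases h : x ∈ ball (0 : Eucl n) ρ
        · exact hζU x h hx.2
        · show 0 ≤ U x + ζ x
          rw [hζ1 x h, add_zero]; exact hthin x hx.1 hx.2
    have h := hvi _ hadm
    have hgrad : ∀ x ∈ hBall (0 : Eucl n) 1, gradient u x = gradient U x := fun x hx =>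
      gradient_congr (by
        filter_upwards [(isOpen_ball.inter isOpen_upper).mem_nhds hx] with y hy
        exact hUu ⟨ball_subset_closedBall hy.1, (show 0 < y (Fin.last n) from hy.2).le⟩)
    have heq : ∫ x in hBall (0 : Eucl n) 1, (⟪F x (u x) (gradient u x),
          gradient (fun x => U x + ζ x) x - gradient u x⟫_ℝ +
          F₀ x (u x) (gradient u x) * (U x + ζ x - u x)) =
        ∫ x in hBall (0 : Eucl n) 1, (⟪F' x (U x) (gradient U x), gradient ζ x⟫_ℝ +
          F₀' x (U x) (gradient U x) * ζ x) := by
      have hms : MeasurableSet (hBall (0 : Eucl n) 1) :=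
        (isOpen_ball.inter isOpen_upper).measurableSet
      refine setIntegral_congr_ae hms ?_
      filter_upwards [ae_hasGradientAt hU, ae_hasGradientAt hB] with x hx1 hx2 hx
      have h1 : gradient (fun x => U x + ζ x) x = gradient U x + gradient ζ x := by
        refine HasGradientAt.gradient ?_
        rw [hasGradientAt_iff_hasFDerivAt] at *
        rw [map_add]
        exact hx1.add hx2
      have h2 : u x = U x := hUu ⟨ball_subset_closedBall hx.1, (show 0 < x (Fin.last n) from hx.2).le⟩
      rw [h1, hgrad x hx, h2, add_sub_cancel_left, add_sub_cancel_left]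
      by_cases h3 : x ∈ ball (0 : Eucl n) ρ
      · have h4 := (norm_gradient_le hU x).trans hLM
        rw [hFF x h3 _ (hUM x h3) _ h4, hFF₀ x h3 _ (hUM x h3) _ h4]
      · rw [gradient_eq_zero_of_support hr hζr h3, hζ1 x h3]
        simp
    rw [heq, hBall_eq] at h
    rwa [setIntegral_eq_of_subset_of_forall_sdiff_eq_zero measurableSet_upper
      Set.inter_subset_right]
    intro x hx
    have h3 : x ∉ ball (0 : Eucl n) ρ := fun h => hx.2 ⟨ball_subset_ball hρ.le h, hx.1⟩
    rw [gradient_eq_zero_of_support hr hζr h3, hζ1 x h3]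
    simp

end Reduction

end Signorini

open TOP in
/-- `C¹` regularity up to the flat boundary for Lipschitz solutions
of the boundary (Signorini) obstacle problem in `B₁⁺`. -/
theorem boundary_obstacle_C1_regularity {n : ℕ} (hn : 1 ≤ n)
    (F : Eucl n → ℝ → Eucl n → Eucl n) (F₀ : Eucl n → ℝ → Eucl n → ℝ)
    (g u : Eucl n → ℝ)
    (hF : H0 F F₀) (hell : H1 F)
    (hu : BdrySolution F F₀ g u) :
    ∃ G : Eucl n → Eucl n,
      ContinuousOn G (hBall (0 : Eucl n) 1 ∪ tBall (0 : Eucl n) 1) ∧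
      ∀ x ∈ hBall (0 : Eucl n) 1, HasGradientAt u (G x) x := by
  obtain ⟨L, hL⟩ := hu.1.1
  obtain ⟨U, hU, hUu⟩ := hL.extend_real
  have hsol : ∀ x ∈ ball (0 : Eucl n) 1, ∃ ρ, ‖x‖ < ρ ∧ ∃ F' F₀' lam Lam M,
      Signorini.Sol F' F₀' U L ρ lam Lam M := by
    intro x hx
    rw [mem_ball_zero_iff] at hx
    exact ⟨(1 + ‖x‖) / 2, by linarith, Signorini.exists_sol hF hell hu hU hUu
      (by positivity) (by linarith)⟩
  have hlim : ∀ x ∈ hBall (0 : Eucl n) 1,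
      Tendsto (gradient U) (𝓝[Signorini.upper n] x) (𝓝 (gradient U x)) := by
    intro x hx
    obtain ⟨ρ, hxρ, _, _, _, _, _, hs⟩ := hsol x hx.1
    exact (hs.continuousAt_gradient (mem_ball_zero_iff.2 hxρ) hx.2).tendsto.mono_left
      nhdsWithin_le_nhds
  refine ⟨extendFrom (Signorini.upper n) (gradient U), continuousOn_extendFrom ?_ ?_, ?_⟩
  · rintro x (hx | hx)
    · exact subset_closure hx.2
    · exact Signorini.mem_closure_upper (show x (Fin.last n) = 0 from hx.2).ge
  · rintro x (hx | hx)
    · exact ⟨_, hlim x hx⟩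
    · obtain ⟨ρ, hxρ, _, _, _, _, _, hs⟩ := hsol x hx.1
      exact hs.exists_tendsto_gradient hxρ hx.2
  · intro x hx
    obtain ⟨ρ, hxρ, _, _, _, _, _, hs⟩ := hsol x hx.1
    rw [extendFrom_eq (subset_closure (s := Signorini.upper n) hx.2) (hlim x hx)]
    have h1 := hs.hasGradientAt (mem_ball_zero_iff.2 hxρ) hx.2
    refine h1.congr_of_eventuallyEq ?_
    filter_upwards [(isOpen_ball.inter Signorini.isOpen_upper).mem_nhds hx] with y hy
    exact hUu ⟨ball_subset_closedBall hy.1, (show 0 < y (Fin.last n) from hy.2).le⟩
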